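/- arXiv:1206.1949 — 2 statements merged into one kernel-verified Lean document; each statement's English description precedes it below -/
import Mathlib

section
/- Let X be an open subset of ℕ → ℝ (product topology). Then the hyperspace mpcc(X) of all nonempty compact max-plus convex subsets of ℕ → ℝ that are contained in X, topologized by the Hausdorff metric (equivalently, the Vietoris topology), is homeomorphic to X. -/
/-- Max-plus convexity. -/
def MaxPlusConvex {ι : Type*} (A : Set (ι → ℝ)) : Prop :=
  ∀ a ∈ A, ∀ b ∈ A, ∀ t : ℝ, t ≤ 0 → (fun i => max (a i) (t + b i)) ∈ A

/-- The Vietoris topology on a family of subsets of a topological space `X`;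
on nonempty compact subsets of `ℕ → ℝ` it coincides with the Hausdorff metric topology. -/
def vietoris {X : Type*} [TopologicalSpace X] (P : Set X → Prop) :
    TopologicalSpace {A : Set X // P A} :=
  TopologicalSpace.generateFrom
    {S | ∃ U : Set X, IsOpen U ∧
      (S = {K : {A : Set X // P A} | (K : Set X) ⊆ U} ∨
        S = {K : {A : Set X // P A} | ((K : Set X) ∩ U).Nonempty})}

/-- The hyperspace of nonempty compact max-plus convex subsets of `ℕ → ℝ`
contained in a given subset `X`. -/
abbrev MPCCIn (X : Set (ℕ → ℝ)) :=
  {A : Set (ℕ → ℝ) // A.Nonempty ∧ IsCompact A ∧ MaxPlusConvex A ∧ A ⊆ X}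

open Set Filter Topology Function

/-- The distance to the complement of `W`, truncated at `1`. -/
noncomputable def gap {α : Type*} [PseudoEMetricSpace α] (W : Set α) (x : α) : ℝ :=
  (min 1 (Metric.infEDist x Wᶜ)).toReal

section Gap

variable {α : Type*} [PseudoEMetricSpace α] {W : Set α}

theorem min_one_ne_top (a : ENNReal) : min 1 a ≠ ⊤ :=
  ne_top_of_le_ne_top ENNReal.one_ne_top (min_le_left _ _)

theorem continuous_gap (W : Set α) : Continuous (gap W) := by
  refine ENNReal.continuousOn_toReal.comp_continuous
    (continuous_const.min Metric.continuous_infEDist) fun x => ?_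
  exact min_one_ne_top _

theorem gap_nonneg (W : Set α) (x : α) : 0 ≤ gap W x := ENNReal.toReal_nonneg

theorem gap_pos_iff (hW : IsOpen W) {x : α} : 0 < gap W x ↔ x ∈ W := by
  rw [gap, ENNReal.toReal_pos_iff]
  have h1 : min 1 (Metric.infEDist x Wᶜ) < ⊤ := (min_one_ne_top _).lt_top
  have h2 := Metric.mem_iff_infEDist_zero_of_closed (x := x) hW.isClosed_compl
  simp only [h1, and_true, lt_min_iff, pos_iff_ne_zero, ne_eq, ← h2]
  simp

theorem gap_mono_of_edist {x y : α}
    (h : ∀ y' ∉ W, ∃ x' ∉ W, edist x x' ≤ edist y y') : gap W x ≤ gap W y := by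
  refine ENNReal.toReal_mono (min_one_ne_top _) (min_le_min_left _ ?_)
  refine Metric.le_infEDist.2 fun y' hy' => ?_
  obtain ⟨x', hx', hd⟩ := h y' hy'
  exact (Metric.infEDist_le_edist_of_mem hx').trans hd

end Gap

theorem exists_le_add_inv {I : Set ℝ} (hI : IsOpen I) (hc : I.OrdConnected) {u : ℝ → ℝ}
    (hu : Continuous u) (hpos : ∀ s, 0 < u s ↔ ∃ s' ∈ I, s ≤ s') (hn : ∀ s, 0 ≤ u s)
    {s₀ : ℝ} (hs₀ : s₀ ∈ I) (M : ℝ) : ∃ s ∈ I, s₀ ≤ s ∧ M ≤ s + (u s)⁻¹ := by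
  by_cases hb : BddAbove I
  · set β := sSup I with hβ
    have hβI : β ∉ I := fun h => by
      obtain ⟨ε, hε, hball⟩ := Metric.isOpen_iff.1 hI β h
      have : β + ε / 2 ∈ I := hball (by simp [abs_of_pos hε, hε])
      have := le_csSup hb this
      linarith
    have h0 : u β = 0 := by
      refine le_antisymm (not_lt.1 fun h => ?_) (hn _)
      obtain ⟨s', hs', h'⟩ := (hpos β).1 h
      exact hβI (le_antisymm h' (le_csSup hb hs') ▸ hs')
    have hlt : s₀ < β := lt_of_le_of_ne (le_csSup hb hs₀) fun h => hβI (h ▸ hs₀)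
    set R := |M| + |s₀| + 1 with hR
    have hRpos : 0 < R := by positivity
    have hev : ∀ᶠ s in 𝓝 β, u s < R⁻¹ :=
      hu.continuousAt.eventually_lt continuousAt_const (by rw [h0]; positivity)
    have hev2 : ∀ᶠ s in 𝓝[<] β, u s < R⁻¹ ∧ s₀ < s :=
      (hev.filter_mono nhdsWithin_le_nhds).and
        ((eventually_gt_nhds hlt).filter_mono nhdsWithin_le_nhds)
    obtain ⟨s, ⟨hs1, hs2⟩, hs3⟩ := (hev2.and self_mem_nhdsWithin).exists
    obtain ⟨s', hs', hss'⟩ := exists_lt_of_lt_csSup ⟨s₀, hs₀⟩ (show s < sSup I from hs3)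
    have hsI : s ∈ I := hc.out hs₀ hs' ⟨hs2.le, hss'.le⟩
    refine ⟨s, hsI, hs2.le, ?_⟩
    have hup : 0 < u s := (hpos s).2 ⟨s, hsI, le_rfl⟩
    have : R ≤ (u s)⁻¹ := by
      rw [← inv_inv R]; exact inv_anti₀ hup hs1.le
    have := le_abs_self M
    have := neg_abs_le s₀
    linarith
  · rw [not_bddAbove_iff] at hb
    obtain ⟨s, hs, h⟩ := hb (max s₀ M)
    refine ⟨s, hs, (le_max_left _ _).trans h.le, ?_⟩
    have := inv_nonneg.2 (hn s)
    have := le_max_right s₀ M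
    linarith

/-- Fibrewise open intervals over a metrizable base can be stretched to full lines. -/
theorem exists_stretch {B : Type*} [TopologicalSpace B] [TopologicalSpace.MetrizableSpace B]
    {O : Set (B × ℝ)} (hO : IsOpen O) (hc : ∀ b, {s | (b, s) ∈ O}.OrdConnected) :
    ∃ h g : B × ℝ → ℝ, ContinuousOn h O ∧
      (∀ b s t, (b, s) ∈ O → (b, t) ∈ O → s < t → h (b, s) < h (b, t)) ∧
      (∀ b, (∃ s, (b, s) ∈ O) → ∀ v, (b, g (b, v)) ∈ O ∧ h (b, g (b, v)) = v) := by
  let _ := TopologicalSpace.metrizableSpaceMetric B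
  have key : ∀ c : ℝ, IsOpen {x : B × ℝ | (x.1, x.2 + c) ∈ O} := fun c =>
    hO.preimage (by fun_prop)
  let Wp : Set (B × ℝ) := {x | ∃ s', (x.1, s') ∈ O ∧ x.2 ≤ s'}
  let Wm : Set (B × ℝ) := {x | ∃ s', (x.1, s') ∈ O ∧ s' ≤ x.2}
  have hWp : IsOpen Wp := by
    have : Wp = ⋃ c ∈ Ici (0 : ℝ), {x : B × ℝ | (x.1, x.2 + c) ∈ O} := by
      ext x
      simp only [Wp, mem_ofPred_eq, mem_iUnion, mem_Ici, exists_prop]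
      exact ⟨fun ⟨s, h, h'⟩ => ⟨s - x.2, by linarith, by simpa using h⟩,
        fun ⟨c, h, h'⟩ => ⟨x.2 + c, h', by linarith⟩⟩
    rw [this]
    exact isOpen_biUnion fun c _ => key c
  have hWm : IsOpen Wm := by
    have : Wm = ⋃ c ∈ Iic (0 : ℝ), {x : B × ℝ | (x.1, x.2 + c) ∈ O} := by
      ext x
      simp only [Wm, mem_ofPred_eq, mem_iUnion, mem_Iic, exists_prop]
      exact ⟨fun ⟨s, h, h'⟩ => ⟨s - x.2, by linarith, by simpa using h⟩,
        fun ⟨c, h, h'⟩ => ⟨x.2 + c, h', by linarith⟩⟩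
    rw [this]
    exact isOpen_biUnion fun c _ => key c
  have hOp : O ⊆ Wp := fun x hx => ⟨x.2, hx, le_rfl⟩
  have hOm : O ⊆ Wm := fun x hx => ⟨x.2, hx, le_rfl⟩
  have anti : ∀ b s t, s ≤ t → gap Wp (b, t) ≤ gap Wp (b, s) := by
    intro b s t hst
    refine gap_mono_of_edist fun y hy => ⟨(y.1, y.2 + (t - s)), ?_, ?_⟩
    · rintro ⟨s', hs', h'⟩
      exact hy ⟨s', hs', by simp only at h'; linarith⟩
    · rw [edist_dist, edist_dist, Prod.dist_eq, Prod.dist_eq, Real.dist_eq, Real.dist_eq]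
      simp only [show t - (y.2 + (t - s)) = s - y.2 by ring, le_refl]
  have mono : ∀ b s t, s ≤ t → gap Wm (b, s) ≤ gap Wm (b, t) := by
    intro b s t hst
    refine gap_mono_of_edist fun y hy => ⟨(y.1, y.2 + (s - t)), ?_, ?_⟩
    · rintro ⟨s', hs', h'⟩
      exact hy ⟨s', hs', by simp only at h'; linarith⟩
    · rw [edist_dist, edist_dist, Prod.dist_eq, Prod.dist_eq, Real.dist_eq, Real.dist_eq]
      simp only [show s - (y.2 + (s - t)) = t - y.2 by ring, le_refl]
  let h : B × ℝ → ℝ := fun x => x.2 + (gap Wp x)⁻¹ - (gap Wm x)⁻¹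
  have hh : ContinuousOn h O := by
    refine (continuousOn_snd.add ((continuous_gap _).continuousOn.inv₀ fun x hx => ?_)).sub
      ((continuous_gap _).continuousOn.inv₀ fun x hx => ?_)
    · exact ((gap_pos_iff hWp).2 (hOp hx)).ne'
    · exact ((gap_pos_iff hWm).2 (hOm hx)).ne'
  have hstrict : ∀ b s t, (b, s) ∈ O → (b, t) ∈ O → s < t → h (b, s) < h (b, t) := by
    intro b s t hs ht hst
    have h1 : (gap Wp (b, s))⁻¹ ≤ (gap Wp (b, t))⁻¹ :=
      inv_anti₀ ((gap_pos_iff hWp).2 (hOp ht)) (anti _ _ _ hst.le)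
    have h2 : (gap Wm (b, t))⁻¹ ≤ (gap Wm (b, s))⁻¹ :=
      inv_anti₀ ((gap_pos_iff hWm).2 (hOm hs)) (mono _ _ _ hst.le)
    simp only [h]; linarith
  have hsurj : ∀ b, (∃ s, (b, s) ∈ O) → ∀ v, ∃ s, (b, s) ∈ O ∧ h (b, s) = v := by
    rintro b ⟨s₀, hs₀⟩ v
    have hIo : IsOpen {s | (b, s) ∈ O} := hO.preimage (by fun_prop)
    obtain ⟨t, ht, hst, hvt⟩ := exists_le_add_inv hIo (hc b) (u := fun s => gap Wp (b, s))
      ((continuous_gap _).comp (by fun_prop)) (fun s => gap_pos_iff hWp)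
      (fun s => gap_nonneg _ _) hs₀ (v + (gap Wm (b, s₀))⁻¹)
    obtain ⟨r, hr, hsr, hvr⟩ := exists_le_add_inv (I := {s | (b, -s) ∈ O})
      (hIo.preimage continuous_neg) ⟨fun x hx y hy z hz => (hc b).out hy hx
        ⟨neg_le_neg hz.2, neg_le_neg hz.1⟩⟩ (u := fun s => gap Wm (b, -s))
      ((continuous_gap _).comp (by fun_prop))
      (fun s => (gap_pos_iff hWm).trans ⟨fun ⟨s', a, a'⟩ => ⟨-s', by simpa using a, by
        simp only at a'; linarith⟩, fun ⟨s', a, a'⟩ => ⟨-s', a, by simpa using a'⟩⟩)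
      (fun s => gap_nonneg _ _) (s₀ := -s₀) (by simpa using hs₀) (-v + (gap Wp (b, s₀))⁻¹)
    have e1 : v ≤ h (b, t) := by
      have : (gap Wm (b, t))⁻¹ ≤ (gap Wm (b, s₀))⁻¹ :=
        inv_anti₀ ((gap_pos_iff hWm).2 (hOm hs₀)) (mono _ _ _ hst)
      simp only [h]; linarith
    have e2 : h (b, -r) ≤ v := by
      have : (gap Wp (b, -r))⁻¹ ≤ (gap Wp (b, s₀))⁻¹ :=
        inv_anti₀ ((gap_pos_iff hWp).2 (hOp hs₀)) (anti _ _ _ (by linarith))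
      simp only [h]; linarith
    have hsub : Icc (-r) t ⊆ {s | (b, s) ∈ O} := (hc b).out hr ht
    obtain ⟨s, hs, hv⟩ := intermediate_value_Icc (by linarith : -r ≤ t)
      (hh.comp (f := fun s => (b, s)) (by fun_prop) hsub) ⟨e2, e1⟩
    exact ⟨s, hsub hs, hv⟩
  classical
  refine ⟨h, fun x => if H : ∃ s, (x.1, s) ∈ O then (hsurj x.1 H x.2).choose else 0,
    hh, hstrict, fun b H v => ?_⟩
  have := (hsurj b H v).choose_spec
  simpa only [dif_pos H] using this

/-- The fibrewise inverse of a fibrewise strictly increasing map is continuous. -/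
theorem continuousOn_fibre_inverse {B : Type*} [TopologicalSpace B]
    {O : Set (B × ℝ)} (hO : IsOpen O) {h g : B × ℝ → ℝ} (hh : ContinuousOn h O)
    (hstrict : ∀ b s t, (b, s) ∈ O → (b, t) ∈ O → s < t → h (b, s) < h (b, t))
    (hg : ∀ b, (∃ s, (b, s) ∈ O) → ∀ v, (b, g (b, v)) ∈ O ∧ h (b, g (b, v)) = v) :
    ContinuousOn g {x | ∃ s, (x.1, s) ∈ O} := by
  rintro ⟨b, v⟩ H
  have hg0 := hg b H v
  have hmono : ∀ b s t, (b, s) ∈ O → (b, t) ∈ O → h (b, s) < h (b, t) → s < t := by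
    intro b s t hs ht hlt
    by_contra hle
    rcases (not_lt.1 hle).lt_or_eq with h' | h'
    · exact (hstrict b t s ht hs h').not_gt hlt
    · subst h'; exact lt_irrefl _ hlt
  have hIo : IsOpen {s | (b, s) ∈ O} := hO.preimage (by fun_prop)
  have near : ∀ s, (b, s) ∈ O → ∀ᶠ x : B × ℝ in 𝓝 (b, v), (x.1, s) ∈ O := fun s hs =>
    (hO.preimage (f := fun x : B × ℝ => (x.1, s)) (by fun_prop)).mem_nhds hs
  have cont : ∀ s, (b, s) ∈ O → ContinuousAt (fun x : B × ℝ => h (x.1, s)) (b, v) := fun s hs =>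
    ContinuousAt.comp (f := fun x : B × ℝ => (x.1, s)) (g := h)
      (hh.continuousAt (hO.mem_nhds hs)) (by fun_prop)
  refine tendsto_order.2 ⟨fun a ha => ?_, fun a ha => ?_⟩
  · have : ∀ᶠ s in 𝓝[<] (g (b, v)), (b, s) ∈ O ∧ a < s :=
      ((hIo.eventually_mem hg0.1).and
        (eventually_gt_nhds ha)).filter_mono nhdsWithin_le_nhds
    obtain ⟨s, ⟨hs, has⟩, hsg⟩ := (this.and self_mem_nhdsWithin).exists
    have hlt : h (b, s) < v := (hstrict b _ _ hs hg0.1 hsg).trans_eq hg0.2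
    filter_upwards [self_mem_nhdsWithin, nhdsWithin_le_nhds (near s hs), nhdsWithin_le_nhds
      ((cont s hs).eventually_lt continuousAt_snd hlt)] with x hx1 hx2 hx3
    refine has.trans (hmono x.1 _ _ hx2 (hg _ hx1 _).1 ?_)
    rwa [(hg _ hx1 _).2]
  · have : ∀ᶠ s in 𝓝[>] (g (b, v)), (b, s) ∈ O ∧ s < a :=
      ((hIo.eventually_mem hg0.1).and
        (eventually_lt_nhds ha)).filter_mono nhdsWithin_le_nhds
    obtain ⟨s, ⟨hs, has⟩, hsg⟩ := (this.and self_mem_nhdsWithin).exists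
    have hlt : v < h (b, s) := hg0.2.symm.trans_lt (hstrict b _ _ hg0.1 hs hsg)
    filter_upwards [self_mem_nhdsWithin, nhdsWithin_le_nhds (near s hs), nhdsWithin_le_nhds
      (continuousAt_snd.eventually_lt (cont s hs) hlt)] with x hx1 hx2 hx3
    refine (hmono x.1 _ _ (hg _ hx1 _).1 hx2 ?_).trans has
    rwa [(hg _ hx1 _).2]

/-- Keep the first `n` coordinates and replace the others by `0`. -/
def trunc {R : Type*} [Zero R] (n : ℕ) (e : ℕ → R) : ℕ → R := fun i => if i < n then e i else 0

section Trunc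

variable {R : Type*} [Zero R]

theorem trunc_apply {n i : ℕ} (h : i < n) (e : ℕ → R) : trunc n e i = e i := if_pos h

theorem continuous_trunc [TopologicalSpace R] (n : ℕ) : Continuous (trunc n : (ℕ → R) → ℕ → R) := by
  refine continuous_pi fun i => ?_
  by_cases h : i < n
  · simpa only [trunc, if_pos h] using continuous_apply i
  · simpa only [trunc, if_neg h] using continuous_const

theorem trunc_congr {n : ℕ} {e e' : ℕ → R} (h : ∀ i < n, e i = e' i) : trunc n e = trunc n e' := by
  funext i
  by_cases hi : i < n <;> simp [trunc, hi, h]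

theorem trunc_succ (n : ℕ) (e : ℕ → R) : trunc (n + 1) e = update (trunc n e) n (e n) := by
  funext i
  rcases lt_trichotomy i n with h | h | h
  · simp [trunc, h, h.ne, Nat.lt_succ_of_lt h]
  · subst h; simp [trunc]
  · simp [trunc, h.ne', h.not_gt, Nat.not_lt.2 (Nat.succ_le_of_lt h)]

end Trunc

/-- A tower of open sets over a metrizable base in which each stage constrains one further
coordinate to a nonempty open interval is trivial. -/
theorem nonempty_homeomorph_tower {P : Type*} [TopologicalSpace P]
    [TopologicalSpace.MetrizableSpace P] (D : ℕ → Set (P × (ℕ → ℝ)))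
    (hopen : ∀ n, IsOpen (D n))
    (hdep : ∀ n p e e', (∀ i < n, e i = e' i) → (p, e) ∈ D n → (p, e') ∈ D n)
    (hzero : D 0 = univ)
    (hne : ∀ n p e, (p, e) ∈ D n → ∃ s, (p, update e n s) ∈ D (n + 1))
    (hord : ∀ n p e, {s | (p, update e n s) ∈ D (n + 1)}.OrdConnected) :
    Nonempty (↥(⋂ n, D n) ≃ₜ P × (ℕ → ℝ)) := by
  let O : ℕ → Set ((P × (ℕ → ℝ)) × ℝ) := fun n => {x | (x.1.1, update x.1.2 n x.2) ∈ D (n + 1)}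
  have hO : ∀ n, IsOpen (O n) := fun n => (hopen (n + 1)).preimage
    (continuous_fst.fst.prodMk (continuous_fst.snd.update n continuous_snd))
  have hst := fun n => exists_stretch (hO n) fun b => hord n b.1 b.2
  choose h g hh hstrict hg using hst
  have hgc := fun n => continuousOn_fibre_inverse (hO n) (hh n) (hstrict n) (hg n)
  -- the prefixes of the inverse image of `z`
  let w : P × (ℕ → ℝ) → ℕ → (ℕ → ℝ) := fun x n =>
    Nat.rec (fun _ => 0) (fun k a => update a k (g k ((x.1, a), x.2 k))) n
  have w0 : ∀ x, w x 0 = fun _ => 0 := fun x => rfl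
  have ws : ∀ x n, w x (n + 1) = update (w x n) n (g n ((x.1, w x n), x.2 n)) := fun x n => rfl
  have wD : ∀ x n, (x.1, w x n) ∈ D n := by
    intro x n
    induction n with
    | zero => simp [hzero]
    | succ n ih =>
      rw [ws]
      exact (hg n (x.1, w x n) (hne n _ _ ih) (x.2 n)).1
  have wc : ∀ n, Continuous fun x => w x n := by
    intro n
    induction n with
    | zero => exact continuous_const
    | succ n ih =>
      simp only [ws]
      refine ih.update n ((hgc n).comp_continuous
        ((continuous_fst.prodMk ih).prodMk ((continuous_apply n).comp continuous_snd)) fun x => ?_)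
      exact hne n _ _ (wD x n)
  have wlt : ∀ x n i, i < n → w x n i = w x (i + 1) i := by
    intro x n i hi
    induction n with
    | zero => omega
    | succ n ih =>
      rcases Nat.lt_succ_iff_lt_or_eq.1 hi with h' | h'
      · rw [ws, update_of_ne h'.ne, ih h']
      · rw [h']
  have wge : ∀ x n i, n ≤ i → w x n i = 0 := by
    intro x n i hi
    induction n with
    | zero => rfl
    | succ n ih => rw [ws, update_of_ne (by omega), ih (by omega)]
  let v : P × (ℕ → ℝ) → ℕ → ℝ := fun x i => w x (i + 1) i
  have trv : ∀ x n, trunc n (v x) = w x n := by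
    intro x n
    funext i
    by_cases hi : i < n
    · rw [trunc_apply hi, wlt x n i hi]
    · simp only [trunc, hi, if_false]; rw [wge x n i (by omega)]
  have hv : ∀ x, (x.1, v x) ∈ ⋂ n, D n := fun x => mem_iInter.2 fun n =>
    hdep n _ _ _ (fun i hi => wlt x n i hi) (wD x n)
  have hOmem : ∀ y ∈ ⋂ n, D n, ∀ n, ((y.1, trunc n y.2), y.2 n) ∈ O n := by
    intro y hy n
    have := mem_iInter.1 hy (n + 1)
    refine hdep (n + 1) y.1 y.2 _ (fun i hi => ?_) this
    rw [← trunc_succ, trunc_apply hi]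
  let fwd : ↥(⋂ n, D n) → P × (ℕ → ℝ) := fun y =>
    (y.1.1, fun n => h n ((y.1.1, trunc n y.1.2), y.1.2 n))
  refine ⟨⟨⟨fwd, fun x => ⟨(x.1, v x), hv x⟩, fun y => ?_, fun x => ?_⟩, ?_, ?_⟩⟩
  · have key : ∀ n, w (fwd y) n = trunc n y.1.2 := by
      intro n
      induction n with
      | zero => funext i; simp [w0, trunc]
      | succ n ih =>
        have hy := hOmem y.1 y.2 n
        have hg' := hg n (y.1.1, trunc n y.1.2) ⟨_, hy⟩ (h n ((y.1.1, trunc n y.1.2), y.1.2 n))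
        rw [ws, trunc_succ, ih]
        congr 1
        change g n ((y.1.1, trunc n y.1.2), h n ((y.1.1, trunc n y.1.2), y.1.2 n)) = y.1.2 n
        rcases lt_trichotomy (g n ((y.1.1, trunc n y.1.2), h n ((y.1.1, trunc n y.1.2), y.1.2 n)))
          (y.1.2 n) with h' | h' | h'
        · exact absurd hg'.2 (hstrict n _ _ _ hg'.1 hy h').ne
        · exact h'
        · exact absurd hg'.2 (hstrict n _ _ _ hy hg'.1 h').ne'
    refine Subtype.ext (Prod.ext rfl ?_)
    funext i
    exact (congrFun (key (i + 1)) i).trans (trunc_apply (Nat.lt_succ_self i) _)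
  · refine Prod.ext rfl ?_
    funext n
    change h n ((x.1, trunc n (v x)), v x n) = x.2 n
    rw [trv]
    have := (hg n (x.1, w x n) (hne n _ _ (wD x n)) (x.2 n)).2
    simpa only [v, ws, update_self] using this
  · refine (continuous_fst.comp continuous_subtype_val).prodMk (continuous_pi fun n => ?_)
    refine (hh n).comp_continuous ?_ fun y => hOmem y.1 y.2 n
    have h1 : Continuous fun y : ↥(⋂ n, D n) => y.1.2 := continuous_snd.comp continuous_subtype_val
    exact ((continuous_fst.comp continuous_subtype_val).prodMk
      ((continuous_trunc n).comp h1)).prodMk ((continuous_apply n).comp h1)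
  · refine (continuous_fst.prodMk (continuous_pi fun i => ?_)).subtype_mk _
    exact (continuous_apply i).comp (wc (i + 1))

/-- The inverse of `w ↦ w / (1 + |w|)` on `(-1, 1)`. -/
noncomputable def unsquash (u : ℝ) : ℝ := u / (1 - |u|)

theorem unsquash_mono {u v : ℝ} (hu : |u| < 1) (hv : |v| < 1) (h : u ≤ v) :
    unsquash u ≤ unsquash v := by
  unfold unsquash
  rw [div_le_div_iff₀ (by linarith) (by linarith)]
  rcases abs_cases u with ⟨h1, h1'⟩ | ⟨h1, h1'⟩ <;>
    rcases abs_cases v with ⟨h2, h2'⟩ | ⟨h2, h2'⟩ <;>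
    rw [h1, h2] <;> nlinarith

theorem abs_le_of_unsquash {u R : ℝ} (hu : |u| < 1) (h : |unsquash u| ≤ R) :
    |u| ≤ R / (1 + R) := by
  have hR : 0 ≤ R := (abs_nonneg _).trans h
  have h1 : 0 < 1 - |u| := by linarith
  rw [unsquash, abs_div, abs_of_pos h1, div_le_iff₀ h1] at h
  rw [le_div_iff₀ (by linarith)]
  linarith

section Fat

variable {Y : Type*}

/-- The quantities recorded by the coordinates of the thickened graph: even coordinates record
the functions `f n`, odd coordinates record how far inside the tube the earlier ones are. -/
noncomputable def record (f : ℕ → Y × (ℕ → ℝ) → ℝ) (j : ℕ) (x : Y × (ℕ → ℝ)) : ℝ :=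
  if j % 2 = 0 then f (j / 2) x
  else unsquash (2 ^ (j / 2) * (x.2 (j / 2) - record f (j / 2) x))
termination_by j
decreasing_by omega

/-- The thickened graph of the first `m` recorded quantities. -/
def tube (f : ℕ → Y × (ℕ → ℝ) → ℝ) (m : ℕ) : Set (Y × (ℕ → ℝ)) :=
  {x | ∀ j < m, |x.2 j - record f j x| < (1 / 2) ^ j}

variable {f : ℕ → Y × (ℕ → ℝ) → ℝ}

theorem record_even (n : ℕ) (x : Y × (ℕ → ℝ)) : record f (2 * n) x = f n x := by
  rw [record]; simp

theorem record_odd (n : ℕ) (x : Y × (ℕ → ℝ)) :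
    record f (2 * n + 1) x = unsquash (2 ^ n * (x.2 n - record f n x)) := by
  rw [record]
  have h1 : (2 * n + 1) / 2 = n := by omega
  have h2 : (2 * n + 1) % 2 = 1 := by omega
  simp [h1, h2]

theorem tube_succ (m : ℕ) :
    tube f (m + 1) = tube f m ∩ {x | |x.2 m - record f m x| < (1 / 2) ^ m} := by
  ext x
  constructor
  · exact fun h => ⟨fun j hj => h j (by omega), h m (by omega)⟩
  · rintro ⟨h, h'⟩ j hj
    rcases Nat.lt_succ_iff_lt_or_eq.1 hj with hj | rfl
    exacts [h j hj, h']

theorem tube_anti {m m' : ℕ} (h : m ≤ m') : tube f m' ⊆ tube f m :=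
  fun _ hx j hj => hx j (hj.trans_le h)

theorem abs_scaled_lt {a : ℝ} {n : ℕ} : |2 ^ n * a| < 1 ↔ |a| < (1 / 2) ^ n := by
  rw [abs_mul, abs_of_pos (by positivity : (0 : ℝ) < 2 ^ n), one_div, inv_pow,
    ← lt_inv_mul_iff₀ (by positivity), mul_one]

theorem record_congr (hdep : ∀ n y e e', (∀ i < 2 * n, e i = e' i) → f n (y, e) = f n (y, e'))
    (j : ℕ) (y : Y) (e e' : ℕ → ℝ) (h : ∀ i < j, e i = e' i) :
    record f j (y, e) = record f j (y, e') := by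
  induction j using Nat.strong_induction_on with
  | _ j ih =>
    rcases Nat.even_or_odd' j with ⟨n, rfl | rfl⟩
    · rw [record_even, record_even, hdep n y e e' h]
    · rw [record_odd, record_odd, ih n (by omega) fun i hi => h i (by omega)]
      simp only [h n (by omega)]

theorem tube_congr (hdep : ∀ n y e e', (∀ i < 2 * n, e i = e' i) → f n (y, e) = f n (y, e'))
    (m : ℕ) (y : Y) (e e' : ℕ → ℝ) (h : ∀ i < m, e i = e' i) (hy : (y, e) ∈ tube f m) :
    (y, e') ∈ tube f m := by
  intro j hj
  have := hy j hj
  rw [record_congr hdep j y e e' fun i hi => h i (hi.trans hj)] at this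
  simpa only [h j hj] using this

theorem record_mem_uIcc {y y' z : Y} {e : ℕ → ℝ} {m : ℕ} (hy : (y, e) ∈ tube f m)
    (hy' : (y', e) ∈ tube f m)
    (hz : ∀ n, 2 * n ≤ m → f n (z, e) ∈ uIcc (f n (y, e)) (f n (y', e))) :
    (z, e) ∈ tube f m ∧ record f m (z, e) ∈ uIcc (record f m (y, e)) (record f m (y', e)) := by
  induction m using Nat.strong_induction_on with
  | _ m ih =>
    have IH : ∀ j < m, |e j - record f j (z, e)| < (1 / 2) ^ j ∧
        record f j (z, e) ∈ uIcc (record f j (y, e)) (record f j (y', e)) := by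
      intro j hj
      have h1 := (ih j hj (tube_anti hj.le hy) (tube_anti hj.le hy') fun n hn => hz n (by omega)).2
      refine ⟨?_, h1⟩
      have h2 := abs_lt.1 (hy j hj)
      have h3 := abs_lt.1 (hy' j hj)
      simp only at h2 h3
      rw [abs_lt]
      rcases mem_uIcc.1 h1 with h | h <;> constructor <;> linarith [h.1, h.2]
    refine ⟨fun j hj => (IH j hj).1, ?_⟩
    rcases Nat.even_or_odd' m with ⟨n, rfl | rfl⟩
    · simpa only [record_even] using hz n le_rfl
    · have hn : n < 2 * n + 1 := by omega
      have a := abs_scaled_lt.2 (hy n hn)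
      have b := abs_scaled_lt.2 (hy' n hn)
      have c := abs_scaled_lt.2 (IH n hn).1
      simp only [record_odd]
      have key : ∀ s t : ℝ, s ≤ t → 2 ^ n * (e n - t) ≤ 2 ^ n * (e n - s) := fun s t h => by
        gcongr
      rcases mem_uIcc.1 (IH n hn).2 with h | h
      · exact mem_uIcc.2 (Or.inr ⟨unsquash_mono b c (key _ _ h.2), unsquash_mono c a (key _ _ h.1)⟩)
      · exact mem_uIcc.2 (Or.inl ⟨unsquash_mono a c (key _ _ h.2), unsquash_mono c b (key _ _ h.1)⟩)

variable [TopologicalSpace Y]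

theorem continuousOn_record (hf : ∀ n, Continuous (f n)) (j : ℕ) :
    ContinuousOn (record f j) (tube f j) := by
  induction j using Nat.strong_induction_on with
  | _ j ih =>
    rcases Nat.even_or_odd' j with ⟨n, rfl | rfl⟩
    · simp only [funext (record_even (f := f) n)]
      exact (hf n).continuousOn
    · simp only [funext (record_odd (f := f) n)]
      have hc : ContinuousOn (fun x : Y × (ℕ → ℝ) => 2 ^ n * (x.2 n - record f n x))
          (tube f (2 * n + 1)) :=
        continuousOn_const.mul (((continuous_apply n).comp continuous_snd).continuousOn.sub
          ((ih n (by omega)).mono (tube_anti (by omega))))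
      refine hc.div (continuousOn_const.sub hc.abs) fun x hx => ?_
      have := abs_scaled_lt.2 (hx n (by omega))
      linarith

theorem isOpen_tube (hf : ∀ n, Continuous (f n)) (m : ℕ) : IsOpen (tube f m) := by
  induction m with
  | zero => simp [tube]
  | succ m ih =>
    rw [tube_succ]
    exact ContinuousOn.isOpen_inter_preimage (f := fun x => |x.2 m - record f m x|)
      (((continuous_apply m).comp continuous_snd).continuousOn.sub
        (continuousOn_record hf m)).abs ih isOpen_Iio

theorem nonempty_homeomorph_tube [TopologicalSpace.MetrizableSpace Y]
    (hf : ∀ n, Continuous (f n))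
    (hdep : ∀ n y e e', (∀ i < 2 * n, e i = e' i) → f n (y, e) = f n (y, e')) :
    Nonempty (↥(⋂ m, tube f m) ≃ₜ Y × (ℕ → ℝ)) := by
  have hup : ∀ (m : ℕ) (e : ℕ → ℝ) s, ∀ i < m, e i = update e m s i := fun m e s i hi => by
    rw [update_of_ne hi.ne]
  refine nonempty_homeomorph_tower _ (isOpen_tube hf) (tube_congr hdep) (by simp [tube]) ?_ ?_
  · intro m y e he
    refine ⟨record f m (y, e), ?_⟩
    rw [tube_succ]
    refine ⟨tube_congr hdep m y e _ (hup _ _ _) he, ?_⟩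
    have := record_congr hdep m y e (update e m (record f m (y, e))) (hup _ _ _)
    simp [← this]
  · refine fun m y e => ⟨fun s hs t ht r hr => ?_⟩
    have hR : ∀ s, record f m (y, update e m s) = record f m (y, e) := fun s =>
      (record_congr hdep m y e (update e m s) (hup _ _ _)).symm
    simp only [tube_succ, mem_ofPred_eq, mem_inter_iff, hR, update_self, abs_lt] at hs ht ⊢
    refine ⟨tube_congr hdep m y _ _ (fun i hi => ?_) hs.1, ?_, ?_⟩
    · rw [update_of_ne hi.ne, update_of_ne hi.ne]
    · linarith [hr.1]
    · linarith [hr.2]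

/-- Limits of points of deeper and deeper tubes lie in all tubes. -/
theorem mem_iInter_tube_of_tendsto (hf : ∀ n, Continuous (f n)) {y : ℕ → Y} {e : ℕ → ℕ → ℝ}
    {y₀ : Y} {e₀ : ℕ → ℝ} (hy : Tendsto y atTop (𝓝 y₀)) (he : Tendsto e atTop (𝓝 e₀))
    (h : ∀ k, (y k, e k) ∈ tube f (2 * k)) : (y₀, e₀) ∈ ⋂ m, tube f m := by
  refine mem_iInter.2 fun m => ?_
  induction m with
  | zero => simp [tube]
  | succ j ih =>
    rw [tube_succ]
    refine ⟨ih, ?_⟩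
    have he' := tendsto_pi_nhds.1 he
    have hR : Tendsto (fun k => record f j (y k, e k)) atTop (𝓝 (record f j (y₀, e₀))) :=
      ((continuousOn_record hf j).continuousAt ((isOpen_tube hf j).mem_nhds ih)).tendsto.comp
        (hy.prodMk_nhds he)
    have hu := (((he' j).sub hR).const_mul ((2 : ℝ) ^ j)).abs
    set R := |e₀ (2 * j + 1)| + 2 with hRdef
    have hRpos : 0 < R := by positivity
    have hev : ∀ᶠ k in atTop, |2 ^ j * (e k j - record f j (y k, e k))| ≤ R / (1 + R) := by
      filter_upwards [eventually_gt_atTop (j + 1), (he' (2 * j + 1)).abs.eventually_lt_const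
        (show |e₀ (2 * j + 1)| < |e₀ (2 * j + 1)| + 1 by linarith)] with k hk hk'
      have h1 := h k j (by omega)
      have h2 := h k (2 * j + 1) (by omega)
      rw [record_odd] at h2
      refine abs_le_of_unsquash (abs_scaled_lt.2 h1) ?_
      have h3 : ((1 : ℝ) / 2) ^ (2 * j + 1) ≤ 1 := pow_le_one₀ (by norm_num) (by norm_num)
      have h4 := abs_sub_abs_le_abs_sub (unsquash (2 ^ j * (e k j - record f j (y k, e k))))
        (e k (2 * j + 1))
      rw [abs_sub_comm] at h4
      simp only at h2
      linarith
    have h5 := le_of_tendsto hu hev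
    have h6 : R / (1 + R) < 1 := by rw [div_lt_one (by linarith)]; linarith
    exact abs_scaled_lt.1 (h5.trans_lt h6)

/-- A continuous open surjection between metrizable spaces becomes a homeomorphism after
multiplication by `ℕ → ℝ`, provided its fibres can be recovered from countably many functions whose
level constraints cut out connected pieces of the fibres. -/
theorem nonempty_homeomorph_of_fat {P : Type*} [TopologicalSpace P]
    [TopologicalSpace.MetrizableSpace Y] [TopologicalSpace.MetrizableSpace P]
    {p : Y → P} (hp : Continuous p) (hpo : IsOpenMap p) (hps : Surjective p)
    (hf : ∀ n, Continuous (f n))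
    (hdep : ∀ n y e e', (∀ i < 2 * n, e i = e' i) → f n (y, e) = f n (y, e'))
    (hK : ∀ N y y' e, p y = p y' → (∀ n < N, |e (2 * n) - f n (y, e)| < (1 / 2) ^ (2 * n)) →
      (∀ n < N, |e (2 * n) - f n (y', e)| < (1 / 2) ^ (2 * n)) → ∃ S : Set Y, IsPreconnected S ∧
        y ∈ S ∧ y' ∈ S ∧ ∀ z ∈ S, p z = p y ∧
          ∀ n ≤ N, f n (z, e) ∈ uIcc (f n (y, e)) (f n (y', e)))
    (hC : ∀ (y : ℕ → Y) (e : ℕ → ℕ → ℝ) (p₀ : P) (e₀ : ℕ → ℝ),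
      Tendsto (fun k => p (y k)) atTop (𝓝 p₀) → Tendsto e atTop (𝓝 e₀) →
      (∀ k, ∀ n < k, |e k (2 * n) - f n (y k, e k)| < (1 / 2) ^ (2 * n)) →
      ∃ y₀, Tendsto y atTop (𝓝 y₀)) :
    Nonempty (Y × (ℕ → ℝ) ≃ₜ P × (ℕ → ℝ)) := by
  obtain ⟨ΦY⟩ := nonempty_homeomorph_tube hf hdep
  let q : Y × (ℕ → ℝ) → P × (ℕ → ℝ) := Prod.map p id
  have hq : Continuous q := hp.prodMap continuous_id
  let D : ℕ → Set (P × (ℕ → ℝ)) := fun m => q '' tube f m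
  have memD : ∀ m r e, (r, e) ∈ D m ↔ ∃ y, p y = r ∧ (y, e) ∈ tube f m := by
    intro m r e
    constructor
    · rintro ⟨⟨y, e'⟩, h, h'⟩
      obtain ⟨rfl, rfl⟩ := Prod.ext_iff.1 h'
      exact ⟨y, rfl, h⟩
    · rintro ⟨y, rfl, h⟩
      exact ⟨(y, e), h, rfl⟩
  have hup : ∀ (m : ℕ) (e : ℕ → ℝ) s, ∀ i < m, e i = update e m s i := fun m e s i hi => by
    rw [update_of_ne hi.ne]
  have memS : ∀ m y e s, (y, update e m s) ∈ tube f (m + 1) ↔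
      (y, e) ∈ tube f m ∧ |s - record f m (y, e)| < (1 / 2) ^ m := by
    intro m y e s
    rw [tube_succ]
    simp only [mem_inter_iff, mem_ofPred_eq, update_self,
      ← record_congr hdep m y e (update e m s) (hup _ _ _)]
    exact and_congr_left fun _ => ⟨tube_congr hdep m y _ _ fun i hi => (hup m e s i hi).symm,
      tube_congr hdep m y _ _ (hup m e s)⟩
  have hΦP : Nonempty (↥(⋂ m, D m) ≃ₜ P × (ℕ → ℝ)) := by
    refine nonempty_homeomorph_tower D
      (fun m => (hpo.prodMap IsOpenMap.id) _ (isOpen_tube hf m)) ?_ ?_ ?_ ?_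
    · intro m r e e' h he
      obtain ⟨y, hy, hy'⟩ := (memD _ _ _).1 he
      exact (memD _ _ _).2 ⟨y, hy, tube_congr hdep m y e e' h hy'⟩
    · refine eq_univ_of_forall fun x => (memD _ _ _).2 ?_
      obtain ⟨y, hy⟩ := hps x.1
      exact ⟨y, hy, by simp [tube]⟩
    · intro m r e he
      obtain ⟨y, hy, hy'⟩ := (memD _ _ _).1 he
      exact ⟨record f m (y, e), (memD _ _ _).2 ⟨y, hy, (memS _ _ _ _).2 ⟨hy', by simp⟩⟩⟩
    · refine fun m r e => ⟨fun s hs t ht v hv => ?_⟩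
      obtain ⟨y, rfl, hy⟩ := (memD _ _ _).1 hs
      obtain ⟨y', hyy', hy'⟩ := (memD _ _ _).1 ht
      obtain ⟨h1, h2⟩ := (memS _ _ _ _).1 hy
      obtain ⟨h1', h2'⟩ := (memS _ _ _ _).1 hy'
      suffices ∃ z, p z = p y ∧ (z, e) ∈ tube f m ∧ |v - record f m (z, e)| < (1 / 2) ^ m by
        obtain ⟨z, hz, hz'⟩ := this
        exact (memD _ _ _).2 ⟨z, hz, (memS _ _ _ _).2 hz'⟩
      rw [abs_lt] at h2 h2'
      by_cases hA : v < record f m (y, e) + (1 / 2) ^ m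
      · exact ⟨y, rfl, h1, abs_lt.2 ⟨by linarith [hv.1], by linarith⟩⟩
      by_cases hB : record f m (y', e) - (1 / 2) ^ m < v
      · exact ⟨y', hyy', h1', abs_lt.2 ⟨by linarith, by linarith [hv.2]⟩⟩
      have hpos : (0 : ℝ) < (1 / 2) ^ m := by positivity
      have tub : ∀ y, (y, e) ∈ tube f m → ∀ n < (m + 1) / 2,
          |e (2 * n) - f n (y, e)| < (1 / 2) ^ (2 * n) := fun y hy n hn => by
        have := hy (2 * n) (by omega)
        rwa [record_even] at this
      obtain ⟨S, hS, hyS, hy'S, hz⟩ := hK ((m + 1) / 2) y y' e hyy'.symm (tub y h1) (tub y' h1')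
      have hz' := fun z hz' => record_mem_uIcc (z := z) h1 h1'
        fun n hn => (hz z hz').2 n (by omega)
      have hcont : ContinuousOn (fun z => record f m (z, e)) S :=
        (continuousOn_record hf m).comp (f := fun z => (z, e)) (by fun_prop) fun z h => (hz' z h).1
      obtain ⟨z, hzS, hzv⟩ := hS.intermediate_value hyS hy'S hcont
        ⟨by linarith [not_lt.1 hA], by linarith [not_lt.1 hB]⟩
      refine ⟨z, (hz z hzS).1, (hz' z hzS).1, ?_⟩
      rw [show record f m (z, e) = v from hzv]
      simp
  obtain ⟨ΦP⟩ := hΦP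
  have hL : ∀ (y : ℕ → Y) (e : ℕ → ℕ → ℝ) (p₀ : P) (e₀ : ℕ → ℝ),
      Tendsto (fun k => p (y k)) atTop (𝓝 p₀) → Tendsto e atTop (𝓝 e₀) →
      (∀ k, (y k, e k) ∈ tube f (2 * k)) →
      ∃ y₀, Tendsto y atTop (𝓝 y₀) ∧ p y₀ = p₀ ∧ (y₀, e₀) ∈ ⋂ m, tube f m := by
    intro y e p₀ e₀ hpy he h
    obtain ⟨y₀, hy₀⟩ := hC y e p₀ e₀ hpy he fun k n hn => by
      have := h k (2 * n) (by omega)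
      rwa [record_even] at this
    exact ⟨y₀, hy₀, tendsto_nhds_unique ((hp.tendsto y₀).comp hy₀) hpy,
      mem_iInter_tube_of_tendsto hf hy₀ he h⟩
  have hinj : ∀ y y' e, p y = p y' → (y, e) ∈ ⋂ m, tube f m → (y', e) ∈ ⋂ m, tube f m →
      y = y' := by
    intro y y' e hyy' h h'
    obtain ⟨y₀, hy₀, -⟩ := hL (fun k => if Even k then y else y') (fun _ => e) (p y) e
      (tendsto_const_nhds.congr fun k => by split_ifs <;> simp [hyy']) tendsto_const_nhds
      (fun k => by split_ifs; exacts [mem_iInter.1 h _, mem_iInter.1 h' _])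
    have t1 : Tendsto (fun k : ℕ => 2 * k) atTop atTop :=
      tendsto_atTop_mono (fun k => show k ≤ _ by omega) tendsto_id
    have t2 : Tendsto (fun k : ℕ => 2 * k + 1) atTop atTop :=
      tendsto_atTop_mono (fun k => show k ≤ _ by omega) tendsto_id
    have e1 := hy₀.comp t1
    have e2 := hy₀.comp t2
    have f1 : ((fun k : ℕ => if Even k then y else y') ∘ fun k => 2 * k) = fun _ => y := by
      funext k; simp
    have f2 : ((fun k : ℕ => if Even k then y else y') ∘ fun k => 2 * k + 1) = fun _ => y' := by
      funext k; simp
    rw [f1] at e1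
    rw [f2] at e2
    exact (tendsto_nhds_unique tendsto_const_nhds e1).trans
      (tendsto_nhds_unique tendsto_const_nhds e2).symm
  have hsurj : ∀ x ∈ ⋂ m, D m, ∃ y, p y = x.1 ∧ (y, x.2) ∈ ⋂ m, tube f m := by
    intro x hx
    choose y hy hy' using fun k => (memD (2 * k) x.1 x.2).1 (mem_iInter.1 hx (2 * k))
    obtain ⟨y₀, -, h1, h2⟩ := hL y (fun _ => x.2) x.1 x.2 (by simp [hy]) tendsto_const_nhds hy'
    exact ⟨y₀, h1, h2⟩
  choose s hs hs' using hsurj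
  have hsc : Continuous fun x : ↥(⋂ m, D m) => s x.1 x.2 := by
    let _ := TopologicalSpace.metrizableSpaceMetric P
    rw [continuous_iff_seqContinuous]
    intro x x₀ hx
    have hx' := (continuous_subtype_val.tendsto x₀).comp hx
    obtain ⟨y₀, h1, h2, h3⟩ := hL (fun k => s (x k).1 (x k).2) (fun k => (x k).1.2) x₀.1.1 x₀.1.2
      (by simp only [hs]; exact (continuous_fst.tendsto _).comp hx')
      ((continuous_snd.tendsto _).comp hx') fun k => mem_iInter.1 (hs' _ (x k).2) _
    have h4 := hinj _ _ _ ((hs _ x₀.2).trans h2.symm) (hs' _ x₀.2) h3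
    change Tendsto (fun k => s (x k).1 (x k).2) atTop (𝓝 (s x₀.1 x₀.2))
    rw [h4]
    exact h1
  let Ψ : ↥(⋂ m, tube f m) ≃ₜ ↥(⋂ m, D m) :=
    { toFun := fun x => ⟨q x.1, mem_iInter.2 fun m => ⟨x.1, mem_iInter.1 x.2 m, rfl⟩⟩
      invFun := fun x => ⟨(s x.1 x.2, x.1.2), hs' _ x.2⟩
      left_inv := by
        rintro ⟨⟨y, e⟩, hx⟩
        have hm : q (y, e) ∈ ⋂ m, D m := mem_iInter.2 fun m => ⟨_, mem_iInter.1 hx m, rfl⟩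
        exact Subtype.ext (Prod.ext (hinj _ _ _ (hs _ hm) (hs' _ hm) hx) rfl)
      right_inv := by
        rintro ⟨⟨r, e⟩, hx⟩
        exact Subtype.ext (Prod.ext (hs _ hx) rfl)
      continuous_toFun := (hq.comp continuous_subtype_val).subtype_mk _
      continuous_invFun :=
        (hsc.prodMk (continuous_snd.comp continuous_subtype_val)).subtype_mk _ }
  exact ⟨(ΦY.symm.trans Ψ).trans ΦP⟩

end Fat

/-- Every open subset `O` of `Z × (ℕ → R)` carries a sequence of functions locating, continuously,
how many coordinates of a point have to be known to see that it belongs to `O`. -/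
theorem exists_locator {Z R : Type*} [TopologicalSpace Z] [TopologicalSpace.MetrizableSpace Z]
    [TopologicalSpace R] [TopologicalSpace.MetrizableSpace (ℕ → R)] [Zero R]
    {O : Set (Z × (ℕ → R))} (hO : IsOpen O) :
    ∃ s : ℕ → Z × (ℕ → R) → ℝ, (∀ k, Continuous (s k)) ∧ (∀ k x, 0 ≤ s k x) ∧ (∀ k x, s k x ≤ 1) ∧
      (∀ k z v v', (∀ i < k, v i = v' i) → s k (z, v) = s k (z, v')) ∧
      (∀ k x, s k x < 1 → s (k + 1) x = 0) ∧
      (∀ k z v v', s k (z, v) < 1 → (∀ i < k, v i = v' i) → (z, v') ∈ O) ∧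
      (∀ x ∈ O, ∃ k, s k x < 1) := by
  let _ := TopologicalSpace.metrizableSpaceMetric (Z × (ℕ → R))
  let W : ℕ → Set (Z × (ℕ → R)) := fun k => {x | ∀ v', (∀ i < k, x.2 i = v' i) → (x.1, v') ∈ O}
  let q : ℕ → Z × (ℕ → R) → ℝ := fun k x => gap (interior (W k)) (x.1, trunc k x.2)
  have hq : ∀ k, Continuous (q k) := fun k => (continuous_gap _).comp
    (continuous_fst.prodMk ((continuous_trunc k).comp continuous_snd))
  have hq0 : ∀ k x, 0 ≤ q k x := fun k x => gap_nonneg _ _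
  let M : ℕ → Z × (ℕ → R) → ℝ := fun k x => ∑ j ∈ Finset.range (k + 1), q j x
  have hM : ∀ k, Continuous (M k) := fun k => continuous_finsetSum _ fun j _ => hq j
  have hMmono : ∀ x, Monotone fun k => M k x := fun x => monotone_nat_of_le_succ fun k => by
    simp only [M, Finset.sum_range_succ _ (k + 1)]
    linarith [hq0 (k + 1) x]
  have hMdep : ∀ k z v v', (∀ i < k, v i = v' i) → M k (z, v) = M k (z, v') := by
    intro k z v v' h
    refine Finset.sum_congr rfl fun j hj => ?_
    have := trunc_congr (n := j) (e := v) (e' := v') fun i hi => h i (by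
      have := Finset.mem_range.1 hj; omega)
    simp only [q, this]
  have hMpos : ∀ k x, 0 < M k x → ∃ j ≤ k, 0 < q j x := by
    intro k x h
    by_contra! hc
    refine h.not_ge (Finset.sum_nonpos fun j hj => hc j ?_)
    have := Finset.mem_range.1 hj; omega
  have hex : ∀ x ∈ O, ∃ k, 0 < q k x := by
    rintro ⟨z, v⟩ hx
    obtain ⟨A, B, hA, hB, hzA, hvB, hAB⟩ := isOpen_prod_iff.1 hO z v hx
    obtain ⟨I, u, hu, hIu⟩ := isOpen_pi_iff.1 hB v hvB
    refine ⟨I.sup id + 1, (gap_pos_iff isOpen_interior).2 ?_⟩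
    have hlt : ∀ i ∈ I, i < I.sup id + 1 := fun i hi =>
      Nat.lt_succ_of_le (Finset.le_sup (f := id) hi)
    refine mem_interior.2 ⟨A ×ˢ (I : Set ℕ).pi u, ?_, ?_, hzA, fun i hi => ?_⟩
    · rintro ⟨z', w⟩ ⟨hz', hw⟩ v' hv'
      refine hAB ⟨hz', hIu fun i hi => ?_⟩
      change v' i ∈ u i
      exact hv' i (hlt i hi) ▸ hw i hi
    · exact hA.prod (isOpen_set_pi I.finite_toSet fun i hi => (hu i hi).1)
    · change trunc _ v i ∈ u i
      exact (trunc_apply (hlt i hi) v).symm ▸ (hu i hi).2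
  let s : ℕ → Z × (ℕ → R) → ℝ := fun k x =>
    max 0 (min 1 (1 - (M k x - 1 / (k + 2)) * ((k + 1) * (k + 2))))
  have hlt : ∀ k x, s k x < 1 ↔ 1 / ((k : ℝ) + 2) < M k x := by
    intro k x
    have : (0 : ℝ) < (k + 1) * (k + 2) := by positivity
    simp only [s, max_lt_iff, min_lt_iff, lt_irrefl, false_or, zero_lt_one, true_and]
    constructor
    · intro h
      have := pos_of_mul_pos_left (show 0 < (M k x - 1 / (k + 2)) * (((k : ℝ) + 1) * (k + 2)) by
        linarith) this.le
      linarith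
    · intro h
      have := mul_pos (sub_pos.2 h) this
      linarith
  refine ⟨s, fun k => ?_, fun k x => le_max_left _ _,
    fun k x => max_le zero_le_one (min_le_left _ _),
    fun k z v v' h => ?_, fun k x h => ?_, fun k z v v' h hv => ?_, fun x hx => ?_⟩
  · have := hM k
    fun_prop
  · simp only [s, hMdep k z v v' h]
  · have h1 := (hlt k x).1 h
    have h2 : M k x ≤ M (k + 1) x := hMmono x (Nat.le_succ k)
    refine max_eq_left ((min_le_right _ _).trans ?_)
    push_cast
    have h3 : 1 / ((k : ℝ) + 2) - 1 / (k + 1 + 2) = 1 / (((k : ℝ) + 1 + 1) * (k + 1 + 2)) := by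
      field_simp; ring
    have h4 : (0 : ℝ) < ((k : ℝ) + 1 + 1) * (k + 1 + 2) := by positivity
    have h5 : 1 / (((k : ℝ) + 1 + 1) * (k + 1 + 2)) ≤ M (k + 1) x - 1 / (k + 1 + 2) := by
      rw [← h3]; linarith
    rw [div_le_iff₀ h4] at h5
    linarith
  · obtain ⟨j, hj, hqj⟩ := hMpos k (z, v) (lt_trans (by positivity) ((hlt k _).1 h))
    refine interior_subset ((gap_pos_iff isOpen_interior).1 hqj) v' fun i hi => ?_
    exact (trunc_apply hi v).trans (hv i (by omega))
  · obtain ⟨j, hj⟩ := hex x hx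
    obtain ⟨n, hn⟩ := exists_nat_one_div_lt hj
    refine ⟨max n j, (hlt _ _).2 ?_⟩
    have h1 : q j x ≤ M (max n j) x :=
      Finset.single_le_sum (f := fun j => q j x) (fun i _ => hq0 i x)
        (Finset.mem_range.2 (by omega))
    refine lt_of_le_of_lt ?_ (hn.trans_le h1)
    refine one_div_le_one_div_of_le (by positivity) ?_
    have : (n : ℝ) ≤ (max n j : ℕ) := by exact_mod_cast le_max_left _ _
    linarith

section Insert

variable {R : Type*} [AddCommGroup R] [Module ℝ R]

/-- The coefficient orthogonal to `s`. -/
noncomputable def cof (s : ℝ) : ℝ := √(1 - s ^ 2)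

/-- The vector that remains to be inserted after `k` rotations. -/
noncomputable def carry (s : ℕ → ℝ) (v : ℕ → R) (y : R) : ℕ → R
  | 0 => y
  | k + 1 => cof (s k) • v k - s k • carry s v y k

/-- Insert `y` into the sequence `v` at the position described by `s`. -/
noncomputable def insertAt (s : ℕ → ℝ) (v : ℕ → R) (y : R) (k : ℕ) : R :=
  s k • v k + cof (s k) • carry s v y k

/-- Remove the inserted vector. -/
noncomputable def removeAt (s : ℕ → ℝ) (u : ℕ → R) (k : ℕ) : R :=
  s k • u k + cof (s k) • u (k + 1)

/-- Recover the inserted vector from the first `n` entries. -/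
noncomputable def extractAt (s : ℕ → ℝ) (u : ℕ → R) (n : ℕ) : R :=
  ∑ k ∈ Finset.range n, ((-1) ^ k * (∏ j ∈ Finset.range k, s j) * cof (s k)) • u k

theorem sq_add_cof_sq {s : ℝ} (h0 : 0 ≤ s) (h1 : s ≤ 1) : s ^ 2 + cof s ^ 2 = 1 := by
  rw [cof, Real.sq_sqrt (by nlinarith)]; ring

theorem cof_one : cof 1 = 0 := by simp [cof]

theorem cof_zero : cof 0 = 1 := by simp [cof]

variable {s : ℕ → ℝ}

theorem locator_zero (hs : ∀ k, s k < 1 → s (k + 1) = 0) {K k : ℕ} (hK : s K < 1)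
    (hk : K < k) : s k = 0 := by
  induction k with
  | zero => omega
  | succ k ih =>
    rcases Nat.lt_succ_iff_lt_or_eq.1 hk with h | rfl
    · exact hs k (by rw [ih h]; exact zero_lt_one)
    · exact hs K hK

theorem extractAt_eq (hs : ∀ k, s k < 1 → s (k + 1) = 0) {K n : ℕ} (hK : s K < 1)
    (hn : K + 2 ≤ n) (u : ℕ → R) :
    extractAt s u n = extractAt s u (K + 2) := by
  induction n, hn using Nat.le_induction with
  | base => rfl
  | succ n hn ih =>
    have : ∏ j ∈ Finset.range n, s j = 0 :=
      Finset.prod_eq_zero (Finset.mem_range.2 (by omega : K + 1 < n)) (hs K hK)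
    rw [extractAt, Finset.sum_range_succ, this, ← extractAt, ih]
    simp

theorem removeAt_insertAt (h0 : ∀ k, 0 ≤ s k) (h1 : ∀ k, s k ≤ 1)
    (hs : ∀ k, s k < 1 → s (k + 1) = 0) (v : ℕ → R) (y : R) :
    removeAt s (insertAt s v y) = v := by
  funext k
  have hc := sq_add_cof_sq (h0 k) (h1 k)
  rcases (h1 k).lt_or_eq with h | h
  · simp only [removeAt, insertAt, carry, hs k h, cof_zero]
    have : v k = (s k ^ 2 + cof (s k) ^ 2) • v k := by rw [hc, one_smul]
    nth_rewrite 3 [this]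
    module
  · simp [removeAt, insertAt, h, cof_one]

theorem extractAt_insertAt (h0 : ∀ k, 0 ≤ s k) (h1 : ∀ k, s k ≤ 1)
    (hs : ∀ k, s k < 1 → s (k + 1) = 0) {K : ℕ} (hK : s K < 1) (v : ℕ → R) (y : R) :
    extractAt s (insertAt s v y) (K + 2) = y := by
  have key : ∀ n, extractAt s (insertAt s v y) n =
      y - ((-1) ^ n * ∏ j ∈ Finset.range n, s j) • carry s v y n := by
    intro n
    induction n with
    | zero => simp [extractAt, carry]
    | succ n ih =>
      rw [extractAt, Finset.sum_range_succ, ← extractAt, ih, Finset.prod_range_succ]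
      have hc : carry s v y n = (s n ^ 2 + cof (s n) ^ 2) • carry s v y n := by
        rw [sq_add_cof_sq (h0 n) (h1 n), one_smul]
      have : carry s v y n = cof (s n) • insertAt s v y n - s n • carry s v y (n + 1) := by
        rw [hc, insertAt, carry]; module
      nth_rewrite 1 [this]
      module
  have : ∏ j ∈ Finset.range (K + 2), s j = 0 :=
    Finset.prod_eq_zero (Finset.mem_range.2 (by omega : K + 1 < K + 2)) (hs K hK)
  simp [key, this]

theorem insertAt_removeAt (h0 : ∀ k, 0 ≤ s k) (h1 : ∀ k, s k ≤ 1)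
    (hs : ∀ k, s k < 1 → s (k + 1) = 0) {K : ℕ} (hK : s K < 1)
    (hK' : ∀ k < K, s k = 1) (u : ℕ → R) :
    insertAt s (removeAt s u) (extractAt s u (K + 2)) = u := by
  have hc := sq_add_cof_sq (h0 K) (h1 K)
  have hz := fun k => locator_zero (k := k) hs hK
  set y := extractAt s u (K + 2) with hy
  have hyv : y = ((-1 : ℝ) ^ K) • (cof (s K) • u K - s K • u (K + 1)) := by
    rw [hy, extractAt, Finset.sum_range_succ, Finset.sum_range_succ, Finset.sum_eq_zero,
      Finset.prod_range_succ, hz (K + 1) (by omega), cof_zero, Finset.prod_eq_one]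
    · module
    · exact fun j hj => hK' j (Finset.mem_range.1 hj)
    · intro j hj
      rw [hK' j (Finset.mem_range.1 hj), cof_one]
      simp
  have c1 : ∀ k ≤ K, carry s (removeAt s u) y k = ((-1 : ℝ) ^ k) • y := by
    intro k hk
    induction k with
    | zero => simp [carry]
    | succ k ih =>
      rw [carry, ih (by omega), hK' k (by omega), cof_one]
      module
  have c2 : carry s (removeAt s u) y K = cof (s K) • u K - s K • u (K + 1) := by
    rw [c1 K le_rfl, hyv, smul_smul, ← mul_pow]; simp
  have c3 : ∀ k, K < k → carry s (removeAt s u) y k = u k := by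
    intro k hk
    induction k with
    | zero => omega
    | succ k ih =>
      rcases Nat.lt_succ_iff_lt_or_eq.1 hk with h | rfl
      · rw [carry, hz k h, cof_zero]
        simp [removeAt, hz k h, cof_zero]
      · rw [carry, c2, removeAt]
        have : u (K + 1) = (s K ^ 2 + cof (s K) ^ 2) • u (K + 1) := by rw [hc, one_smul]
        nth_rewrite 3 [this]
        module
  funext k
  rcases lt_trichotomy k K with h | rfl | h
  · simp [insertAt, removeAt, hK' k h, cof_one]
  · rw [insertAt, c2, removeAt]
    have : u k = (s k ^ 2 + cof (s k) ^ 2) • u k := by rw [hc, one_smul]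
    nth_rewrite 3 [this]
    module
  · rw [insertAt, c3 k h, hz k h, cof_zero]
    simp

end Insert

theorem nonempty_homeomorph_open_prod_aux {Z R : Type*} [TopologicalSpace Z]
    [TopologicalSpace.MetrizableSpace Z] [TopologicalSpace R]
    [TopologicalSpace.MetrizableSpace (ℕ → R)]
    [AddCommGroup R] [Module ℝ R] [IsTopologicalAddGroup R] [ContinuousSMul ℝ R]
    {O : Set (Z × (ℕ → R))} (hO : IsOpen O) : Nonempty (↥O × R ≃ₜ ↥O) := by
  obtain ⟨s, hsc, h0, h1, hdep, hs, hsO, hex⟩ := exists_locator hO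
  have cofc : Continuous cof := by unfold cof; fun_prop
  let S : Z × (ℕ → R) → ℕ → ℝ := fun x k => s k x
  have hSK : ∀ x ∈ O, ∃ K, S x K < 1 ∧ ∀ k < K, S x k = 1 := by
    intro x hx
    classical
    refine ⟨Nat.find (hex x hx), Nat.find_spec (hex x hx), fun k hk => ?_⟩
    exact le_antisymm (h1 k x) (not_lt.1 (Nat.find_min (hex x hx) hk))
  -- changing coordinates beyond the located position does not change the location
  have agree : ∀ z v v' K, S (z, v) K < 1 → (∀ k < K, v k = v' k) →
      (z, v') ∈ O ∧ S (z, v') = S (z, v) := by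
    intro z v v' K hK h
    refine ⟨hsO K z v v' hK h, funext fun k => ?_⟩
    by_cases hk : k ≤ K
    · exact (hdep k z v v' fun i hi => h i (by omega)).symm
    · have h' : S (z, v') K < 1 := by
        have := hdep K z v v' h
        simp only [S] at hK ⊢; rwa [← this]
      exact (locator_zero (s := S (z, v')) (fun k => hs k _) h' (not_le.1 hk)).trans
        (locator_zero (s := S (z, v)) (fun k => hs k _) hK (not_le.1 hk)).symm
  have insAgree : ∀ x ∈ O, ∀ y, (x.1, insertAt (S x) x.2 y) ∈ O ∧
      S (x.1, insertAt (S x) x.2 y) = S x := by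
    intro x hx y
    obtain ⟨K, hK, hK'⟩ := hSK x hx
    exact agree x.1 x.2 _ K hK fun k hk => by simp [insertAt, hK' k hk, cof_one]
  have remAgree : ∀ x ∈ O, (x.1, removeAt (S x) x.2) ∈ O ∧
      S (x.1, removeAt (S x) x.2) = S x := by
    intro x hx
    obtain ⟨K, hK, hK'⟩ := hSK x hx
    exact agree x.1 x.2 _ K hK fun k hk => by simp [removeAt, hK' k hk, cof_one]
  choose κ hκ hκ' using hSK
  let ex : ↥O → R := fun x => extractAt (S x.1) x.1.2 (κ x.1 x.2 + 2)
  refine ⟨⟨⟨fun a => ⟨(a.1.1.1, insertAt (S a.1.1) a.1.1.2 a.2), (insAgree _ a.1.2 _).1⟩,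
    fun x => (⟨(x.1.1, removeAt (S x.1) x.1.2), (remAgree _ x.2).1⟩, ex x), ?_, ?_⟩, ?_, ?_⟩⟩
  · rintro ⟨⟨⟨z, v⟩, hx⟩, y⟩
    have hS := (insAgree _ hx y).2
    simp only at hS
    refine Prod.ext (Subtype.ext (Prod.ext rfl ?_)) ?_
    · simp only [hS]
      exact removeAt_insertAt (fun k => h0 k _) (fun k => h1 k _) (fun k => hs k _) v y
    · simp only [ex, hS]
      have hκ1 := (congrFun hS _).symm.trans_lt (hκ _ (insAgree _ hx y).1)
      exact extractAt_insertAt (fun k => h0 k _) (fun k => h1 k _) (fun k => hs k _) hκ1 v y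
  · rintro ⟨⟨z, u⟩, hx⟩
    have hS := (remAgree _ hx).2
    simp only at hS
    refine Subtype.ext (Prod.ext rfl ?_)
    simp only [ex, hS]
    exact insertAt_removeAt (fun k => h0 k _) (fun k => h1 k _) (fun k => hs k _) (hκ _ hx)
      (hκ' _ hx) u
  · have hv : Continuous fun a : ↥O × R => a.1.1 := by fun_prop
    have hS : ∀ k, Continuous fun a : ↥O × R => S a.1.1 k := fun k => (hsc k).comp hv
    have hk : ∀ k, Continuous fun a : ↥O × R => a.1.1.2 k := fun k => by fun_prop
    have hcarry : ∀ k, Continuous fun a : ↥O × R => carry (S a.1.1) a.1.1.2 a.2 k := by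
      intro k
      induction k with
      | zero => exact continuous_snd
      | succ k ih => exact ((cofc.comp (hS k)).smul (hk k)).sub ((hS k).smul ih)
    refine (hv.fst.prodMk (continuous_pi fun k => ?_)).subtype_mk _
    exact ((hS k).smul (hk k)).add ((cofc.comp (hS k)).smul (hcarry k))
  · have hS : ∀ k, Continuous fun x : ↥O => S x.1 k := fun k => (hsc k).comp continuous_subtype_val
    have hk : ∀ k, Continuous fun x : ↥O => x.1.2 k := fun k => by fun_prop
    refine ((continuous_subtype_val.fst.prodMk (continuous_pi fun k => ?_)).subtype_mk _).prodMk ?_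
    · exact ((hS k).smul (hk k)).add ((cofc.comp (hS k)).smul (hk (k + 1)))
    · rw [continuous_iff_continuousAt]
      intro x
      set K := κ x.1 x.2 with hKdef
      have hn : ∀ᶠ x' : ↥O in 𝓝 x, S x'.1 K < 1 :=
        (hS K).continuousAt.eventually_lt continuousAt_const (hκ x.1 x.2)
      have hex' : (fun x' : ↥O => extractAt (S x'.1) x'.1.2 (K + 2)) =ᶠ[𝓝 x] ex := by
        filter_upwards [hn] with x' hx'
        have hle : κ x'.1 x'.2 ≤ K := by
          by_contra hlt
          exact hx'.ne (hκ' x'.1 x'.2 K (not_le.1 hlt))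
        exact extractAt_eq (fun k => hs k _) (hκ x'.1 x'.2) (by omega) _
      refine ContinuousAt.congr (Continuous.continuousAt ?_) hex'
      refine continuous_finsetSum _ fun k _ => Continuous.smul ?_ (hk k)
      exact (continuous_const.mul (continuous_finsetProd _ fun j _ => hS j)).mul
        (cofc.comp (hS k))

/-- Open subsets of `Z × (ℕ → ℝ)` are stable under multiplication by `ℕ → ℝ`. -/
theorem nonempty_homeomorph_open_prod {Z : Type*} [TopologicalSpace Z]
    [TopologicalSpace.MetrizableSpace Z] {O : Set (Z × (ℕ → ℝ))} (hO : IsOpen O) :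
    Nonempty (↥O × (ℕ → ℝ) ≃ₜ ↥O) := by
  let η : (ℕ → ℕ → ℝ) ≃ₜ (ℕ → ℝ) :=
    { toFun := fun v k => v k.unpair.1 k.unpair.2
      invFun := fun v i j => v (Nat.pair i j)
      left_inv := fun v => by funext i j; simp
      right_inv := fun v => by funext k; simp
      continuous_toFun := by fun_prop
      continuous_invFun := by fun_prop }
  let θ : Z × (ℕ → ℕ → ℝ) ≃ₜ Z × (ℕ → ℝ) := (Homeomorph.refl Z).prodCongr η
  obtain ⟨Φ⟩ := nonempty_homeomorph_open_prod_aux (R := ℕ → ℝ) (hO.preimage θ.continuous)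
  let σ : ↥(θ ⁻¹' O) ≃ₜ ↥O := θ.sets rfl
  exact ⟨((σ.symm.prodCongr (Homeomorph.refl _)).trans Φ).trans σ⟩

/-- The max-plus combination of `a` and `b` in which `b` is shifted by `log r`;
it is `a` when `r ≤ 0`. -/
noncomputable def mix (r : ℝ) (a b : ℕ → ℝ) : ℕ → ℝ :=
  fun i => Real.log (max (Real.exp (a i)) (r * Real.exp (b i)))

section Mix

variable {r s t : ℝ} {a b : ℕ → ℝ}

theorem exp_mix (r : ℝ) (a b : ℕ → ℝ) (i : ℕ) :
    Real.exp (mix r a b i) = max (Real.exp (a i)) (r * Real.exp (b i)) :=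
  Real.exp_log (lt_max_of_lt_left (Real.exp_pos _))

theorem eq_of_exp_eq {a b : ℕ → ℝ} (h : ∀ i, Real.exp (a i) = Real.exp (b i)) : a = b :=
  funext fun i => Real.exp_injective (h i)

theorem continuous_mix : Continuous fun z : ℝ × (ℕ → ℝ) × (ℕ → ℝ) => mix z.1 z.2.1 z.2.2 := by
  refine continuous_pi fun i => Continuous.log (by fun_prop) fun z => ?_
  exact (lt_max_of_lt_left (Real.exp_pos _)).ne'

theorem mix_zero (a b : ℕ → ℝ) : mix 0 a b = a := by
  refine eq_of_exp_eq fun i => ?_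
  rw [exp_mix, zero_mul, max_eq_left (Real.exp_pos _).le]

theorem mix_of_pos (hr : 0 < r) (a b : ℕ → ℝ) :
    mix r a b = fun i => max (a i) (Real.log r + b i) := by
  refine eq_of_exp_eq fun i => ?_
  rw [exp_mix, Real.exp_monotone.map_max, Real.exp_add, Real.exp_log hr]

theorem le_mix (r : ℝ) (a b : ℕ → ℝ) (i : ℕ) : a i ≤ mix r a b i := by
  rw [← Real.exp_le_exp, exp_mix]; exact le_max_left _ _

theorem mix_le (hr : r ≤ 1) {c : ℝ} {i : ℕ} (ha : a i ≤ c) (hb : b i ≤ c) : mix r a b i ≤ c := by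
  rw [← Real.exp_le_exp, exp_mix]
  refine max_le (Real.exp_le_exp.2 ha) ?_
  exact (mul_le_of_le_one_left (Real.exp_pos _).le hr).trans (Real.exp_le_exp.2 hb)

theorem mix_comm_mix (hr : 0 ≤ r) (hs : 0 ≤ s) (a b c d : ℕ → ℝ) :
    mix r (mix s a b) (mix s c d) = mix s (mix r a c) (mix r b d) := by
  refine eq_of_exp_eq fun i => ?_
  simp only [exp_mix, mul_max_of_nonneg _ _ hr, mul_max_of_nonneg _ _ hs, ← mul_assoc,
    mul_comm r s, max_max_max_comm]

theorem mix_mix (a b : ℕ → ℝ) : mix t (mix s a b) b = mix (max s t) a b := by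
  refine eq_of_exp_eq fun i => ?_
  rw [exp_mix, exp_mix, exp_mix, max_mul_of_nonneg _ _ (Real.exp_pos _).le, max_assoc]

theorem mix_self (hr : r ≤ 1) (a : ℕ → ℝ) : mix r a a = a := by
  refine eq_of_exp_eq fun i => ?_
  rw [exp_mix, max_eq_left (mul_le_of_le_one_left (Real.exp_pos _).le hr)]

end Mix

theorem maxPlusConvex_iff {A : Set (ℕ → ℝ)} :
    MaxPlusConvex A ↔ ∀ r ∈ Icc (0 : ℝ) 1, ∀ a ∈ A, ∀ b ∈ A, mix r a b ∈ A := by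
  refine ⟨fun h r hr a ha b hb => ?_, fun h a ha b hb t ht => ?_⟩
  · rcases hr.1.eq_or_lt with h0 | h0
    · rwa [← h0, mix_zero]
    · rw [mix_of_pos h0]
      exact h a ha b hb _ (Real.log_nonpos hr.1 hr.2)
  · have := h (Real.exp t) ⟨(Real.exp_pos _).le, Real.exp_le_one_iff.2 ht⟩ a ha b hb
    rwa [mix_of_pos (Real.exp_pos t), Real.log_exp] at this

/-- The hyperspace of nonempty compact max-plus convex subsets of `ℕ → ℝ`. -/
abbrev MaxPlusCompacts :=
  {K : TopologicalSpace.NonemptyCompacts (ℕ → ℝ) // MaxPlusConvex (K : Set (ℕ → ℝ))}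

/-- The maximum of a real function on a compact set. -/
noncomputable def supOn (φ : (ℕ → ℝ) → ℝ) (K : TopologicalSpace.NonemptyCompacts (ℕ → ℝ)) : ℝ :=
  sSup (φ '' K)

section SupOn

variable {φ : (ℕ → ℝ) → ℝ} {K K' : TopologicalSpace.NonemptyCompacts (ℕ → ℝ)}

theorem le_supOn (hφ : Continuous φ) {a : ℕ → ℝ} (ha : a ∈ K) : φ a ≤ supOn φ K :=
  le_csSup (K.isCompact.image hφ).bddAbove (mem_image_of_mem φ ha)

theorem exists_eq_supOn (hφ : Continuous φ) (K : TopologicalSpace.NonemptyCompacts (ℕ → ℝ)) :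
    ∃ a ∈ K, φ a = supOn φ K :=
  (K.isCompact.image hφ).sSup_mem (K.nonempty.image φ)

theorem supOn_le (hφ : Continuous φ) {c : ℝ} (h : ∀ a ∈ K, φ a ≤ c) : supOn φ K ≤ c := by
  obtain ⟨a, ha, h'⟩ := exists_eq_supOn hφ K
  exact h' ▸ h a ha

theorem supOn_mono (hφ : Continuous φ) (h : (K : Set (ℕ → ℝ)) ⊆ K') : supOn φ K ≤ supOn φ K' :=
  supOn_le hφ fun _ ha => le_supOn hφ (h ha)

theorem continuous_supOn (hφ : Continuous φ) : Continuous (supOn φ) := by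
  refine continuous_iff_continuousAt.2 fun K => tendsto_order.2 ⟨fun c hc => ?_, fun c hc => ?_⟩
  · obtain ⟨a, ha, h⟩ := exists_eq_supOn hφ K
    filter_upwards [(TopologicalSpace.NonemptyCompacts.isOpen_inter_nonempty_of_isOpen
      (isOpen_lt continuous_const hφ)).mem_nhds (show ((K : Set _) ∩ {a | c < φ a}).Nonempty from
        ⟨a, ha, hc.trans_eq h.symm⟩)] with K' ⟨b, hb, hb'⟩
    exact lt_of_lt_of_le hb' (le_supOn hφ hb)
  · filter_upwards [(TopologicalSpace.NonemptyCompacts.isOpen_subsets_of_isOpen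
      (isOpen_lt hφ continuous_const)).mem_nhds (show (K : Set _) ⊆ {a | φ a < c} from
        fun a ha => (le_supOn hφ ha).trans_lt hc)] with K' hK'
    obtain ⟨b, hb, hb'⟩ := exists_eq_supOn hφ K'
    exact hb' ▸ hK' hb

end SupOn

namespace MaxPlusCompacts

variable {r s t : ℝ} {A A' B : MaxPlusCompacts}

theorem mix_mem (A : MaxPlusCompacts) (hr0 : 0 ≤ r) (hr1 : r ≤ 1) {a b : ℕ → ℝ}
    (ha : a ∈ A.1) (hb : b ∈ A.1) : mix r a b ∈ A.1 :=
  maxPlusConvex_iff.1 A.2 r ⟨hr0, hr1⟩ a ha b hb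

theorem ext_mem (h : ∀ a, a ∈ A.1 ↔ a ∈ A'.1) : A = A' :=
  Subtype.ext (SetLike.ext h)

/-- The coordinatewise maximum of a max-plus convex compact set. -/
noncomputable def top (A : MaxPlusCompacts) : ℕ → ℝ := fun i => supOn (fun a => a i) A.1

theorem le_top {a : ℕ → ℝ} (ha : a ∈ A.1) (i : ℕ) : a i ≤ A.top i :=
  le_supOn (φ := fun a => a i) (continuous_apply i) ha

theorem continuous_top : Continuous top :=
  continuous_pi fun i => (continuous_supOn (continuous_apply i)).comp continuous_subtype_val

theorem top_mem (A : MaxPlusCompacts) : A.top ∈ A.1 := by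
  have h : ∀ n, ∃ a ∈ A.1, ∀ i < n, a i = A.top i := by
    intro n
    induction n with
    | zero => exact A.1.nonempty.imp fun a ha => ⟨ha, by simp⟩
    | succ n ih =>
      obtain ⟨a, ha, h⟩ := ih
      obtain ⟨b, hb, h'⟩ := exists_eq_supOn (φ := fun a => a n) (continuous_apply n) A.1
      refine ⟨mix 1 a b, A.mix_mem zero_le_one le_rfl ha hb, fun i hi => ?_⟩
      refine le_antisymm (mix_le le_rfl (le_top ha i) (le_top hb i)) ?_
      rw [mix_of_pos one_pos, Real.log_one]
      simp only [zero_add]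
      rcases Nat.lt_succ_iff_lt_or_eq.1 hi with hi | rfl
      · exact (h i hi).ge.trans (le_max_left _ _)
      · exact h'.ge.trans (le_max_right _ _)
  choose a ha h using h
  refine A.1.isCompact.isClosed.mem_of_tendsto (b := atTop) (f := a) ?_ (Eventually.of_forall ha)
  refine tendsto_pi_nhds.2 fun i => tendsto_const_nhds.congr' ?_
  filter_upwards [eventually_gt_atTop i] with n hn using (h n i hn).symm

theorem top_eq_of {x : ℕ → ℝ} (hx : x ∈ A.1) (h : ∀ a ∈ A.1, ∀ i, a i ≤ x i) : A.top = x :=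
  funext fun i => le_antisymm (h _ A.top_mem i) (le_top hx i)

/-- The singleton `{x}`. -/
def point (x : ℕ → ℝ) : MaxPlusCompacts :=
  ⟨{x}, by
    refine maxPlusConvex_iff.2 fun r hr a ha b hb => ?_
    rw [TopologicalSpace.NonemptyCompacts.coe_singleton, mem_singleton_iff] at *
    rw [ha, hb, mix_self hr.2]⟩

theorem mem_point {x a : ℕ → ℝ} : a ∈ (point x).1 ↔ a = x := by
  simp [point]

theorem continuous_point : Continuous point :=
  TopologicalSpace.NonemptyCompacts.continuous_singleton.subtype_mk _

theorem top_point (x : ℕ → ℝ) : (point x).top = x :=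
  mem_point.1 (top_mem _)

/-- The set of all combinations `mix |r| a a'` with `a ∈ A` and `a' ∈ A'`. -/
noncomputable def comb (r : ℝ) (A A' : MaxPlusCompacts) : MaxPlusCompacts :=
  ⟨(A.1 ×ˢ A'.1).map (fun z => mix |r| z.1 z.2)
    (continuous_mix.comp (continuous_const.prodMk continuous_id)), by
    refine maxPlusConvex_iff.2 fun s hs => ?_
    rintro _ ⟨⟨a, a'⟩, ⟨ha, ha'⟩, rfl⟩ _ ⟨⟨b, b'⟩, ⟨hb, hb'⟩, rfl⟩
    exact ⟨(_, _), ⟨A.mix_mem hs.1 hs.2 ha hb, A'.mix_mem hs.1 hs.2 ha' hb'⟩,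
      (mix_comm_mix hs.1 (abs_nonneg r) a a' b b').symm⟩⟩

theorem mem_comb (hr : 0 ≤ r) {c : ℕ → ℝ} :
    c ∈ (comb r A A').1 ↔ ∃ a ∈ A.1, ∃ a' ∈ A'.1, mix r a a' = c := by
  rw [← abs_of_nonneg hr]
  refine ⟨?_, ?_⟩
  · rintro ⟨⟨a, a'⟩, ⟨ha, ha'⟩, rfl⟩
    exact ⟨a, ha, a', ha', by simp⟩
  · rintro ⟨a, ha, a', ha', rfl⟩
    exact ⟨(a, a'), ⟨ha, ha'⟩, by simp⟩

theorem continuous_comb :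
    Continuous fun z : ℝ × MaxPlusCompacts × MaxPlusCompacts => comb z.1 z.2.1 z.2.2 := by
  refine Continuous.subtype_mk (Continuous.nonemptyCompacts_map'
    (f := fun z : ℝ × MaxPlusCompacts × MaxPlusCompacts => z.2.1.1 ×ˢ z.2.2.1)
    (g := fun z y => mix |z.1| y.1 y.2) ?_ ?_) _
  · exact TopologicalSpace.NonemptyCompacts.continuous_prod.comp
      (f := fun z : ℝ × MaxPlusCompacts × MaxPlusCompacts => (z.2.1.1, z.2.2.1)) (by fun_prop)
  · exact continuous_mix.comp (by fun_prop :
      Continuous fun z : (ℝ × MaxPlusCompacts × MaxPlusCompacts) × _ × _ => (|z.1.1|, z.2))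

theorem comb_zero (A A' : MaxPlusCompacts) : comb 0 A A' = A := by
  refine ext_mem fun c => (mem_comb le_rfl).trans ⟨?_, fun h => ?_⟩
  · rintro ⟨a, ha, a', -, rfl⟩
    rwa [mix_zero]
  · exact ⟨c, h, A'.top, A'.top_mem, mix_zero _ _⟩

theorem top_comb (hr0 : 0 ≤ r) (hr1 : r ≤ 1) (h : A.top = A'.top) : (comb r A A').top = A.top := by
  refine top_eq_of ((mem_comb hr0).2 ⟨_, A.top_mem, _, A'.top_mem, ?_⟩) fun c hc i => ?_
  · rw [← h, mix_self hr1]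
  · obtain ⟨a, ha, a', ha', rfl⟩ := (mem_comb hr0).1 hc
    exact mix_le hr1 (le_top ha i) (h ▸ le_top ha' i)

theorem comb_comm (A A' : MaxPlusCompacts) : comb 1 A A' = comb 1 A' A := by
  have : ∀ a b, mix 1 a b = mix 1 b a := fun a b => eq_of_exp_eq fun i => by
    rw [exp_mix, exp_mix, one_mul, one_mul, max_comm]
  refine ext_mem fun c => ?_
  rw [mem_comb zero_le_one, mem_comb zero_le_one]
  exact ⟨fun ⟨a, ha, b, hb, h⟩ => ⟨b, hb, a, ha, this b a ▸ h⟩,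
    fun ⟨a, ha, b, hb, h⟩ => ⟨b, hb, a, ha, this b a ▸ h⟩⟩

/-- The part of `A` near its maximum. -/
noncomputable def cut (A : MaxPlusCompacts) (t : ℝ) : MaxPlusCompacts := comb t A (point A.top)

theorem mem_cut (ht : 0 ≤ t) {c : ℕ → ℝ} :
    c ∈ (A.cut t).1 ↔ ∃ a ∈ A.1, mix t a A.top = c := by
  rw [cut, mem_comb ht]
  simp [mem_point]

theorem continuous_cut : Continuous fun z : MaxPlusCompacts × ℝ => z.1.cut z.2 :=
  continuous_comb.comp (continuous_snd.prodMk (continuous_fst.prodMk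
    (continuous_point.comp (continuous_top.comp continuous_fst))))

theorem cut_zero (A : MaxPlusCompacts) : A.cut 0 = A := comb_zero _ _

theorem top_cut (ht0 : 0 ≤ t) (ht1 : t ≤ 1) : (A.cut t).top = A.top :=
  top_comb ht0 ht1 (top_point _).symm

theorem cut_subset (ht0 : 0 ≤ t) (ht1 : t ≤ 1) : ((A.cut t).1 : Set (ℕ → ℝ)) ⊆ A.1 := by
  intro c hc
  obtain ⟨a, ha, rfl⟩ := (mem_cut ht0).1 hc
  exact A.mix_mem ht0 ht1 ha A.top_mem

theorem cut_one (A : MaxPlusCompacts) : A.cut 1 = point A.top := by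
  have : ∀ a ∈ A.1, mix 1 a A.top = A.top := fun a ha => funext fun i =>
    le_antisymm (mix_le le_rfl (le_top ha i) le_rfl) (by
      rw [mix_of_pos one_pos, Real.log_one]; simp)
  refine ext_mem fun c => ?_
  rw [mem_cut zero_le_one, mem_point]
  exact ⟨fun ⟨a, ha, h⟩ => h ▸ this a ha, fun h => ⟨_, A.top_mem, h ▸ this _ A.top_mem⟩⟩

theorem cut_cut (hs0 : 0 ≤ s) (hs1 : s ≤ 1) (ht : 0 ≤ t) :
    (A.cut s).cut t = A.cut (max s t) := by
  refine ext_mem fun c => ?_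
  rw [mem_cut ht, mem_cut (hs0.trans (le_max_left _ _)), top_cut hs0 hs1]
  constructor
  · rintro ⟨b, hb, rfl⟩
    obtain ⟨a, ha, rfl⟩ := (mem_cut hs0).1 hb
    exact ⟨a, ha, (mix_mix _ _).symm⟩
  · rintro ⟨a, ha, rfl⟩
    exact ⟨_, (mem_cut hs0).2 ⟨a, ha, rfl⟩, mix_mix _ _⟩

theorem cut_comb (hr0 : 0 ≤ r) (hr1 : r ≤ 1) (ht : 0 ≤ t) (h : A.top = A'.top) :
    (comb r A A').cut t = comb r (A.cut t) (A'.cut t) := by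
  have key : ∀ a a', mix t (mix r a a') A.top = mix r (mix t a A.top) (mix t a' A.top) := by
    intro a a'
    rw [mix_comm_mix hr0 ht, mix_self hr1]
  refine ext_mem fun c => ?_
  rw [mem_cut ht, mem_comb hr0, top_comb hr0 hr1 h]
  constructor
  · rintro ⟨b, hb, rfl⟩
    obtain ⟨a, ha, a', ha', rfl⟩ := (mem_comb hr0).1 hb
    exact ⟨_, (mem_cut ht).2 ⟨a, ha, rfl⟩, _, (mem_cut ht).2 ⟨a', ha', rfl⟩, by
      rw [← h, key]⟩
  · rintro ⟨_, h1, _, h2, rfl⟩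
    obtain ⟨a, ha, rfl⟩ := (mem_cut ht).1 h1
    obtain ⟨a', ha', rfl⟩ := (mem_cut ht).1 h2
    exact ⟨_, (mem_comb hr0).2 ⟨a, ha, a', ha', rfl⟩, by rw [← h, key]⟩

theorem cut_anti (hs0 : 0 ≤ s) (hst : s ≤ t) (ht : t ≤ 1) :
    ((A.cut t).1 : Set (ℕ → ℝ)) ⊆ (A.cut s).1 := by
  have := cut_subset (A := A.cut s) (hs0.trans hst) ht
  rwa [cut_cut hs0 (hst.trans ht) (hs0.trans hst), max_eq_right hst] at this

theorem supOn_comb_mem_uIcc {φ : (ℕ → ℝ) → ℝ} (hφ : Continuous φ) (hr0 : 0 ≤ r)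
    (h : ∀ a b, φ (mix r a b) ∈ uIcc (φ a) (φ b)) :
    supOn φ (comb r A A').1 ∈ uIcc (supOn φ A.1) (supOn φ A'.1) := by
  constructor
  · obtain ⟨a, ha, h1⟩ := exists_eq_supOn hφ A.1
    obtain ⟨b, hb, h2⟩ := exists_eq_supOn hφ A'.1
    rw [← h1, ← h2]
    exact (h a b).1.trans (le_supOn hφ ((mem_comb hr0).2 ⟨a, ha, b, hb, rfl⟩))
  · refine supOn_le hφ fun c hc => ?_
    obtain ⟨a, ha, b, hb, rfl⟩ := (mem_comb hr0).1 hc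
    exact (h a b).2.trans (max_le_max (le_supOn hφ ha) (le_supOn hφ hb))

theorem isClosed_maxPlusConvex :
    IsClosed {K : TopologicalSpace.NonemptyCompacts (ℕ → ℝ) | MaxPlusConvex (K : Set (ℕ → ℝ))} := by
  have hc : ∀ r, Continuous fun z : (ℕ → ℝ) × (ℕ → ℝ) => mix r z.1 z.2 := fun r =>
    continuous_mix.comp (continuous_const.prodMk continuous_id)
  have : {K : TopologicalSpace.NonemptyCompacts (ℕ → ℝ) | MaxPlusConvex (K : Set (ℕ → ℝ))} =
      ⋂ r ∈ Icc (0 : ℝ) 1, {K | (K ×ˢ K).map _ (hc r) ⊔ K = K} := by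
    ext K
    simp only [mem_ofPred_eq, mem_iInter, sup_eq_right, maxPlusConvex_iff]
    refine forall₂_congr fun r hr => ⟨?_, fun h a ha b hb => h ⟨(a, b), ⟨ha, hb⟩, rfl⟩⟩
    rintro h _ ⟨⟨a, b⟩, ⟨ha, hb⟩, rfl⟩
    exact h a ha b hb
  rw [this]
  refine isClosed_biInter fun r _ => isClosed_eq ?_ continuous_id
  refine Continuous.sup ((hc r).nonemptyCompacts_map.comp ?_) continuous_id
  exact TopologicalSpace.NonemptyCompacts.continuous_prod.comp (continuous_id.prodMk continuous_id)

theorem exists_subseq_tendsto (C : ℕ → MaxPlusCompacts)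
    (h : ∀ i, ∃ l u, ∀ k, ∀ c ∈ (C k).1, c i ∈ Icc l u) :
    ∃ A, ∃ σ : ℕ → ℕ, StrictMono σ ∧ Tendsto (C ∘ σ) atTop (𝓝 A) := by
  choose l u h using h
  have hK : IsCompact {K : TopologicalSpace.NonemptyCompacts (ℕ → ℝ) |
      (K : Set (ℕ → ℝ)) ⊆ pi univ fun i => Icc (l i) (u i)} :=
    TopologicalSpace.NonemptyCompacts.isCompact_subsets_of_isCompact
      (isCompact_univ_pi fun i => isCompact_Icc)
  obtain ⟨A, -, σ, hσ, hA⟩ := (hK.inter_right isClosed_maxPlusConvex).tendsto_subseq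
    (x := fun k => (C k).1) fun k => ⟨fun c hc i _ => h i k c hc, (C k).2⟩
  have := isClosed_maxPlusConvex.mem_of_tendsto hA (Eventually.of_forall fun k => (C (σ k)).2)
  exact ⟨⟨A, this⟩, σ, hσ, tendsto_subtype_rng.2 hA⟩

end MaxPlusCompacts

/-- The positive part of `a - q`, maximized over the first `m` coordinates. -/
def excess (q : ℕ → ℝ) : ℕ → (ℕ → ℝ) → ℝ
  | 0, _ => 0
  | m + 1, a => max (excess q m a) (a m - q m)

theorem continuous_excess (q : ℕ → ℝ) (m : ℕ) : Continuous (excess q m) := by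
  induction m with
  | zero => exact continuous_const
  | succ m ih => exact ih.max (by fun_prop)

theorem excess_le_iff {q a : ℕ → ℝ} {m : ℕ} {c : ℝ} :
    excess q m a ≤ c ↔ 0 ≤ c ∧ ∀ j < m, a j - q j ≤ c := by
  induction m with
  | zero => simp [excess]
  | succ m ih => rw [excess, max_le_iff, ih, Nat.forall_lt_succ_right, and_assoc]

theorem excess_nonneg (q a : ℕ → ℝ) (m : ℕ) : 0 ≤ excess q m a :=
  (excess_le_iff.1 le_rfl).1

theorem sub_le_excess {q a : ℕ → ℝ} {m j : ℕ} (hj : j < m) : a j - q j ≤ excess q m a :=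
  (excess_le_iff.1 le_rfl).2 j hj

/-- Functionals that detect whether `q` belongs to a max-plus convex set. -/
def probe (q : ℕ → ℝ) (m : ℕ) (o : Option ℕ) (a : ℕ → ℝ) : ℝ :=
  (o.elim 0 fun i => a i - q i) - excess q m a

theorem continuous_probe (q : ℕ → ℝ) (m : ℕ) (o : Option ℕ) : Continuous (probe q m o) := by
  refine Continuous.sub ?_ (continuous_excess q m)
  cases o with
  | none => exact continuous_const
  | some i => exact (continuous_apply i).sub continuous_const

theorem probe_mix_mem_uIcc (q : ℕ → ℝ) (m : ℕ) (o : Option ℕ) {r : ℝ} (hr : r ∈ Icc (0 : ℝ) 1)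
    (a b : ℕ → ℝ) : probe q m o (mix r a b) ∈ uIcc (probe q m o a) (probe q m o b) := by
  rcases hr.1.eq_or_lt with rfl | h0
  · rw [mix_zero]; exact left_mem_uIcc
  have hs : Real.log r ≤ 0 := Real.log_nonpos hr.1 hr.2
  have hw : ∀ i, mix r a b i = max (a i) (Real.log r + b i) := fun i => by rw [mix_of_pos h0]
  set s := Real.log r
  set w := mix r a b
  have ha : ∀ i, a i ≤ w i := fun i => by rw [hw]; exact le_max_left _ _
  have hb : ∀ i, s + b i ≤ w i := fun i => by rw [hw]; exact le_max_right _ _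
  have hNa : excess q m a ≤ excess q m w := excess_le_iff.2 ⟨excess_nonneg _ _ _, fun j hj => by
    have := sub_le_excess (q := q) (a := w) hj
    linarith [ha j]⟩
  have hNb : excess q m b ≤ excess q m w - s := excess_le_iff.2
    ⟨by linarith [excess_nonneg q w m], fun j hj => by
      have := sub_le_excess (q := q) (a := w) hj
      linarith [hb j]⟩
  have hN : excess q m w ≤ max (excess q m a) (s + excess q m b) :=
    excess_le_iff.2 ⟨le_max_of_le_left (excess_nonneg _ _ _), fun j hj => by
      have h1 := sub_le_excess (q := q) (a := a) hj
      have h2 := sub_le_excess (q := q) (a := b) hj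
      rw [hw]
      rcases le_total (a j) (s + b j) with h | h
      · rw [max_eq_right h]; exact le_max_of_le_right (by linarith)
      · rw [max_eq_left h]; exact le_max_of_le_left (by linarith)⟩
  cases o with
  | none =>
    constructor
    · simp only [probe, Option.elim_none]
      rcases le_max_iff.1 hN with h | h
      · exact min_le_of_left_le (by linarith)
      · exact min_le_of_right_le (by linarith)
    · exact le_max_of_le_left (by simp only [probe, Option.elim_none]; linarith)
  | some i =>
    simp only [probe, Option.elim_some]
    constructor
    · rcases le_max_iff.1 hN with h | h
      · exact min_le_of_left_le (by linarith [ha i])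
      · exact min_le_of_right_le (by linarith [hb i])
    · rcases le_total (a i) (s + b i) with h | h
      · exact le_max_of_le_right (by linarith [hw i, max_eq_right h])
      · exact le_max_of_le_left (by linarith [hw i, max_eq_left h])

theorem exists_finsupp_rat_near (x : ℕ → ℝ) (m : ℕ) {ε : ℝ} (hε : 0 < ε) :
    ∃ q : ℕ →₀ ℚ, ∀ j < m, |x j - q j| < ε := by
  choose r hr using fun j => exists_rat_near (x j) hε
  refine ⟨Finsupp.onFinset (Finset.range m) (fun j => if j < m then r j else 0) ?_, fun j hj => ?_⟩
  · intro j hj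
    by_contra h
    exact hj (if_neg (by simpa using h))
  · simp [hj, hr]

open MaxPlusCompacts in
theorem mem_of_supOn_probe_le {A A' : MaxPlusCompacts}
    (h : ∀ (q : ℕ →₀ ℚ) m o, supOn (probe (fun i => q i) m o) A.1 ≤
      supOn (probe (fun i => q i) m o) A'.1) {x : ℕ → ℝ} (hx : x ∈ A.1) : x ∈ A'.1 := by
  have key : ∀ m : ℕ, ∀ ε > 0, ∃ b ∈ A'.1, ∀ j < m, |b j - x j| ≤ 3 * ε := by
    intro m ε hε
    obtain ⟨q, hq⟩ := exists_finsupp_rat_near x m hε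
    have hq' : ∀ j < m, (q j : ℝ) - ε ≤ x j ∧ x j ≤ q j + ε := fun j hj => by
      have := abs_lt.1 (hq j hj); constructor <;> linarith
    have hNx : excess (fun i => q i) m x ≤ ε := excess_le_iff.2 ⟨hε.le, fun j hj => by
      linarith [(hq' j hj).2]⟩
    have hp : ∀ o, ∃ b ∈ A'.1, probe (fun i => q i) m o x ≤ probe (fun i => q i) m o b := by
      intro o
      obtain ⟨b, hb, h'⟩ := exists_eq_supOn (continuous_probe (fun i => q i) m o) A'.1
      exact ⟨b, hb, (le_supOn (continuous_probe _ m o) hx).trans ((h q m o).trans h'.ge)⟩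
    have hstep : ∀ k ≤ m, ∃ b ∈ A'.1, (∀ j < m, b j ≤ q j + ε) ∧ ∀ j < k, q j - 2 * ε ≤ b j := by
      intro k
      induction k with
      | zero =>
        intro _
        obtain ⟨b, hb, h1⟩ := hp none
        refine ⟨b, hb, fun j hj => ?_, by simp⟩
        simp only [probe, Option.elim_none] at h1
        have := sub_le_excess (q := fun i => (q i : ℝ)) (a := b) hj
        linarith
      | succ k ih =>
        intro hk
        obtain ⟨b, hb, h1, h2⟩ := ih (by omega)
        obtain ⟨c, hc, h3⟩ := hp (some k)
        simp only [probe, Option.elim_some] at h3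
        set s := excess (fun i => (q i : ℝ)) m c
        refine ⟨_, A'.2 b hb c hc (-s) (neg_nonpos.2 (excess_nonneg _ _ _)), fun j hj => ?_,
          fun j hj => ?_⟩
        · have := sub_le_excess (q := fun i => (q i : ℝ)) (a := c) hj
          exact max_le (h1 j hj) (by linarith)
        · rcases Nat.lt_succ_iff_lt_or_eq.1 hj with hj | rfl
          · exact le_max_of_le_left (h2 j hj)
          · exact le_max_of_le_right (by linarith [(hq' j hk).1])
    obtain ⟨b, hb, h1, h2⟩ := hstep m le_rfl
    refine ⟨b, hb, fun j hj => abs_le.2 ⟨?_, ?_⟩⟩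
    · linarith [h2 j hj, (hq' j hj).2]
    · linarith [h1 j hj, (hq' j hj).1]
  choose b hb hbx using fun n : ℕ => key n (1 / (n + 1)) Nat.one_div_pos_of_nat
  refine A'.1.isCompact.isClosed.mem_of_tendsto (b := atTop) (f := b) ?_ (Eventually.of_forall hb)
  refine tendsto_pi_nhds.2 fun i => tendsto_iff_dist_tendsto_zero.2 ?_
  refine squeeze_zero' (Eventually.of_forall fun _ => dist_nonneg) ?_
    (g := fun n : ℕ => 3 * (1 / ((n : ℝ) + 1))) ?_
  · filter_upwards [eventually_gt_atTop i] with n hn using hbx n i hn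
  · simpa using tendsto_one_div_add_atTop_nhds_zero_nat.const_mul (3 : ℝ)

/-- Countably many quasi-affine functionals separate max-plus convex compact sets. -/
theorem exists_separating : ∃ φ : ℕ → (ℕ → ℝ) → ℝ, (∀ n, Continuous (φ n)) ∧
    (∀ n, ∀ r ∈ Icc (0 : ℝ) 1, ∀ a b, φ n (mix r a b) ∈ uIcc (φ n a) (φ n b)) ∧
    ∀ A A' : MaxPlusCompacts, (∀ n, supOn (φ n) A.1 = supOn (φ n) A'.1) → A = A' := by
  obtain ⟨e, he⟩ := exists_surjective_nat ((ℕ →₀ ℚ) × ℕ × Option ℕ)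
  refine ⟨fun n => probe (fun i => (e n).1 i) (e n).2.1 (e n).2.2, fun n => continuous_probe _ _ _,
    fun n r hr a b => probe_mix_mem_uIcc _ _ _ hr a b, fun A A' h => ?_⟩
  refine MaxPlusCompacts.ext_mem fun x => ⟨fun hx => ?_, fun hx => ?_⟩
  · refine mem_of_supOn_probe_le (fun q m o => ?_) hx
    obtain ⟨n, hn⟩ := he (q, m, o)
    simpa [hn] using (h n).le
  · refine mem_of_supOn_probe_le (fun q m o => ?_) hx
    obtain ⟨n, hn⟩ := he (q, m, o)
    simpa [hn] using (h n).ge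

/-- A strictly monotone function on the hyperspace which is positive exactly on the subsets
of the open set `X`. -/
theorem exists_level {X : Set (ℕ → ℝ)} (hX : IsOpen X) : ∃ L : MaxPlusCompacts → ℝ,
    Continuous L ∧ (∀ A, 0 < L A ↔ (A.1 : Set (ℕ → ℝ)) ⊆ X) ∧
    (∀ A B : MaxPlusCompacts, (A.1 : Set (ℕ → ℝ)) ⊆ B.1 → L B ≤ L A) ∧
    ∀ A B : MaxPlusCompacts, (A.1 : Set (ℕ → ℝ)) ⊆ B.1 → L A = L B → 0 < L A → A = B := by
  obtain ⟨φ, hφ, -, hsep⟩ := exists_separating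
  let _ := TopologicalSpace.metrizableSpaceMetric (ℕ → ℝ)
  have hd : Continuous fun a => - gap X a := (continuous_gap X).neg
  let δ : MaxPlusCompacts → ℝ := fun A => - supOn (fun a => - gap X a) A.1
  have hδc : Continuous δ := ((continuous_supOn hd).comp continuous_subtype_val).neg
  have hδ : ∀ A, ∃ a ∈ A.1, δ A = gap X a := fun A => by
    obtain ⟨a, ha, h⟩ := exists_eq_supOn hd A.1
    exact ⟨a, ha, by simp only [δ, ← h, neg_neg]⟩
  have hδle : ∀ A, ∀ a ∈ A.1, δ A ≤ gap X a := fun A a ha => by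
    have := le_supOn hd ha
    simp only [δ]; linarith
  have hδmono : ∀ A B : MaxPlusCompacts, (A.1 : Set (ℕ → ℝ)) ⊆ B.1 → δ B ≤ δ A :=
    fun A B h => neg_le_neg (supOn_mono hd h)
  have hδ0 : ∀ A, 0 ≤ δ A := fun A => by
    obtain ⟨a, -, h⟩ := hδ A
    exact h ▸ gap_nonneg _ _
  have hδpos : ∀ A, 0 < δ A ↔ (A.1 : Set (ℕ → ℝ)) ⊆ X := fun A => by
    refine ⟨fun h a ha => (gap_pos_iff hX).1 (h.trans_le (hδle A a ha)), fun h => ?_⟩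
    obtain ⟨a, ha, h'⟩ := hδ A
    exact h' ▸ (gap_pos_iff hX).2 (h ha)
  let σ : ℝ → ℝ := fun w => w / (1 + |w|)
  have hσ1 : ∀ w : ℝ, 0 < 1 + |w| := fun w => by positivity
  have hσb : ∀ w, |σ w| ≤ 1 := fun w => by
    rw [abs_div, abs_of_pos (hσ1 w), div_le_one (hσ1 w)]; linarith
  have hσc : Continuous σ := continuous_id.div (by fun_prop) fun w => (hσ1 w).ne'
  have hσm : StrictMono σ := by
    intro v w h
    simp only [σ]
    rw [div_lt_div_iff₀ (hσ1 v) (hσ1 w)]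
    rcases abs_cases v with ⟨h1, h1'⟩ | ⟨h1, h1'⟩ <;>
      rcases abs_cases w with ⟨h2, h2'⟩ | ⟨h2, h2'⟩ <;>
      rw [h1, h2] <;> nlinarith
  let term : MaxPlusCompacts → ℕ → ℝ := fun A n => (1 / 2) ^ n * σ (supOn (φ n) A.1)
  have hterm : ∀ n A, ‖term A n‖ ≤ (1 / 2) ^ n := fun n A => by
    rw [Real.norm_eq_abs, abs_mul, abs_of_pos (by positivity : (0 : ℝ) < (1 / 2) ^ n)]
    exact mul_le_of_le_one_right (by positivity) (hσb _)
  have hsum : ∀ A, Summable (term A) := fun A =>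
    Summable.of_norm_bounded summable_geometric_two fun n => hterm n A
  have htmono : ∀ A B : MaxPlusCompacts, (A.1 : Set (ℕ → ℝ)) ⊆ B.1 → ∀ n, term A n ≤ term B n :=
    fun A B h n => mul_le_mul_of_nonneg_left (hσm.monotone (supOn_mono (hφ n) h)) (by positivity)
  let m : MaxPlusCompacts → ℝ := fun A => ∑' n, term A n
  have hmc : Continuous m := continuous_tsum (fun n => continuous_const.mul
    (hσc.comp ((continuous_supOn (hφ n)).comp continuous_subtype_val))) summable_geometric_two hterm
  have hm2 : ∀ A, m A ≤ 2 := fun A => by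
    rw [← tsum_geometric_two]
    exact (hsum A).tsum_le_tsum (fun n => (le_abs_self _).trans (hterm n A)) summable_geometric_two
  have hmmono : ∀ A B : MaxPlusCompacts, (A.1 : Set (ℕ → ℝ)) ⊆ B.1 → m A ≤ m B := fun A B h =>
    (hsum A).tsum_le_tsum (htmono A B h) (hsum B)
  refine ⟨fun A => δ A * (3 - m A), hδc.mul (continuous_const.sub hmc), fun A => ?_,
    fun A B h => ?_, fun A B h heq hpos => ?_⟩
  · rw [mul_pos_iff_of_pos_right (by linarith [hm2 A]), hδpos]
  · exact mul_le_mul (hδmono A B h) (by linarith [hmmono A B h]) (by linarith [hm2 B]) (hδ0 A)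
  · have h1 := hδmono A B h
    have h2 := hmmono A B h
    have h3 := hm2 A
    have h4 : 0 < δ A := by
      rwa [mul_pos_iff_of_pos_right (by linarith)] at hpos
    have heq : δ A * (3 - m A) = δ B * (3 - m B) := heq
    have hm : m A = m B := by
      refine le_antisymm h2 (not_lt.1 fun h5 => ?_)
      have := hm2 B
      nlinarith
    refine hsep A B fun n => hσm.injective ?_
    have hn : term A n = term B n := by
      by_contra hne
      exact (Summable.tsum_lt_tsum (htmono A B h) (lt_of_le_of_ne (htmono A B h n) hne)
        (hsum A) (hsum B)).ne hm
    exact mul_left_cancel₀ (by positivity) hn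

section Threshold

variable {Q M : Type*} [TopologicalSpace Q] [TopologicalSpace M]

/-- A continuous threshold `t` which is safe (`R` stays positive over the compact fibres of `B`
on which `ψ ≤ 0`) and nearly optimal. -/
theorem exists_threshold [TopologicalSpace.MetrizableSpace Q]
    {B : Set (Q × M)} (hB : IsClosed B)
    (hBp : ∀ (b : ℕ → Q) (C : ℕ → M) b₀, Tendsto b atTop (𝓝 b₀) → (∀ k, (b k, C k) ∈ B) →
      ∃ A, ∃ σ : ℕ → ℕ, StrictMono σ ∧ Tendsto (C ∘ σ) atTop (𝓝 A))
    {ψ : Q × M → ℝ} (hψ : Continuous ψ) {R : Q × M × ℝ → ℝ} (hR : Continuous R)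
    (hmono : ∀ b C s t, 0 ≤ s → s ≤ t → t ≤ 1 → R (b, C, s) ≤ R (b, C, t))
    (hone : ∀ b C, (b, C) ∈ B → 0 < R (b, C, 1)) {η : ℝ} (hη : 0 < η) :
    ∃ t : Q → ℝ, Continuous t ∧ (∀ b, t b ∈ Icc (0 : ℝ) 1) ∧
      (∀ b C, (b, C) ∈ B → ψ (b, C) ≤ 0 → 0 < R (b, C, t b)) ∧
      ∀ b, t b < η ∨ ∃ C, ψ (b, C) < η ∧ R (b, C, t b) < η := by
  let _ := TopologicalSpace.metrizableSpaceMetric Q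
  let W : Set (Q × ℝ) := {z | ∀ C, (z.1, C) ∈ B → ψ (z.1, C) ≤ 0 → 0 < R (z.1, C, z.2)}
  have hW : IsOpen W := by
    rw [← isClosed_compl_iff]
    refine IsSeqClosed.isClosed fun z z₀ hz hz₀ => ?_
    have : ∀ k, ∃ C, ((z k).1, C) ∈ B ∧ ψ ((z k).1, C) ≤ 0 ∧ R ((z k).1, C, (z k).2) ≤ 0 := by
      intro k
      simpa [W] using hz k
    choose C hC hψC hRC using this
    obtain ⟨A, σ, hσ, hA⟩ := hBp _ C _ ((continuous_fst.tendsto z₀).comp hz₀) hC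
    have hzσ : Tendsto (z ∘ σ) atTop (𝓝 z₀) := hz₀.comp hσ.tendsto_atTop
    have h1 : Tendsto (fun k => ((z (σ k)).1, C (σ k))) atTop (𝓝 (z₀.1, A)) :=
      ((continuous_fst.tendsto z₀).comp hzσ).prodMk_nhds hA
    have h2 : Tendsto (fun k => ((z (σ k)).1, C (σ k), (z (σ k)).2)) atTop (𝓝 (z₀.1, A, z₀.2)) :=
      ((continuous_fst.tendsto z₀).comp hzσ).prodMk_nhds
        (hA.prodMk_nhds ((continuous_snd.tendsto z₀).comp hzσ))
    intro hz₀W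
    refine (hz₀W A (hB.mem_of_tendsto h1 (Eventually.of_forall fun k => hC _)) ?_).not_ge ?_
    · exact le_of_tendsto ((hψ.tendsto _).comp h1) (Eventually.of_forall fun k => hψC _)
    · exact le_of_tendsto ((hR.tendsto _).comp h2) (Eventually.of_forall fun k => hRC _)
  have hWup : ∀ b s t, 0 ≤ s → s ≤ t → t ≤ 1 → (b, s) ∈ W → (b, t) ∈ W :=
    fun b s t h0 hst h1 h C hC hψC => (h C hC hψC).trans_le (hmono b C s t h0 hst h1)
  let V : Set (Q × ℝ) := {z | z.2 < η ∨ ∃ C, ψ (z.1, C) < η ∧ R (z.1, C, z.2) < η}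
  have hV : IsOpen V := by
    have : V = {z | z.2 < η} ∪ ⋃ C, ({z | ψ (z.1, C) < η} ∩ {z | R (z.1, C, z.2) < η}) := by
      ext z; simp [V]
    rw [this]
    refine (isOpen_lt continuous_snd continuous_const).union (isOpen_iUnion fun C => ?_)
    exact (isOpen_lt (hψ.comp (by fun_prop)) continuous_const).inter
      (isOpen_lt (hR.comp (by fun_prop)) continuous_const)
  have hVdown : ∀ b s t, 0 ≤ s → s ≤ t → t ≤ 1 → (b, t) ∈ V → (b, s) ∈ V := by
    rintro b s t h0 hst h1 (h | ⟨C, h, h'⟩)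
    · exact Or.inl (hst.trans_lt h)
    · exact Or.inr ⟨C, h, (hmono b C s t h0 hst h1).trans_lt h'⟩
  let T : Q → Set ℝ := fun b => {t | t ∈ Icc (0 : ℝ) 1 ∧ (b, t) ∈ W ∧ (b, t) ∈ V}
  have hne : ∀ b, (T b).Nonempty := by
    intro b
    let S : Set ℝ := {t | t ∈ Icc (0 : ℝ) 1 ∧ (b, t) ∈ W}
    have h1S : (1 : ℝ) ∈ S := ⟨⟨zero_le_one, le_rfl⟩, fun C hC _ => hone b C hC⟩
    have hSb : BddBelow S := ⟨0, fun t ht => ht.1.1⟩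
    set τ := sInf S
    have hτ0 : 0 ≤ τ := le_csInf ⟨1, h1S⟩ fun t ht => ht.1.1
    have hτ1 : τ ≤ 1 := csInf_le hSb h1S
    by_cases hτ : (b, τ) ∈ W
    · rcases hτ0.eq_or_lt with h | h
      · exact ⟨τ, ⟨hτ0, hτ1⟩, hτ, Or.inl (by simpa [← h] using hη)⟩
      · have hev : ∀ᶠ s in 𝓝[<] τ, (b, s) ∈ W ∧ 0 < s :=
          (((hW.preimage (f := fun s : ℝ => (b, s)) (by fun_prop)).eventually_mem hτ).and
            (eventually_gt_nhds h)).filter_mono nhdsWithin_le_nhds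
        obtain ⟨s, ⟨hs, hs0⟩, hsτ⟩ := (hev.and self_mem_nhdsWithin).exists
        have hsτ : s < τ := hsτ
        exact absurd (csInf_le hSb (show s ∈ S from ⟨⟨hs0.le, hsτ.le.trans hτ1⟩, hs⟩)) hsτ.not_ge
    · obtain ⟨C, hC, hψC, hRC⟩ : ∃ C, (b, C) ∈ B ∧ ψ (b, C) ≤ 0 ∧ R (b, C, τ) ≤ 0 := by
        simpa [W] using hτ
      have hev : ∀ᶠ s in 𝓝 τ, R (b, C, s) < η :=
        (hR.comp (f := fun s : ℝ => (b, C, s)) (by fun_prop)).continuousAt.eventually_lt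
          continuousAt_const (hRC.trans_lt hη)
      obtain ⟨s, hs, hsV⟩ := (mem_closure_iff_frequently.1
        (csInf_mem_closure ⟨1, h1S⟩ hSb)).and_eventually hev |>.exists
      exact ⟨s, hs.1, hs.2, Or.inr ⟨C, hψC.trans_lt hη, hsV⟩⟩
  obtain ⟨t, ht⟩ := exists_continuous_forall_mem_convex_of_local_const (t := T)
    (fun b => OrdConnected.convex ⟨fun x hx y hy z hz =>
      ⟨⟨hx.1.1.trans hz.1, hz.2.trans hy.1.2⟩,
        hWup b x z hx.1.1 hz.1 (hz.2.trans hy.1.2) hx.2.1,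
        hVdown b z y (hx.1.1.trans hz.1) hz.2 hy.1.2 hy.2.2⟩⟩)
    (fun b => by
      obtain ⟨c, hc, hcW, hcV⟩ := hne b
      refine ⟨c, ?_⟩
      filter_upwards [(hW.preimage (f := fun b : Q => (b, c)) (by fun_prop)).mem_nhds hcW,
        (hV.preimage (f := fun b : Q => (b, c)) (by fun_prop)).mem_nhds hcV] with b' h1 h2
      exact ⟨hc, h1, h2⟩)
  exact ⟨t, t.continuous, fun b => (ht b).1, fun b => (ht b).2.1, fun b => (ht b).2.2⟩

end Threshold

/-- A decreasing sequence of thresholds, each adapted to the constraints imposed by the previous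
ones. -/
theorem exists_threshold_seq {P M : Type*} [TopologicalSpace P] [TopologicalSpace M]
    [TopologicalSpace.MetrizableSpace P] {B : Set (P × M)} (hB : IsClosed B)
    (hBp : ∀ (b : ℕ → P) (C : ℕ → M) b₀, Tendsto b atTop (𝓝 b₀) → (∀ k, (b k, C k) ∈ B) →
      ∃ A, ∃ σ : ℕ → ℕ, StrictMono σ ∧ Tendsto (C ∘ σ) atTop (𝓝 A))
    {κ : ℕ → (P × (ℕ → ℝ)) × M × ℝ → ℝ} (hκ : ∀ n, Continuous (κ n))
    (hκdep : ∀ n p e e' C t, (∀ i < 2 * (n + 1), e i = e' i) →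
      κ n ((p, e), C, t) = κ n ((p, e'), C, t))
    {R : P × M × ℝ → ℝ} (hR : Continuous R)
    (hmono : ∀ b C s t, 0 ≤ s → s ≤ t → t ≤ 1 → R (b, C, s) ≤ R (b, C, t))
    (hone : ∀ b C, (b, C) ∈ B → 0 < R (b, C, 1)) :
    ∃ t : ℕ → P × (ℕ → ℝ) → ℝ, (∀ n, Continuous (t n)) ∧ (∀ n b, t n b ∈ Icc (0 : ℝ) 1) ∧
      (∀ n b, t (n + 1) b ≤ t n b) ∧
      (∀ n p e e', (∀ i < 2 * n, e i = e' i) → t n (p, e) = t n (p, e')) ∧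
      (∀ n b C, (b.1, C) ∈ B → (∀ j < n, κ j (b, C, t j b) ≤ 0) → 0 < R (b.1, C, t n b)) ∧
      ∀ n b, t (n + 1) b < 1 / ((n : ℝ) + 1) ∨ ∃ C,
        (∀ j < n + 1, κ j (b, C, t j b) < 1 / ((n : ℝ) + 1)) ∧
        R (b.1, C, t (n + 1) b) < 1 / ((n : ℝ) + 1) := by
  -- a stage consists of a threshold and of the accumulated constraint
  let Good : ℕ → (P × (ℕ → ℝ) → ℝ) × ((P × (ℕ → ℝ)) × M → ℝ) → Prop := fun n s =>
    Continuous s.1 ∧ Continuous s.2 ∧ (∀ b, s.1 b ∈ Icc (0 : ℝ) 1) ∧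
    (∀ p e e', (∀ i < 2 * n, e i = e' i) → s.1 (p, e) = s.1 (p, e')) ∧
    (∀ p e e' C, (∀ i < 2 * n, e i = e' i) → s.2 ((p, e), C) = s.2 ((p, e'), C)) ∧
    ∀ b C, (b.1, C) ∈ B → s.2 (b, C) ≤ 0 → 0 < R (b.1, C, s.1 b)
  have step : ∀ n s, Good n s → ∃ s', Good (n + 1) s' ∧
      (∀ z, s'.2 z = max (s.2 z) (κ n (z.1, z.2, s.1 z.1))) ∧ (∀ b, s'.1 b ≤ s.1 b) ∧
      ∀ b, s'.1 b < 1 / ((n : ℝ) + 1) ∨ ∃ C, s'.2 (b, C) < 1 / ((n : ℝ) + 1) ∧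
        R (b.1, C, s'.1 b) < 1 / ((n : ℝ) + 1) := by
    rintro n ⟨t, ψ⟩ ⟨ht, hψ, htI, htdep, hψdep, hsafe⟩
    simp only at ht hψ htI htdep hψdep hsafe
    let ψ' : (P × (ℕ → ℝ)) × M → ℝ := fun z => max (ψ z) (κ n (z.1, z.2, t z.1))
    have hψ' : Continuous ψ' := hψ.max ((hκ n).comp (by fun_prop))
    have hψ'dep : ∀ p e e' C, (∀ i < 2 * (n + 1), e i = e' i) →
        ψ' ((p, e), C) = ψ' ((p, e'), C) := by
      intro p e e' C h
      simp only [ψ']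
      rw [hψdep p e e' C fun i hi => h i (by omega), htdep p e e' fun i hi => h i (by omega),
        hκdep n p e e' C _ h]
    obtain ⟨t₀, ht₀, ht₀I, ht₀s, ht₀p⟩ := exists_threshold (Q := P × (ℕ → ℝ)) (M := M)
      (B := {z | (z.1.1, z.2) ∈ B}) (hB.preimage (by fun_prop))
      (fun b C b₀ hb hC => hBp _ C _ ((continuous_fst.tendsto _).comp hb) hC) hψ'
      (R := fun z => R (z.1.1, z.2)) (hR.comp (by fun_prop)) (fun b => hmono b.1)
      (fun b => hone b.1) (η := 1 / ((n : ℝ) + 1)) Nat.one_div_pos_of_nat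
    let τ : P × (ℕ → ℝ) → P × (ℕ → ℝ) := fun b => (b.1, trunc (2 * (n + 1)) b.2)
    have hτ : Continuous τ := continuous_fst.prodMk ((continuous_trunc _).comp continuous_snd)
    have hψτ : ∀ b C, ψ' (τ b, C) = ψ' (b, C) := fun b C =>
      hψ'dep _ _ _ _ fun i hi => trunc_apply hi _
    refine ⟨(fun b => min (t b) (t₀ (τ b)), ψ'), ⟨ht.min (ht₀.comp hτ), hψ', fun b => ?_,
      fun p e e' h => ?_, hψ'dep, fun b C hC hψC => ?_⟩, fun z => rfl, fun b => min_le_left _ _,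
      fun b => ?_⟩
    · exact ⟨le_min (htI b).1 (ht₀I _).1, min_le_of_left_le (htI b).2⟩
    · simp only [τ]
      rw [htdep p e e' fun i hi => h i (by omega), trunc_congr h]
    · rcases min_choice (t b) (t₀ (τ b)) with h | h
      · simp only [h]
        exact hsafe b C hC ((le_max_left _ _).trans hψC)
      · simp only [h]
        exact ht₀s (τ b) C hC ((hψτ b C).trans_le hψC)
    · rcases ht₀p (τ b) with h | ⟨C, h1, h2⟩
      · exact Or.inl (min_lt_of_right_lt h)
      · refine Or.inr ⟨C, (hψτ b C).symm.trans_lt h1, lt_of_le_of_lt ?_ h2⟩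
        exact hmono _ _ _ _ (le_min (htI b).1 (ht₀I _).1) (min_le_right _ _) (ht₀I _).2
  have base : Good 0 (fun _ => 1, fun _ => -1) :=
    ⟨continuous_const, continuous_const, fun _ => ⟨zero_le_one, le_rfl⟩, fun _ _ _ _ => rfl,
      fun _ _ _ _ _ => rfl, fun b C hC _ => hone b.1 C hC⟩
  choose nxt hnxt using step
  let s : ∀ n, {s // Good n s} := fun n =>
    Nat.rec ⟨_, base⟩ (fun n s => ⟨nxt n s.1 s.2, (hnxt n s.1 s.2).1⟩) n
  have hs : ∀ n, (∀ z, (s (n + 1)).1.2 z = max ((s n).1.2 z) (κ n (z.1, z.2, (s n).1.1 z.1))) ∧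
      (∀ b, (s (n + 1)).1.1 b ≤ (s n).1.1 b) ∧
      ∀ b, (s (n + 1)).1.1 b < 1 / ((n : ℝ) + 1) ∨ ∃ C, (s (n + 1)).1.2 (b, C) < 1 / ((n : ℝ) + 1) ∧
        R (b.1, C, (s (n + 1)).1.1 b) < 1 / ((n : ℝ) + 1) :=
    fun n => (hnxt n (s n).1 (s n).2).2
  have hψ : ∀ n b C, (∀ j < n, κ j (b, C, (s j).1.1 b) ≤ 0) → (s n).1.2 (b, C) ≤ 0 := by
    intro n b C
    induction n with
    | zero => intro _; exact neg_nonpos.2 zero_le_one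
    | succ n ih =>
      intro h
      rw [(hs n).1]
      exact max_le (ih fun j hj => h j (by omega)) (h n (by omega))
  have hψ' : ∀ n b C c, (s n).1.2 (b, C) < c → ∀ j < n, κ j (b, C, (s j).1.1 b) < c := by
    intro n b C c
    induction n with
    | zero => intro _ j hj; omega
    | succ n ih =>
      intro h j hj
      rw [(hs n).1, max_lt_iff] at h
      rcases Nat.lt_succ_iff_lt_or_eq.1 hj with hj | rfl
      · exact ih h.1 j hj
      · exact h.2
  refine ⟨fun n => (s n).1.1, fun n => (s n).2.1, fun n => (s n).2.2.2.1, fun n => (hs n).2.1,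
    fun n => (s n).2.2.2.2.1, fun n b C hC h => (s n).2.2.2.2.2.2 b C hC (hψ n b C h),
    fun n b => ?_⟩
  refine ((hs n).2.2 b).imp_right fun ⟨C, h1, h2⟩ => ⟨C, hψ' _ b C _ h1, h2⟩

theorem isPreconnected_of_image_inducing {α β : Type*} [TopologicalSpace α] [TopologicalSpace β]
    {ι : α → β} (hι : IsInducing ι) {T : Set β} (hT : IsPreconnected T) (hr : T ⊆ range ι) :
    IsPreconnected (ι ⁻¹' T) := by
  rw [← hι.isPreconnected_image, image_preimage_eq_of_subset hr]
  exact hT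

theorem cauchySeq_of_approx {w : ℕ → ℝ}
    (h : ∀ ε > 0, ∃ v : ℕ → ℝ, CauchySeq v ∧ ∀ᶠ k in atTop, |v k - w k| < ε) : CauchySeq w := by
  refine Metric.cauchySeq_iff'.2 fun ε hε => ?_
  obtain ⟨v, hv, hvw⟩ := h (ε / 3) (by positivity)
  obtain ⟨N, hN⟩ := Metric.cauchySeq_iff.1 hv (ε / 3) (by positivity)
  obtain ⟨N', hN'⟩ := eventually_atTop.1 hvw
  refine ⟨max N N', fun n hn => ?_⟩
  have h1 := hN n ((le_max_left _ _).trans hn) (max N N') (le_max_left _ _)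
  have h2 := hN' n ((le_max_right _ _).trans hn)
  have h3 := hN' (max N N') (le_max_right _ _)
  rw [Real.dist_eq] at h1 ⊢
  rw [abs_lt] at *
  constructor <;> linarith

theorem exists_pair_small (i : ℕ) {ε : ℝ} (hε : 0 < ε) :
    ∃ n : ℕ, n.unpair.1 = i ∧ ((1 : ℝ) / 2) ^ (2 * n) < ε := by
  obtain ⟨m, hm⟩ := exists_pow_lt_of_lt_one hε (by norm_num : (1 : ℝ) / 2 < 1)
  refine ⟨Nat.pair i m, by simp, lt_of_le_of_lt ?_ hm⟩
  have := Nat.right_le_pair i m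
  exact pow_le_pow_of_le_one (by norm_num) (by norm_num) (by omega)

/-- The fibres of a product of epigraphs are absorbed by `ℕ → ℝ`. -/
theorem nonempty_homeomorph_epigraph {U : Type*} [TopologicalSpace U]
    [TopologicalSpace.MetrizableSpace U] {c : ℕ → U → ℝ} (hc : ∀ j, Continuous (c j)) :
    Nonempty ({z : U × (ℕ → ℝ) // ∀ j, c j z.1 ≤ Real.exp (z.2 j)} × (ℕ → ℝ) ≃ₜ
      U × (ℕ → ℝ)) := by
  set Y := {z : U × (ℕ → ℝ) // ∀ j, c j z.1 ≤ Real.exp (z.2 j)}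
  have : TopologicalSpace.MetrizableSpace Y := IsEmbedding.subtypeVal.metrizableSpace
  let sec : Y → U → Y := fun y A =>
    ⟨(A, fun j => Real.log (max (Real.exp (y.1.2 j)) (c j A))), fun j => by
      rw [Real.exp_log (lt_max_of_lt_left (Real.exp_pos _))]
      exact le_max_right _ _⟩
  have hsec : ∀ y, Continuous (sec y) := fun y => by
    refine (continuous_id.prodMk (continuous_pi fun j => ?_)).subtype_mk _
    exact Continuous.log (continuous_const.max (hc j))
      fun A => (lt_max_of_lt_left (Real.exp_pos _)).ne'
  have hsec' : ∀ y, sec y y.1.1 = y := fun y => Subtype.ext (Prod.ext rfl (funext fun j => by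
    simp only [sec]
    rw [max_eq_left (y.2 j), Real.log_exp]))
  have hp : Continuous fun y : Y => y.1.1 := continuous_fst.comp continuous_subtype_val
  have hcoord : ∀ j, Continuous fun y : Y => y.1.2 j := fun j =>
    (continuous_apply j).comp (continuous_snd.comp continuous_subtype_val)
  refine nonempty_homeomorph_of_fat (p := fun y : Y => y.1.1)
    (f := fun n x => x.1.1.2 n.unpair.1) hp
    (IsOpenMap.of_sections fun y => ⟨sec y, (hsec y).continuousAt, hsec' y, fun A => rfl⟩)
    (fun A => ⟨⟨(A, fun j => Real.log (max 1 (c j A))), fun j => by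
      rw [Real.exp_log (lt_max_of_lt_left one_pos)]; exact le_max_right _ _⟩, rfl⟩)
    (fun n => (hcoord _).comp continuous_fst) (fun _ _ _ _ _ => rfl) ?_ ?_
  · intro N y y' e hyy' _ _
    refine ⟨Subtype.val ⁻¹' ({y.1.1} ×ˢ pi univ fun j => uIcc (y.1.2 j) (y'.1.2 j)),
      isPreconnected_of_image_inducing IsInducing.subtypeVal
        (isPreconnected_singleton.prod (isPreconnected_univ_pi fun j => isPreconnected_uIcc)) ?_,
      ⟨rfl, fun j _ => left_mem_uIcc⟩, ⟨hyy'.symm, fun j _ => right_mem_uIcc⟩,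
      fun z hz => ⟨hz.1, fun n _ => hz.2 _ (mem_univ _)⟩⟩
    rintro ⟨A, u⟩ ⟨hA, hu⟩
    refine ⟨⟨(A, u), fun j => ?_⟩, rfl⟩
    have hA : A = y.1.1 := hA
    have h1 := y.2 j
    have h2 := y'.2 j
    rw [← hyy'] at h2
    subst hA
    rcases min_choice (y.1.2 j) (y'.1.2 j) with h | h
    · exact h1.trans (Real.exp_le_exp.2 (h.ge.trans (hu j (mem_univ j)).1))
    · exact h2.trans (Real.exp_le_exp.2 (h.ge.trans (hu j (mem_univ j)).1))
  · intro y e A₀ e₀ hA he hd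
    have hcau : ∀ j, CauchySeq fun k => (y k).1.2 j := fun j => by
      refine cauchySeq_of_approx fun ε hε => ?_
      obtain ⟨n, rfl, hn⟩ := exists_pair_small j hε
      refine ⟨fun k => e k (2 * n), (tendsto_pi_nhds.1 he (2 * n)).cauchySeq, ?_⟩
      filter_upwards [eventually_gt_atTop n] with k hk using (hd k n hk).trans hn
    choose u₀ hu₀ using fun j => cauchySeq_tendsto_of_complete (hcau j)
    refine ⟨⟨(A₀, u₀), fun j => ?_⟩, tendsto_subtype_rng.2 ?_⟩
    · exact le_of_tendsto_of_tendsto' (((hc j).tendsto _).comp hA)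
        ((Real.continuous_exp.tendsto _).comp (hu₀ j)) fun k => (y k).2 j
    · exact hA.prodMk_nhds (tendsto_pi_nhds.2 hu₀)

namespace MaxPlusCompacts

variable {r t : ℝ} {A A' : MaxPlusCompacts} {φ : (ℕ → ℝ) → ℝ}

/-- The coordinatewise infimum of `A`. -/
noncomputable def low (A : MaxPlusCompacts) : ℕ → ℝ := fun i => - supOn (fun a => - a i) A.1

theorem low_le {a : ℕ → ℝ} (ha : a ∈ A.1) (i : ℕ) : A.low i ≤ a i := by
  have := le_supOn (φ := fun a => - a i) (by fun_prop) ha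
  simp only [low]; linarith

theorem le_low {i : ℕ} {c : ℝ} (h : ∀ a ∈ A.1, c ≤ a i) : c ≤ A.low i :=
  le_neg_of_le_neg (supOn_le (φ := fun a => - a i) (by fun_prop) fun a ha => neg_le_neg (h a ha))

theorem continuous_low : Continuous low :=
  continuous_pi fun i => ((continuous_supOn (φ := fun a => - a i) (by fun_prop)).comp
    continuous_subtype_val).neg

theorem low_mono (h : (A.1 : Set (ℕ → ℝ)) ⊆ A'.1) (i : ℕ) : A'.low i ≤ A.low i :=
  le_low fun _ ha => low_le (h ha) i

theorem low_le_low_comb (hr : 0 ≤ r) (i : ℕ) : A.low i ≤ (comb r A A').low i := by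
  refine le_low fun c hc => ?_
  obtain ⟨a, ha, a', -, rfl⟩ := (mem_comb hr).1 hc
  exact (low_le ha i).trans (le_mix _ _ _ _)

theorem exists_subseq_tendsto_of_bounded (C : ℕ → MaxPlusCompacts)
    (h1 : ∀ i, IsBoundedUnder (· ≤ ·) atTop fun k => (C k).top i)
    (h2 : ∀ i, IsBoundedUnder (· ≥ ·) atTop fun k => (C k).low i) :
    ∃ A, ∃ σ : ℕ → ℕ, StrictMono σ ∧ Tendsto (C ∘ σ) atTop (𝓝 A) := by
  refine exists_subseq_tendsto C fun i => ?_
  obtain ⟨u, hu⟩ := (h1 i).bddAbove_range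
  obtain ⟨l, hl⟩ := (h2 i).bddBelow_range
  exact ⟨l, u, fun k c hc => ⟨(hl (mem_range_self k)).trans (low_le hc i),
    (le_top hc i).trans (hu (mem_range_self k))⟩⟩

/-- The translate of `A` by `v`. -/
noncomputable def shift (v : ℕ → ℝ) (A : MaxPlusCompacts) : MaxPlusCompacts :=
  ⟨A.1.map (fun a => a + v) (by fun_prop), by
    refine maxPlusConvex_iff.2 fun r hr => ?_
    rintro _ ⟨a, ha, rfl⟩ _ ⟨b, hb, rfl⟩
    refine ⟨_, A.mix_mem hr.1 hr.2 ha hb, eq_of_exp_eq fun i => ?_⟩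
    simp only [Pi.add_apply, Real.exp_add, exp_mix]
    rw [max_mul_of_nonneg _ _ (Real.exp_pos _).le, mul_assoc]⟩

theorem continuous_shift : Continuous fun z : (ℕ → ℝ) × MaxPlusCompacts => shift z.1 z.2 :=
  Continuous.subtype_mk (Continuous.nonemptyCompacts_map'
    (f := fun z : (ℕ → ℝ) × MaxPlusCompacts => z.2.1) (g := fun z a => a + z.1)
    (by fun_prop) (by fun_prop)) _

theorem top_shift (v : ℕ → ℝ) (A : MaxPlusCompacts) : (shift v A).top = A.top + v := by
  refine top_eq_of ⟨_, A.top_mem, rfl⟩ ?_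
  rintro _ ⟨a, ha, rfl⟩ i
  exact add_le_add_left (le_top ha i) (v i)

theorem shift_shift (v w : ℕ → ℝ) (A : MaxPlusCompacts) :
    shift w (shift v A) = shift (v + w) A := by
  refine ext_mem fun c => ⟨?_, ?_⟩
  · rintro ⟨_, ⟨a, ha, rfl⟩, rfl⟩
    exact ⟨a, ha, (add_assoc a v w).symm⟩
  · rintro ⟨a, ha, rfl⟩
    exact ⟨_, ⟨a, ha, rfl⟩, add_assoc a v w⟩

theorem shift_zero (A : MaxPlusCompacts) : shift 0 A = A := by
  refine ext_mem fun c => ⟨?_, fun h => ⟨c, h, add_zero c⟩⟩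
  rintro ⟨a, ha, rfl⟩
  simpa using ha

/-- The translate of `A` with maximum `x`, raised to lie above `x - h`. -/
noncomputable def place (A : MaxPlusCompacts) (x h : ℕ → ℝ) : MaxPlusCompacts :=
  comb 1 (shift (x - A.top) A) (point (x - h))

theorem continuous_place (A : MaxPlusCompacts) :
    Continuous fun z : (ℕ → ℝ) × (ℕ → ℝ) => A.place z.1 z.2 := by
  refine continuous_comb.comp (continuous_const.prodMk (Continuous.prodMk ?_ ?_))
  · exact continuous_shift.comp (f := fun z : (ℕ → ℝ) × (ℕ → ℝ) => (z.1 - A.top, A)) (by fun_prop)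
  · exact continuous_point.comp (by fun_prop)

theorem mix_one_apply (a b : ℕ → ℝ) (i : ℕ) : mix 1 a b i = max (a i) (b i) := by
  simp [mix_of_pos one_pos]

theorem mem_place {x h c : ℕ → ℝ} :
    c ∈ (A.place x h).1 ↔ ∃ a ∈ A.1, (fun i => max (a i + (x i - A.top i)) (x i - h i)) = c := by
  rw [place, mem_comb zero_le_one]
  have key : ∀ a, mix 1 (a + (x - A.top)) (x - h) =
    fun i => max (a i + (x i - A.top i)) (x i - h i) := fun a => funext fun i => mix_one_apply _ _ _
  constructor
  · rintro ⟨_, ⟨a, ha, rfl⟩, b, hb, rfl⟩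
    exact ⟨a, ha, by rw [mem_point.1 hb]; exact (key a).symm⟩
  · rintro ⟨a, ha, rfl⟩
    exact ⟨_, ⟨a, ha, rfl⟩, _, mem_point.2 rfl, key a⟩

theorem top_place {x h : ℕ → ℝ} (hh : ∀ i, 0 ≤ h i) : (A.place x h).top = x := by
  refine top_eq_of (mem_place.2 ⟨_, A.top_mem, funext fun i => ?_⟩) ?_
  · rw [max_eq_left (by linarith [hh i])]; ring
  · intro c hc i
    obtain ⟨a, ha, rfl⟩ := mem_place.1 hc
    exact max_le (by linarith [le_top ha i]) (by linarith [hh i])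

theorem sub_le_low_place {x h : ℕ → ℝ} (i : ℕ) : x i - h i ≤ (A.place x h).low i := by
  refine le_low fun c hc => ?_
  obtain ⟨a, ha, rfl⟩ := mem_place.1 hc
  exact le_max_right _ _

theorem place_top {h : ℕ → ℝ} (hh : ∀ i, A.top i - h i ≤ A.low i) : A.place A.top h = A := by
  have key : ∀ a ∈ A.1, (fun i => max (a i + (A.top i - A.top i)) (A.top i - h i)) = a :=
    fun a ha => funext fun i => by
      rw [sub_self, add_zero, max_eq_left ((hh i).trans (low_le ha i))]
  refine ext_mem fun c => mem_place.trans ⟨?_, fun hc => ⟨c, hc, key c hc⟩⟩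
  rintro ⟨a, ha, rfl⟩
  rwa [key a ha]

end MaxPlusCompacts

namespace MaxPlusCompacts

variable {L : MaxPlusCompacts → ℝ} {φ : ℕ → (ℕ → ℝ) → ℝ} {A A' : MaxPlusCompacts}

theorem continuous_supOn_cut {ψ : (ℕ → ℝ) → ℝ} (hψ : Continuous ψ) :
    Continuous fun z : MaxPlusCompacts × ℝ => supOn ψ (z.1.cut z.2).1 :=
  (continuous_supOn hψ).comp (continuous_subtype_val.comp continuous_cut)

theorem tendsto_cut {α : Type*} {l : Filter α} {C : α → MaxPlusCompacts} {s : α → ℝ}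
    {D : MaxPlusCompacts} {τ : ℝ} (hC : Tendsto C l (𝓝 D)) (hs : Tendsto s l (𝓝 τ)) :
    Tendsto (fun k => (C k).cut (s k)) l (𝓝 (D.cut τ)) :=
  Tendsto.comp (g := fun z : MaxPlusCompacts × ℝ => z.1.cut z.2) (f := fun k => (C k, s k))
    (y := 𝓝 (D, τ)) continuous_cut.continuousAt (hC.prodMk_nhds hs)

theorem tendsto_supOn_cut {ψ : (ℕ → ℝ) → ℝ} (hψ : Continuous ψ) {α : Type*} {l : Filter α}
    {C : α → MaxPlusCompacts} {s : α → ℝ} {D : MaxPlusCompacts} {τ : ℝ}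
    (hC : Tendsto C l (𝓝 D)) (hs : Tendsto s l (𝓝 τ)) :
    Tendsto (fun k => supOn ψ ((C k).cut (s k)).1) l (𝓝 (supOn ψ (D.cut τ).1)) :=
  Tendsto.comp (g := fun A : MaxPlusCompacts => supOn ψ A.1)
    ((continuous_supOn hψ).comp continuous_subtype_val).continuousAt (tendsto_cut hC hs)

/-- Sets with the same approximate data have the same limiting truncation. -/
theorem cut_eq_of_consistent (hφ : ∀ n, Continuous (φ n))
    (hsep : ∀ A A' : MaxPlusCompacts, (∀ n, supOn (φ n) A.1 = supOn (φ n) A'.1) → A = A')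
    {t : ℕ → ℝ} {τ : ℝ} (ht : Tendsto t atTop (𝓝 τ)) {e : ℕ → ℝ}
    (hA : ∀ n, |e (2 * n) - supOn (φ n.unpair.1) (A.cut (t n)).1| ≤ (1 / 2) ^ (2 * n))
    (hA' : ∀ n, |e (2 * n) - supOn (φ n.unpair.1) (A'.cut (t n)).1| ≤ (1 / 2) ^ (2 * n)) :
    A.cut τ = A'.cut τ := by
  refine hsep _ _ fun i => ?_
  obtain ⟨ν, hν, hνi⟩ : ∃ ν : ℕ → ℕ, Tendsto ν atTop atTop ∧ ∀ m, (ν m).unpair.1 = i :=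
    ⟨fun m => Nat.pair i m,
      tendsto_atTop_mono (fun m => Nat.right_le_pair i m) tendsto_id, fun m => by simp⟩
  have hlim : ∀ B : MaxPlusCompacts,
      (∀ n, |e (2 * n) - supOn (φ n.unpair.1) (B.cut (t n)).1| ≤ (1 / 2) ^ (2 * n)) →
      Tendsto (fun m => e (2 * ν m)) atTop (𝓝 (supOn (φ i) (B.cut τ).1)) := by
    intro B hB
    have h1 := tendsto_supOn_cut (hφ i) (tendsto_const_nhds (x := B)) (ht.comp hν)
    have h2 : Tendsto (fun m => e (2 * ν m) - supOn (φ i) (B.cut (t (ν m))).1) atTop (𝓝 0) := by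
      refine squeeze_zero_norm (a := fun m => ((1 : ℝ) / 2) ^ (2 * ν m)) (fun m => ?_) ?_
      · have := hB (ν m)
        rwa [hνi m] at this
      · exact (tendsto_pow_atTop_nhds_zero_of_lt_one (by norm_num) (by norm_num)).comp
          (hν.const_mul_atTop' two_pos)
    simpa using h2.add h1
  exact tendsto_nhds_unique (hlim A hA) (hlim A' hA')

theorem eq_of_consistent (hLc : Continuous L)
    (hLanti : ∀ A B : MaxPlusCompacts, (A.1 : Set (ℕ → ℝ)) ⊆ B.1 → L B ≤ L A)
    (hLstrict : ∀ A B : MaxPlusCompacts, (A.1 : Set (ℕ → ℝ)) ⊆ B.1 → L A = L B → 0 < L A → A = B)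
    (hφ : ∀ n, Continuous (φ n))
    (hsep : ∀ A A' : MaxPlusCompacts, (∀ n, supOn (φ n) A.1 = supOn (φ n) A'.1) → A = A')
    {t : ℕ → ℝ} (htI : ∀ n, t n ∈ Icc (0 : ℝ) 1) (htanti : ∀ n, t (n + 1) ≤ t n)
    {ε : ℝ} (hε : 0 < ε) {x h e : ℕ → ℝ}
    (hprog : ∀ n : ℕ, t (n + 1) < 1 / ((n : ℝ) + 1) ∨ ∃ C : MaxPlusCompacts, (∀ j < n + 1,
      |e (2 * j) - supOn (φ j.unpair.1) (C.cut (t j)).1| - (1 / 2) ^ (2 * j) < 1 / ((n : ℝ) + 1) ∧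
      |C.top j - x j| < 1 / ((n : ℝ) + 1) ∧ C.top j - h j - C.low j < 1 / ((n : ℝ) + 1)) ∧
      L (C.cut (t (n + 1))) - ε < 1 / ((n : ℝ) + 1))
    (hεA : ε ≤ L A) (hεA' : ε ≤ L A')
    (hA : ∀ n, |e (2 * n) - supOn (φ n.unpair.1) (A.cut (t n)).1| ≤ (1 / 2) ^ (2 * n))
    (hA' : ∀ n, |e (2 * n) - supOn (φ n.unpair.1) (A'.cut (t n)).1| ≤ (1 / 2) ^ (2 * n)) :
    A = A' := by
  have hanti : Antitone t := antitone_nat_of_succ_le htanti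
  have hbdd : BddBelow (range t) := ⟨0, by rintro _ ⟨n, rfl⟩; exact (htI n).1⟩
  obtain ⟨τ, hτ⟩ : ∃ τ, Tendsto t atTop (𝓝 τ) := ⟨_, tendsto_atTop_ciInf hanti hbdd⟩
  have hτle : ∀ n, τ ≤ t n := hanti.le_of_tendsto hτ
  have hτ0 : 0 ≤ τ := ge_of_tendsto' hτ fun n => (htI n).1
  have hτ1 : τ ≤ 1 := (hτle 0).trans (htI 0).2
  have hcut := cut_eq_of_consistent hφ hsep hτ hA hA'
  rcases hτ0.eq_or_lt with h0 | h0
  · rwa [← h0, cut_zero, cut_zero] at hcut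
  obtain ⟨n₀, hn₀⟩ := exists_nat_one_div_lt h0
  have hprog' : ∀ k : ℕ, ∃ C : MaxPlusCompacts, (∀ j < k + n₀ + 1,
      |e (2 * j) - supOn (φ j.unpair.1) (C.cut (t j)).1| - (1 / 2) ^ (2 * j) <
        1 / (((k + n₀ : ℕ) : ℝ) + 1) ∧
      |C.top j - x j| < 1 / (((k + n₀ : ℕ) : ℝ) + 1) ∧
      C.top j - h j - C.low j < 1 / (((k + n₀ : ℕ) : ℝ) + 1)) ∧
      L (C.cut (t (k + n₀ + 1))) - ε < 1 / (((k + n₀ : ℕ) : ℝ) + 1) := by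
    intro k
    refine (hprog (k + n₀)).resolve_left (not_lt.2 ?_)
    refine le_trans ?_ (hn₀.le.trans (hτle _))
    exact Nat.one_div_le_one_div (by omega)
  choose C hC hCL using hprog'
  have hone : ∀ k : ℕ, (1 : ℝ) / (((k + n₀ : ℕ) : ℝ) + 1) ≤ 1 := fun k =>
    div_le_one_of_le₀ (le_add_of_nonneg_left (by positivity)) (by positivity)
  have hCx : ∀ i, ∀ᶠ k in atTop, |(C k).top i - x i| < 1 ∧ (C k).top i - h i - (C k).low i < 1 :=
    fun i => by
      filter_upwards [eventually_ge_atTop i] with k hk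
      have := hC k i (by omega)
      exact ⟨this.2.1.trans_le (hone k), this.2.2.trans_le (hone k)⟩
  obtain ⟨D, σ, hσ, hD⟩ := exists_subseq_tendsto_of_bounded C
    (fun i => ⟨x i + 1, eventually_map.2 ((hCx i).mono fun k hk => by
      linarith [(abs_lt.1 hk.1).2])⟩)
    (fun i => ⟨x i - h i - 2, eventually_map.2 ((hCx i).mono fun k hk => by
      change _ ≤ _
      linarith [(abs_lt.1 hk.1).1])⟩)
  have hzero : Tendsto (fun k => (1 : ℝ) / (((σ k + n₀ : ℕ) : ℝ) + 1)) atTop (𝓝 0) :=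
    tendsto_one_div_add_atTop_nhds_zero_nat.comp
      ((tendsto_add_atTop_nat n₀).comp hσ.tendsto_atTop)
  have hDd : ∀ n, |e (2 * n) - supOn (φ n.unpair.1) (D.cut (t n)).1| ≤ (1 / 2) ^ (2 * n) := by
    intro n
    have h1 : Tendsto (fun k => |e (2 * n) - supOn (φ n.unpair.1) ((C (σ k)).cut (t n)).1| -
        (1 / 2) ^ (2 * n)) atTop
        (𝓝 (|e (2 * n) - supOn (φ n.unpair.1) (D.cut (t n)).1| - (1 / 2) ^ (2 * n))) := by
      refine Tendsto.sub_const (Tendsto.abs (tendsto_const_nhds.sub ?_)) _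
      exact tendsto_supOn_cut (hφ _) hD tendsto_const_nhds
    refine sub_nonpos.1 (le_of_tendsto_of_tendsto h1 hzero ?_)
    filter_upwards [hσ.tendsto_atTop.eventually_ge_atTop n] with k hk
    exact (hC (σ k) n (by omega)).1.le
  have hDL : L (D.cut τ) ≤ ε := by
    have h1 : Tendsto (fun k => L ((C (σ k)).cut (t (σ k + n₀ + 1))) - ε) atTop
        (𝓝 (L (D.cut τ) - ε)) := by
      refine Tendsto.sub_const ((hLc.tendsto _).comp (tendsto_cut hD (hτ.comp ?_))) _
      exact (tendsto_add_atTop_nat (n₀ + 1)).comp hσ.tendsto_atTop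
    exact sub_nonpos.1 (le_of_tendsto_of_tendsto' h1 hzero fun k => (hCL _).le)
  have hfix : ∀ B : MaxPlusCompacts, ε ≤ L B →
      (∀ n, |e (2 * n) - supOn (φ n.unpair.1) (B.cut (t n)).1| ≤ (1 / 2) ^ (2 * n)) →
      B.cut τ = B := by
    intro B hB hd
    have h1 : L B ≤ L (B.cut τ) := hLanti _ _ (cut_subset hτ0 hτ1)
    have h2 : L (B.cut τ) ≤ ε := by
      rw [cut_eq_of_consistent hφ hsep hτ hd hDd]; exact hDL
    exact hLstrict _ _ (cut_subset hτ0 hτ1) (le_antisymm (h2.trans hB) h1)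
      (hε.trans_le (hB.trans h1))
  rw [← hfix A hεA hA, hcut, hfix A' hεA' hA']

/-- A set of level at least `ε` is a limit of truncations of level greater than `ε`. -/
theorem exists_cut_level (hLc : Continuous L)
    (hLanti : ∀ A B : MaxPlusCompacts, (A.1 : Set (ℕ → ℝ)) ⊆ B.1 → L B ≤ L A)
    (hLstrict : ∀ A B : MaxPlusCompacts, (A.1 : Set (ℕ → ℝ)) ⊆ B.1 → L A = L B → 0 < L A → A = B)
    {ε : ℝ} (hε : 0 < ε) (hA : ε ≤ L A) (h1 : ε < L (point A.top)) {W : Set MaxPlusCompacts}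
    (hW : W ∈ 𝓝 A) : ∃ t ∈ Icc (0 : ℝ) 1, A.cut t ∈ W ∧ ε < L (A.cut t) := by
  let S : Set ℝ := {t | t ∈ Icc (0 : ℝ) 1 ∧ ε < L (A.cut t)}
  have hcut : Continuous fun t => A.cut t :=
    continuous_cut.comp (f := fun t : ℝ => (A, t)) (by fun_prop)
  have h1S : (1 : ℝ) ∈ S := ⟨⟨zero_le_one, le_rfl⟩, by rwa [cut_one]⟩
  have hSb : BddBelow S := ⟨0, fun t ht => ht.1.1⟩
  set τ := sInf S
  have hτ0 : 0 ≤ τ := le_csInf ⟨1, h1S⟩ fun t ht => ht.1.1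
  have hτ1 : τ ≤ 1 := csInf_le hSb h1S
  by_cases hτ : ε < L (A.cut τ)
  · rcases hτ0.eq_or_lt with h | h
    · exact ⟨τ, ⟨hτ0, hτ1⟩, by rw [← h, cut_zero]; exact mem_of_mem_nhds hW, hτ⟩
    · have hev : ∀ᶠ s in 𝓝[<] τ, ε < L (A.cut s) ∧ 0 < s :=
        ((continuousAt_const.eventually_lt (hLc.comp hcut).continuousAt hτ).and
          (eventually_gt_nhds h)).filter_mono nhdsWithin_le_nhds
      obtain ⟨s, ⟨hs, hs0⟩, hsτ⟩ := (hev.and self_mem_nhdsWithin).exists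
      have hsτ : s < τ := hsτ
      exact absurd (csInf_le hSb (show s ∈ S from ⟨⟨hs0.le, hsτ.le.trans hτ1⟩, hs⟩)) hsτ.not_ge
  · have h2 : L A ≤ L (A.cut τ) := hLanti _ _ (cut_subset hτ0 hτ1)
    have hfix : A.cut τ = A := hLstrict _ _ (cut_subset hτ0 hτ1)
      (le_antisymm ((not_lt.1 hτ).trans hA) h2) (hε.trans_le (hA.trans h2))
    have hev : ∀ᶠ s in 𝓝 τ, A.cut s ∈ W := hcut.continuousAt.eventually_mem (hfix.symm ▸ hW)
    obtain ⟨s, hs, hsW⟩ := (mem_closure_iff_frequently.1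
      (csInf_mem_closure ⟨1, h1S⟩ hSb)).and_eventually hev |>.exists
    exact ⟨s, hs.1, hsW, hs.2⟩

end MaxPlusCompacts

namespace MaxPlusCompacts

variable {X : Set (ℕ → ℝ)} {L : MaxPlusCompacts → ℝ} {φ : ℕ → (ℕ → ℝ) → ℝ}

/-- A positive lower bound for the level of a set with maximum `x`, controlled by `u 0`. -/
noncomputable def slack (L : MaxPlusCompacts → ℝ) (x u : ℕ → ℝ) : ℝ :=
  L (point x) / (1 + Real.exp (u 0))

theorem continuous_slack (hLc : Continuous L) :
    Continuous fun z : (ℕ → ℝ) × (ℕ → ℝ) => slack L z.1 z.2 := by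
  refine Continuous.div (hLc.comp (continuous_point.comp continuous_fst)) (by fun_prop) fun z => ?_
  positivity

theorem slack_pos {x : ℕ → ℝ} (hx : 0 < L (point x)) (u : ℕ → ℝ) : 0 < slack L x u :=
  div_pos hx (by positivity)

theorem slack_lt {x : ℕ → ℝ} (hx : 0 < L (point x)) (u : ℕ → ℝ) : slack L x u < L (point x) :=
  div_lt_self hx (by linarith [Real.exp_pos (u 0)])

theorem exists_slack_threshold (hLc : Continuous L)
    (hLanti : ∀ A B : MaxPlusCompacts, (A.1 : Set (ℕ → ℝ)) ⊆ B.1 → L B ≤ L A)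
    (hLX : ∀ x ∈ X, 0 < L (point x)) (hφ : ∀ n, Continuous (φ n)) :
    ∃ t : ℕ → (X × (ℕ → ℝ)) × (ℕ → ℝ) → ℝ, (∀ n, Continuous (t n)) ∧
      (∀ n b, t n b ∈ Icc (0 : ℝ) 1) ∧ (∀ n b, t (n + 1) b ≤ t n b) ∧
      (∀ n p e e', (∀ i < 2 * n, e i = e' i) → t n (p, e) = t n (p, e')) ∧
      (∀ n b (C : MaxPlusCompacts), C.top = b.1.1 →
        (∀ i, C.top i - C.low i ≤ Real.exp (b.1.2 (i + 1))) →
        (∀ j < n, |b.2 (2 * j) - supOn (φ j.unpair.1) (C.cut (t j b)).1| ≤ (1 / 2) ^ (2 * j)) →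
        slack L b.1.1 b.1.2 < L (C.cut (t n b))) ∧
      ∀ n b, t (n + 1) b < 1 / ((n : ℝ) + 1) ∨ ∃ C : MaxPlusCompacts, (∀ j < n + 1,
        |b.2 (2 * j) - supOn (φ j.unpair.1) (C.cut (t j b)).1| - (1 / 2) ^ (2 * j) <
          1 / ((n : ℝ) + 1) ∧
        |C.top j - b.1.1.1 j| < 1 / ((n : ℝ) + 1) ∧
        C.top j - Real.exp (b.1.2 (j + 1)) - C.low j < 1 / ((n : ℝ) + 1)) ∧
        L (C.cut (t (n + 1) b)) - slack L b.1.1 b.1.2 < 1 / ((n : ℝ) + 1) := by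
  have htop : ∀ i, Continuous fun z : (X × (ℕ → ℝ)) × MaxPlusCompacts => z.2.top i := fun i =>
    (continuous_apply i).comp (continuous_top.comp continuous_snd)
  have hlow : ∀ i, Continuous fun z : (X × (ℕ → ℝ)) × MaxPlusCompacts => z.2.low i := fun i =>
    (continuous_apply i).comp (continuous_low.comp continuous_snd)
  have hcx : ∀ i, Continuous fun b : X × (ℕ → ℝ) => b.1.1 i := fun i =>
    (continuous_apply i).comp (continuous_subtype_val.comp continuous_fst)
  have hB : IsClosed {z : (X × (ℕ → ℝ)) × MaxPlusCompacts | z.2.top = z.1.1 ∧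
      ∀ i, z.2.top i - z.2.low i ≤ Real.exp (z.1.2 (i + 1))} := by
    simp only [ofPred_and, ofPred_forall]
    refine IsClosed.inter (isClosed_eq (continuous_top.comp continuous_snd) (by fun_prop)) ?_
    exact isClosed_iInter fun i => isClosed_le ((htop i).sub (hlow i)) (by fun_prop)
  have key := exists_threshold_seq
    (κ := fun n z => max (|z.1.2 (2 * n) - supOn (φ n.unpair.1) (z.2.1.cut z.2.2).1| -
      (1 / 2) ^ (2 * n)) (max |z.2.1.top n - z.1.1.1.1 n|
        (z.2.1.top n - Real.exp (z.1.1.2 (n + 1)) - z.2.1.low n)))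
    (R := fun z => L (z.2.1.cut z.2.2) - slack L z.1.1 z.1.2) hB ?_ ?_ ?_ ?_ ?_ ?_
  · obtain ⟨t, h1, h2, h3, h4, h5, h6⟩ := key
    refine ⟨t, h1, h2, h3, h4, fun n b C hC hC' hd => ?_, fun n b => ?_⟩
    · refine sub_pos.1 (h5 n b C ⟨hC, hC'⟩ fun j hj => ?_)
      refine max_le (sub_nonpos.2 (hd j hj)) (max_le ?_ ?_)
      · rw [hC]; simp
      · linarith [hC' j]
    · refine (h6 n b).imp_right fun ⟨C, hC, hL⟩ => ⟨C, fun j hj => ?_, hL⟩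
      exact ⟨(max_lt_iff.1 (hC j hj)).1, max_lt_iff.1 (max_lt_iff.1 (hC j hj)).2⟩
  · intro b C b₀ hb hC
    have hx : ∀ i, Tendsto (fun k => (C k).top i) atTop (𝓝 (b₀.1.1 i)) := fun i => by
      simp_rw [(hC _).1]
      exact ((hcx i).tendsto b₀).comp hb
    have hu : ∀ i, Tendsto (fun k => Real.exp ((b k).2 (i + 1))) atTop
        (𝓝 (Real.exp (b₀.2 (i + 1)))) := fun i =>
      (Continuous.tendsto (f := fun b : X × (ℕ → ℝ) => Real.exp (b.2 (i + 1)))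
        (by fun_prop) b₀).comp hb
    refine exists_subseq_tendsto_of_bounded C (fun i => (hx i).isBoundedUnder_le) fun i => ?_
    refine ((hx i).sub (hu i)).isBoundedUnder_ge.mono_ge (Eventually.of_forall fun k => ?_)
    have := (hC k).2 i
    change (C k).top i - Real.exp ((b k).2 (i + 1)) ≤ (C k).low i
    linarith
  · intro n
    have hM : Continuous fun z : ((X × (ℕ → ℝ)) × (ℕ → ℝ)) × MaxPlusCompacts × ℝ => z.2.1 := by
      fun_prop
    have ht := (continuous_apply n).comp (continuous_top.comp hM)
    have hl := (continuous_apply n).comp (continuous_low.comp hM)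
    refine ((Continuous.sub (by fun_prop) ((continuous_supOn_cut (hφ _)).comp
      continuous_snd)).abs.sub continuous_const).max
      ((Continuous.sub ht ((hcx n).comp (by fun_prop))).abs.max
        (Continuous.sub (ht.sub (by fun_prop)) hl))
  · intro n p e e' C s h
    simp only [h (2 * n) (by omega)]
  · exact (hLc.comp (continuous_cut.comp continuous_snd)).sub
      ((continuous_slack hLc).comp
        (f := fun z : (X × (ℕ → ℝ)) × MaxPlusCompacts × ℝ => (z.1.1.1, z.1.2)) (by fun_prop))
  · intro b C s t hs hst ht
    exact sub_le_sub_right (hLanti _ _ (cut_anti hs hst ht)) _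
  · intro b C hC
    simp only [cut_one, hC.1]
    exact sub_pos.2 (slack_lt (hLX _ b.1.2) _)

end MaxPlusCompacts

namespace MaxPlusCompacts

variable {X : Set (ℕ → ℝ)} {L : MaxPlusCompacts → ℝ} {φ : ℕ → (ℕ → ℝ) → ℝ}
  {A A' : MaxPlusCompacts}

theorem supOn_cut_comb_mem_uIcc {ψ : (ℕ → ℝ) → ℝ} (hψ : Continuous ψ) {r t : ℝ}
    (hr : r ∈ Icc (0 : ℝ) 1) (h : ∀ a b, ψ (mix r a b) ∈ uIcc (ψ a) (ψ b)) (ht : 0 ≤ t)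
    (htop : A.top = A'.top) :
    supOn ψ ((comb r A A').cut t).1 ∈ uIcc (supOn ψ (A.cut t).1) (supOn ψ (A'.cut t).1) := by
  rw [cut_comb hr.1 hr.2 ht htop]
  exact supOn_comb_mem_uIcc hψ hr.1 h

/-- Half of the path joining two sets with a common top. -/
theorem exists_half_path (hLanti : ∀ A B : MaxPlusCompacts, (A.1 : Set (ℕ → ℝ)) ⊆ B.1 → L B ≤ L A)
    (hφ : ∀ n, Continuous (φ n))
    (hmix : ∀ n, ∀ r ∈ Icc (0 : ℝ) 1, ∀ a b, φ n (mix r a b) ∈ uIcc (φ n a) (φ n b))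
    {s : ℕ → ℝ} (hs : ∀ n, s n ∈ Icc (0 : ℝ) 1) (hanti : Antitone s) (htop : A.top = A'.top)
    {N : ℕ} {ε : ℝ} (hA : ε ≤ L A) (hsafe : ∀ r ∈ Icc (0 : ℝ) 1, ε ≤ L ((comb r A A').cut (s N))) :
    ∃ Z : Set MaxPlusCompacts, IsPreconnected Z ∧ A ∈ Z ∧ (comb 1 A A').cut (s N) ∈ Z ∧
      ∀ C ∈ Z, ε ≤ L C ∧ C.top = A.top ∧ (∀ i, A.low i ≤ C.low i) ∧
        ∀ n ≤ N, supOn (φ n.unpair.1) (C.cut (s n)).1 ∈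
          uIcc (supOn (φ n.unpair.1) (A.cut (s n)).1) (supOn (φ n.unpair.1) (A'.cut (s n)).1) := by
  have hc1 : Continuous fun t : ℝ => A.cut t :=
    continuous_cut.comp (f := fun t : ℝ => (A, t)) (by fun_prop)
  have hc2 : Continuous fun r : ℝ => (comb r A A').cut (s N) :=
    continuous_cut.comp (f := fun r : ℝ => (comb r A A', s N))
      ((continuous_comb.comp (f := fun r : ℝ => (r, A, A')) (by fun_prop)).prodMk
        continuous_const)
  have h0 := (hs N).1
  refine ⟨(fun t => A.cut t) '' Icc 0 (s N) ∪ (fun r => (comb r A A').cut (s N)) '' Icc 0 1,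
    IsPreconnected.union (A.cut (s N)) ⟨s N, ⟨h0, le_rfl⟩, rfl⟩
      ⟨0, ⟨le_rfl, zero_le_one⟩, by simp only [comb_zero]⟩
      (isPreconnected_Icc.image _ hc1.continuousOn) (isPreconnected_Icc.image _ hc2.continuousOn),
    Or.inl ⟨0, ⟨le_rfl, h0⟩, cut_zero A⟩, Or.inr ⟨1, ⟨zero_le_one, le_rfl⟩, rfl⟩, ?_⟩
  rintro C (⟨t, ht, rfl⟩ | ⟨r, hr, rfl⟩)
  · have ht1 := ht.2.trans (hs N).2
    have hsub : ((A.cut t).1 : Set (ℕ → ℝ)) ⊆ A.1 := cut_subset ht.1 ht1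
    refine ⟨hA.trans (hLanti _ _ hsub), top_cut ht.1 ht1, low_mono hsub, fun n hn => ?_⟩
    simp only [cut_cut ht.1 ht1 (hs n).1, max_eq_right (ht.2.trans (hanti hn)), left_mem_uIcc]
  · refine ⟨hsafe r hr, (top_cut h0 (hs N).2).trans (top_comb hr.1 hr.2 htop), fun i =>
      (low_le_low_comb hr.1 i).trans (low_mono (cut_subset h0 (hs N).2) i), fun n hn => ?_⟩
    simp only [cut_cut h0 (hs N).2 (hs n).1, max_eq_right (hanti hn)]
    exact supOn_cut_comb_mem_uIcc (hφ _) hr (hmix _ r hr) (hs n).1 htop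

/-- A path joining two sets with a common top, along which the data interpolate. -/
theorem exists_path (hLanti : ∀ A B : MaxPlusCompacts, (A.1 : Set (ℕ → ℝ)) ⊆ B.1 → L B ≤ L A)
    (hφ : ∀ n, Continuous (φ n))
    (hmix : ∀ n, ∀ r ∈ Icc (0 : ℝ) 1, ∀ a b, φ n (mix r a b) ∈ uIcc (φ n a) (φ n b))
    {s : ℕ → ℝ} (hs : ∀ n, s n ∈ Icc (0 : ℝ) 1) (hanti : Antitone s) (htop : A.top = A'.top)
    {N : ℕ} {ε : ℝ} {h e : ℕ → ℝ} (hA : ε ≤ L A) (hA' : ε ≤ L A')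
    (hAh : ∀ i, A.top i - A.low i ≤ h i) (hAh' : ∀ i, A'.top i - A'.low i ≤ h i)
    (hd : ∀ n < N, |e (2 * n) - supOn (φ n.unpair.1) (A.cut (s n)).1| < (1 / 2) ^ (2 * n))
    (hd' : ∀ n < N, |e (2 * n) - supOn (φ n.unpair.1) (A'.cut (s n)).1| < (1 / 2) ^ (2 * n))
    (hsafe : ∀ C : MaxPlusCompacts, C.top = A.top → (∀ i, C.top i - C.low i ≤ h i) →
      (∀ n < N, |e (2 * n) - supOn (φ n.unpair.1) (C.cut (s n)).1| ≤ (1 / 2) ^ (2 * n)) →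
      ε < L (C.cut (s N))) :
    ∃ Z : Set MaxPlusCompacts, IsPreconnected Z ∧ A ∈ Z ∧ A' ∈ Z ∧
      ∀ C ∈ Z, ε ≤ L C ∧ C.top = A.top ∧ (∀ i, C.top i - C.low i ≤ h i) ∧
        ∀ n ≤ N, supOn (φ n.unpair.1) (C.cut (s n)).1 ∈
          uIcc (supOn (φ n.unpair.1) (A.cut (s n)).1) (supOn (φ n.unpair.1) (A'.cut (s n)).1) := by
  have hbetween : ∀ {a b v w δ : ℝ}, |w - a| < δ → |w - b| < δ → v ∈ uIcc a b → |w - v| ≤ δ := by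
    intro a b v w δ ha hb hv
    rw [abs_lt] at ha hb
    have h1 := (le_min (by linarith) (by linarith) : w - δ ≤ min a b).trans hv.1
    have h2 := hv.2.trans (max_le (by linarith) (by linarith) : max a b ≤ w + δ)
    rw [abs_le]
    constructor <;> linarith
  have hs1 : ∀ r ∈ Icc (0 : ℝ) 1, ε ≤ L ((comb r A A').cut (s N)) := fun r hr => by
    have ht := top_comb hr.1 hr.2 htop
    refine (hsafe _ ht (fun i => ?_) fun n hn => ?_).le
    · rw [ht]
      exact (sub_le_sub_left (low_le_low_comb hr.1 i) _).trans (hAh i)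
    · exact hbetween (hd n hn) (hd' n hn)
        (supOn_cut_comb_mem_uIcc (hφ _) hr (hmix _ r hr) (hs n).1 htop)
  have hs2 : ∀ r ∈ Icc (0 : ℝ) 1, ε ≤ L ((comb r A' A).cut (s N)) := fun r hr => by
    have ht := top_comb hr.1 hr.2 htop.symm
    refine (hsafe _ (ht.trans htop.symm) (fun i => ?_) fun n hn => ?_).le
    · rw [ht]
      exact (sub_le_sub_left (low_le_low_comb hr.1 i) _).trans (hAh' i)
    · exact hbetween (hd' n hn) (hd n hn)
        (supOn_cut_comb_mem_uIcc (hφ _) hr (hmix _ r hr) (hs n).1 htop.symm)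
  obtain ⟨Z, hZ, hZA, hZc, hZP⟩ := exists_half_path hLanti hφ hmix hs hanti htop hA hs1
  obtain ⟨Z', hZ', hZA', hZc', hZP'⟩ := exists_half_path hLanti hφ hmix hs hanti htop.symm hA' hs2
  rw [comb_comm] at hZc'
  refine ⟨Z ∪ Z', hZ.union _ hZc hZc' hZ', Or.inl hZA, Or.inr hZA', ?_⟩
  rintro C (hC | hC)
  · obtain ⟨h1, h2, h3, h4⟩ := hZP C hC
    exact ⟨h1, h2, fun i => by rw [h2]; exact (sub_le_sub_left (h3 i) _).trans (hAh i), h4⟩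
  · obtain ⟨h1, h2, h3, h4⟩ := hZP' C hC
    refine ⟨h1, h2.trans htop.symm, fun i => ?_, fun n hn => ?_⟩
    · rw [h2]; exact (sub_le_sub_left (h3 i) _).trans (hAh' i)
    · rw [uIcc_comm]; exact h4 n hn

end MaxPlusCompacts

namespace MaxPlusCompacts

variable {X : Set (ℕ → ℝ)} {L : MaxPlusCompacts → ℝ} {φ : ℕ → (ℕ → ℝ) → ℝ}
  {A A' : MaxPlusCompacts}

/-- Sets of positive level, with parameters bounding their level and their extent. -/
abbrev Padded (L : MaxPlusCompacts → ℝ) :=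
  {z : MaxPlusCompacts × (ℕ → ℝ) // 0 < L z.1 ∧ slack L z.1.top z.2 ≤ L z.1 ∧
    ∀ i, z.1.top i - z.1.low i ≤ Real.exp (z.2 (i + 1))}

/-- The top of a padded set, with the same parameters. -/
noncomputable def Padded.proj (hLX : ∀ A, 0 < L A ↔ (A.1 : Set (ℕ → ℝ)) ⊆ X) (y : Padded L) :
    X × (ℕ → ℝ) :=
  (⟨y.1.1.top, (hLX _).1 y.2.1 y.1.1.top_mem⟩, y.1.2)

theorem continuous_proj (hLX : ∀ A, 0 < L A ↔ (A.1 : Set (ℕ → ℝ)) ⊆ X) :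
    Continuous (Padded.proj hLX) :=
  ((continuous_top.comp (continuous_fst.comp continuous_subtype_val)).subtype_mk _).prodMk
    (continuous_snd.comp continuous_subtype_val)

theorem level_point_pos (hLX : ∀ A, 0 < L A ↔ (A.1 : Set (ℕ → ℝ)) ⊆ X) {x : ℕ → ℝ} (hx : x ∈ X) :
    0 < L (point x) :=
  (hLX _).2 fun a ha => by rwa [mem_point.1 ha]

theorem surjective_proj (hLX : ∀ A, 0 < L A ↔ (A.1 : Set (ℕ → ℝ)) ⊆ X) :
    Surjective (Padded.proj hLX) := by
  rintro ⟨⟨x, hx⟩, u⟩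
  have hpos := level_point_pos hLX hx
  refine ⟨⟨(point x, u), hpos, ?_, fun i => ?_⟩, ?_⟩
  · simp only [top_point]
    exact (slack_lt hpos u).le
  · simp only [top_point]
    have : x i ≤ (point x).low i := le_low fun a ha => by rw [mem_point.1 ha]
    linarith [Real.exp_pos (u (i + 1))]
  · simp only [Padded.proj, top_point]

theorem isOpenMap_proj (hLX : ∀ A, 0 < L A ↔ (A.1 : Set (ℕ → ℝ)) ⊆ X) (hLc : Continuous L)
    (hLanti : ∀ A B : MaxPlusCompacts, (A.1 : Set (ℕ → ℝ)) ⊆ B.1 → L B ≤ L A)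
    (hLstrict : ∀ A B : MaxPlusCompacts, (A.1 : Set (ℕ → ℝ)) ⊆ B.1 → L A = L B → 0 < L A → A = B) :
    IsOpenMap (Padded.proj hLX) := by
  refine isOpenMap_iff_nhds_le.2 fun y s hs => ?_
  obtain ⟨W₀, hW₀, hWs⟩ := mem_nhds_induced _ _ _ |>.1 (mem_map.1 hs)
  obtain ⟨W, hWW₀, hWo, hWy⟩ := mem_nhds_iff.1 hW₀
  obtain ⟨⟨A, u⟩, hA0, hAL, hAh⟩ := y
  have hpos : 0 < L (point A.top) := level_point_pos hLX ((hLX _).1 hA0 A.top_mem)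
  have hWA : {B | (B, u) ∈ W} ∈ 𝓝 A :=
    (Continuous.continuousAt (f := fun B : MaxPlusCompacts => (B, u)) (by
      fun_prop)).preimage_mem_nhds
      (hWo.mem_nhds hWy)
  obtain ⟨τ, hτ, hτW, hτL⟩ := exists_cut_level hLc hLanti hLstrict (slack_pos hpos u) hAL
    (slack_lt hpos u) hWA
  let S : X × (ℕ → ℝ) → MaxPlusCompacts × (ℕ → ℝ) := fun p =>
    ((A.cut τ).place p.1 fun i => Real.exp (p.2 (i + 1)), p.2)
  have hS : Continuous S := ((continuous_place _).comp
    (f := fun p : X × (ℕ → ℝ) => (p.1.1, fun i => Real.exp (p.2 (i + 1)))) (by fun_prop)).prodMk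
    continuous_snd
  have hplace : (A.cut τ).place A.top (fun i => Real.exp (u (i + 1))) = A.cut τ := by
    have ht := top_cut (A := A) hτ.1 hτ.2
    have := place_top (A := A.cut τ) (h := fun i => Real.exp (u (i + 1))) fun i => by
      have h1 := hAh i
      have h2 := low_mono (cut_subset (A := A) hτ.1 hτ.2) i
      rw [ht]
      linarith
    rwa [ht] at this
  have h1 : ∀ᶠ p in 𝓝 (Padded.proj hLX ⟨(A, u), hA0, hAL, hAh⟩), S p ∈ W :=
    hS.continuousAt.eventually_mem (by
      change W ∈ 𝓝 ((A.cut τ).place A.top (fun i => Real.exp (u (i + 1))), u)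
      rw [hplace]
      exact hWo.mem_nhds hτW)
  have h2 : ∀ᶠ p in 𝓝 (Padded.proj hLX ⟨(A, u), hA0, hAL, hAh⟩), slack L p.1 p.2 < L (S p).1 := by
    refine ContinuousAt.eventually_lt (((continuous_slack hLc).comp
      (f := fun p : X × (ℕ → ℝ) => (p.1.1, p.2)) (by fun_prop)).continuousAt)
      ((hLc.comp (continuous_fst.comp hS)).continuousAt) ?_
    change slack L A.top u < L ((A.cut τ).place A.top (fun i => Real.exp (u (i + 1))))
    rw [hplace]
    exact hτL
  filter_upwards [h1, h2] with p hp1 hp2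
  have htop : (S p).1.top = p.1 := top_place fun i => (Real.exp_pos _).le
  have hy : 0 < L (S p).1 ∧ slack L (S p).1.top (S p).2 ≤ L (S p).1 ∧
      ∀ i, (S p).1.top i - (S p).1.low i ≤ Real.exp ((S p).2 (i + 1)) := by
    rw [htop]
    refine ⟨(slack_pos (level_point_pos hLX p.1.2) _).trans hp2, hp2.le, fun i => ?_⟩
    have := sub_le_low_place (A := A.cut τ) (x := p.1) (h := fun i => Real.exp (p.2 (i + 1))) i
    exact sub_le_comm.1 this
  have : Padded.proj hLX ⟨S p, hy⟩ ∈ s := hWs (hWW₀ hp1)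
  rwa [show Padded.proj hLX ⟨S p, hy⟩ = p from Prod.ext (Subtype.ext htop) rfl] at this

theorem nonempty_homeomorph_padded (hLX : ∀ A, 0 < L A ↔ (A.1 : Set (ℕ → ℝ)) ⊆ X)
    (hLc : Continuous L)
    (hLanti : ∀ A B : MaxPlusCompacts, (A.1 : Set (ℕ → ℝ)) ⊆ B.1 → L B ≤ L A)
    (hLstrict : ∀ A B : MaxPlusCompacts, (A.1 : Set (ℕ → ℝ)) ⊆ B.1 → L A = L B → 0 < L A → A = B)
    [TopologicalSpace.MetrizableSpace (Padded L)] :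
    Nonempty (Padded L × (ℕ → ℝ) ≃ₜ (X × (ℕ → ℝ)) × (ℕ → ℝ)) := by
  have : TopologicalSpace.MetrizableSpace X := IsEmbedding.subtypeVal.metrizableSpace
  obtain ⟨φ, hφ, hmix, hsep⟩ := exists_separating
  obtain ⟨t, htc, htI, htanti, htdep, htsafe, htprog⟩ := exists_slack_threshold (X := X) hLc hLanti
    (fun x hx => level_point_pos hLX hx) hφ
  have hanti : ∀ b, Antitone fun n => t n b := fun b => antitone_nat_of_succ_le fun n => htanti n b
  have hfc : ∀ n, Continuous fun z : Padded L × (ℕ → ℝ) =>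
      supOn (φ n.unpair.1) (z.1.1.1.cut (t n (z.1.proj hLX, z.2))).1 := fun n =>
    (continuous_supOn_cut (hφ _)).comp
      (f := fun z : Padded L × (ℕ → ℝ) => (z.1.1.1, t n (z.1.proj hLX, z.2)))
      ((continuous_fst.comp (continuous_subtype_val.comp continuous_fst)).prodMk
        ((htc n).comp (((continuous_proj hLX).comp continuous_fst).prodMk continuous_snd)))
  refine nonempty_homeomorph_of_fat
    (f := fun n z => supOn (φ n.unpair.1) (z.1.1.1.cut (t n (z.1.proj hLX, z.2))).1)
    (continuous_proj hLX) (isOpenMap_proj hLX hLc hLanti hLstrict) (surjective_proj hLX) hfc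
    ?_ ?_ ?_
  · intro n y e e' h
    simp only [htdep n (y.proj hLX) e e' h]
  · intro N y y' e hyy' hd hd'
    have htop : y.1.1.top = y'.1.1.top := congrArg (fun p => p.1.1) hyy'
    have hu : y.1.2 = y'.1.2 := congrArg (fun p => p.2) hyy'
    simp only [← hyy'] at hd' ⊢
    obtain ⟨Z, hZ, hyZ, hy'Z, hZP⟩ := exists_path (ε := slack L y.1.1.top y.1.2)
      (h := fun i => Real.exp (y.1.2 (i + 1))) hLanti hφ hmix (fun n => htI n (y.proj hLX, e))
      (hanti _) htop y.2.2.1 (by rw [htop, hu]; exact y'.2.2.1) y.2.2.2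
      (by rw [hu]; exact y'.2.2.2) hd hd' (fun C => htsafe N (y.proj hLX, e) C)
    have hpos := slack_pos (level_point_pos hLX ((hLX _).1 y.2.1 y.1.1.top_mem)) y.1.2
    refine ⟨Subtype.val ⁻¹' (Z ×ˢ {y.1.2}), isPreconnected_of_image_inducing IsInducing.subtypeVal
      (hZ.prod isPreconnected_singleton) ?_, ⟨hyZ, rfl⟩, ⟨hy'Z, hu.symm⟩, ?_⟩
    · rintro ⟨C, u⟩ ⟨hC, rfl : u = y.1.2⟩
      obtain ⟨h1, h2, h3, -⟩ := hZP C hC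
      exact ⟨⟨(C, y.1.2), hpos.trans_le h1, by rw [h2]; exact h1, h3⟩, rfl⟩
    · rintro z ⟨hzZ, hzu⟩
      obtain ⟨-, h2, -, h4⟩ := hZP _ hzZ
      have hp : z.proj hLX = y.proj hLX := Prod.ext (Subtype.ext h2) hzu
      rw [hp]
      exact ⟨rfl, h4⟩
  · intro y e p₀ e₀ hp he hd
    have hpx : ∀ i, Tendsto (fun k => (y k).1.1.top i) atTop (𝓝 (p₀.1.1 i)) := fun i =>
      (((continuous_apply i).comp (continuous_subtype_val.comp continuous_fst)).tendsto p₀).comp hp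
    have hpu : Tendsto (fun k => (y k).1.2) atTop (𝓝 p₀.2) := (continuous_snd.tendsto p₀).comp hp
    have hpe : ∀ i, Tendsto (fun k => Real.exp ((y k).1.2 (i + 1))) atTop
        (𝓝 (Real.exp (p₀.2 (i + 1)))) := fun i =>
      (Real.continuous_exp.tendsto _).comp (tendsto_pi_nhds.1 hpu (i + 1))
    have hpos := slack_pos (level_point_pos hLX p₀.1.2) p₀.2
    have hslack : Tendsto (fun k => slack L (y k).1.1.top (y k).1.2) atTop
        (𝓝 (slack L p₀.1 p₀.2)) :=
      (((continuous_slack hLc).comp (f := fun p : X × (ℕ → ℝ) => (p.1.1, p.2))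
        (by fun_prop)).tendsto p₀).comp hp
    have hlim : ∀ {ns : ℕ → ℕ} {A : MaxPlusCompacts}, Tendsto ns atTop atTop →
        Tendsto (fun k => (y (ns k)).1.1) atTop (𝓝 A) →
        A.top = p₀.1 ∧ slack L p₀.1 p₀.2 ≤ L A ∧
          (∀ i, A.top i - A.low i ≤ Real.exp (p₀.2 (i + 1))) ∧
          ∀ n, |e₀ (2 * n) - supOn (φ n.unpair.1) (A.cut (t n (p₀, e₀))).1| ≤
            (1 / 2) ^ (2 * n) := by
      intro ns A hns hA
      have htopA : ∀ i, Tendsto (fun k => (y (ns k)).1.1.top i) atTop (𝓝 (A.top i)) := fun i =>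
        (((continuous_apply i).comp continuous_top).tendsto A).comp hA
      refine ⟨funext fun i => tendsto_nhds_unique (htopA i) ((hpx i).comp hns),
        le_of_tendsto_of_tendsto' (hslack.comp hns) ((hLc.tendsto A).comp hA)
          fun k => (y (ns k)).2.2.1, fun i => ?_, fun n => ?_⟩
      · exact le_of_tendsto_of_tendsto' ((htopA i).sub
          ((((continuous_apply i).comp continuous_low).tendsto A).comp hA)) ((hpe i).comp hns)
          fun k => (y (ns k)).2.2.2 i
      · have h1 := tendsto_supOn_cut (hφ n.unpair.1) hA
          ((((htc n).tendsto (p₀, e₀)).comp (hp.prodMk_nhds he)).comp hns)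
        refine le_of_tendsto (((tendsto_pi_nhds.1 he (2 * n)).comp hns).sub h1).abs ?_
        filter_upwards [hns.eventually_gt_atTop n] with k hk using (hd (ns k) n hk).le
    have hsub : ∀ ns : ℕ → ℕ, Tendsto ns atTop atTop → ∃ A, ∃ σ : ℕ → ℕ, StrictMono σ ∧
        Tendsto (fun k => (y (ns (σ k))).1.1) atTop (𝓝 A) := fun ns hns => by
      refine exists_subseq_tendsto_of_bounded (fun k => (y (ns k)).1.1)
        (fun i => ((hpx i).comp hns).isBoundedUnder_le) fun i => ?_
      refine (((hpx i).sub (hpe i)).comp hns).isBoundedUnder_ge.mono_ge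
        (Eventually.of_forall fun k => ?_)
      exact sub_le_comm.1 ((y (ns k)).2.2.2 i)
    obtain ⟨A, σ, hσ, hA⟩ := hsub id tendsto_id
    obtain ⟨hA1, hA2, hA3, hA4⟩ := hlim hσ.tendsto_atTop hA
    have hconv : Tendsto (fun k => (y k).1.1) atTop (𝓝 A) := by
      refine tendsto_of_subseq_tendsto fun ns hns => ?_
      obtain ⟨A', σ', hσ', hA'⟩ := hsub ns hns
      obtain ⟨-, hA2', -, hA4'⟩ := hlim (hns.comp hσ'.tendsto_atTop) hA'
      have heq : A' = A := eq_of_consistent hLc hLanti hLstrict hφ hsep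
        (fun n => htI n (p₀, e₀)) (fun n => htanti n (p₀, e₀)) hpos
        (fun n => htprog n (p₀, e₀)) hA2' hA2 hA4' hA4
      exact ⟨σ', heq ▸ hA'⟩
    exact ⟨⟨(A, p₀.2), hpos.trans_le hA2, by rw [hA1]; exact hA2, hA3⟩,
      tendsto_subtype_rng.2 (hconv.prodMk_nhds hpu)⟩

end MaxPlusCompacts

namespace MaxPlusCompacts

variable {X : Set (ℕ → ℝ)} {L : MaxPlusCompacts → ℝ}

/-- The members of the hyperspace contained in `X`. -/
abbrev Inside (X : Set (ℕ → ℝ)) := {A : MaxPlusCompacts // (A.1 : Set (ℕ → ℝ)) ⊆ X}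

theorem metrizableSpace : TopologicalSpace.MetrizableSpace MaxPlusCompacts :=
  IsEmbedding.subtypeVal.metrizableSpace

theorem nonempty_homeomorph_inside_padded (hLX : ∀ A, 0 < L A ↔ (A.1 : Set (ℕ → ℝ)) ⊆ X)
    (hLc : Continuous L) : Nonempty (Inside X × (ℕ → ℝ) ≃ₜ Padded L × (ℕ → ℝ)) := by
  have := metrizableSpace
  have : TopologicalSpace.MetrizableSpace (Inside X) := IsEmbedding.subtypeVal.metrizableSpace
  let c : ℕ → Inside X → ℝ := fun j A =>
    Nat.casesOn j (L (point A.1.top) / L A.1 - 1) fun i => A.1.top i - A.1.low i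
  have hpos : ∀ A : Inside X, 0 < L A.1 := fun A => (hLX _).2 A.2
  have hc : ∀ j, Continuous (c j) := by
    rintro (_ | i)
    · exact ((hLc.comp (continuous_point.comp (continuous_top.comp continuous_subtype_val))).div
        (hLc.comp continuous_subtype_val) fun A => (hpos A).ne').sub continuous_const
    · exact ((continuous_apply i).comp (continuous_top.comp continuous_subtype_val)).sub
        ((continuous_apply i).comp (continuous_low.comp continuous_subtype_val))
  have hiff : ∀ (A : Inside X) (u : ℕ → ℝ), (∀ j, c j A ≤ Real.exp (u j)) ↔
      slack L A.1.top u ≤ L A.1 ∧ ∀ i, A.1.top i - A.1.low i ≤ Real.exp (u (i + 1)) := by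
    intro A u
    have h0 : c 0 A ≤ Real.exp (u 0) ↔ slack L A.1.top u ≤ L A.1 := by
      change L (point A.1.top) / L A.1 - 1 ≤ _ ↔ _ / _ ≤ _
      rw [sub_le_iff_le_add', div_le_iff₀ (hpos A), div_le_iff₀ (by positivity), mul_comm]
    rw [← h0]
    exact ⟨fun h => ⟨h 0, fun i => h (i + 1)⟩, fun h j => Nat.casesOn j h.1 h.2⟩
  obtain ⟨Φ⟩ := nonempty_homeomorph_epigraph hc
  let Ψ : {z : Inside X × (ℕ → ℝ) // ∀ j, c j z.1 ≤ Real.exp (z.2 j)} ≃ₜ Padded L :=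
    { toFun := fun z => ⟨(z.1.1.1, z.1.2), hpos _, (hiff z.1.1 z.1.2).1 z.2⟩
      invFun := fun y => ⟨(⟨y.1.1, (hLX _).1 y.2.1⟩, y.1.2),
        (hiff ⟨y.1.1, (hLX _).1 y.2.1⟩ y.1.2).2 y.2.2⟩
      left_inv := fun _ => rfl
      right_inv := fun _ => rfl
      continuous_toFun := by fun_prop
      continuous_invFun := by fun_prop }
  exact ⟨Φ.symm.trans (Ψ.prodCongr (Homeomorph.refl _))⟩

theorem nonempty_homeomorph_inside_prod (hX : IsOpen X) :
    Nonempty (Inside X × (ℕ → ℝ) ≃ₜ Inside X) := by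
  have := metrizableSpace
  have : TopologicalSpace.MetrizableSpace {B : MaxPlusCompacts // B.top = 0} :=
    IsEmbedding.subtypeVal.metrizableSpace
  obtain ⟨L, hLc, hLX, -⟩ := exists_level hX
  have hs : Continuous fun z : {B : MaxPlusCompacts // B.top = 0} × (ℕ → ℝ) => shift z.2 z.1.1 :=
    continuous_shift.comp (f := fun z : {B : MaxPlusCompacts // B.top = 0} × (ℕ → ℝ) =>
      (z.2, z.1.1)) (by fun_prop)
  let O : Set ({B : MaxPlusCompacts // B.top = 0} × (ℕ → ℝ)) :=
    {z | ((shift z.2 z.1.1).1 : Set (ℕ → ℝ)) ⊆ X}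
  have hO : IsOpen O := by
    simp only [O, ← hLX]
    exact isOpen_lt continuous_const (hLc.comp hs)
  obtain ⟨Φ⟩ := nonempty_homeomorph_open_prod hO
  have hback : ∀ A : MaxPlusCompacts, shift A.top (shift (-A.top) A) = A := fun A => by
    rw [shift_shift, neg_add_cancel, shift_zero]
  let Ψ : Inside X ≃ₜ O :=
    { toFun := fun A => ⟨(⟨shift (-A.1.top) A.1, by rw [top_shift, add_neg_cancel]⟩, A.1.top), by
        change ((shift A.1.top (shift (-A.1.top) A.1)).1 : Set (ℕ → ℝ)) ⊆ X
        rw [hback]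
        exact A.2⟩
      invFun := fun z => ⟨shift z.1.2 z.1.1.1, z.2⟩
      left_inv := fun A => Subtype.ext (hback A.1)
      right_inv := by
        rintro ⟨⟨⟨B, hB⟩, x⟩, hz⟩
        have h1 : (shift x B).top = x := by rw [top_shift, hB, zero_add]
        refine Subtype.ext (Prod.ext (Subtype.ext ?_) h1)
        change shift (-(shift x B).top) (shift x B) = B
        rw [h1, shift_shift, add_neg_cancel, shift_zero]
      continuous_toFun := by
        have ht : Continuous fun A : Inside X => A.1.top :=
          continuous_top.comp continuous_subtype_val
        exact (((continuous_shift.comp (f := fun A : Inside X => (-A.1.top, A.1))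
          (ht.neg.prodMk continuous_subtype_val)).subtype_mk _).prodMk ht).subtype_mk _
      continuous_invFun := (hs.comp continuous_subtype_val).subtype_mk _ }
  exact ⟨((Ψ.prodCongr (Homeomorph.refl _)).trans Φ).trans Ψ.symm⟩

end MaxPlusCompacts

theorem IsOpen.nonempty_homeomorph_prod {X : Set (ℕ → ℝ)} (hX : IsOpen X) :
    Nonempty (X × (ℕ → ℝ) ≃ₜ X) := by
  let θ : PUnit.{1} × (ℕ → ℝ) ≃ₜ (ℕ → ℝ) := Homeomorph.punitProd _
  obtain ⟨Φ⟩ := nonempty_homeomorph_open_prod (hX.preimage θ.continuous)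
  let σ : ↥(θ ⁻¹' X) ≃ₜ ↥X := θ.sets rfl
  exact ⟨((σ.symm.prodCongr (Homeomorph.refl _)).trans Φ).trans σ⟩

/-- Members of the hyperspace as bundled compact sets. -/
def MPCCIn.equivInside (X : Set (ℕ → ℝ)) : MPCCIn X ≃ MaxPlusCompacts.Inside X where
  toFun A := ⟨⟨⟨⟨A.1, A.2.2.1⟩, A.2.1⟩, A.2.2.2.1⟩, A.2.2.2.2⟩
  invFun A := ⟨A.1.1, A.1.1.nonempty, A.1.1.isCompact, A.1.2, A.2⟩
  left_inv _ := rfl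
  right_inv _ := rfl

theorem vietoris_eq_induced (X : Set (ℕ → ℝ)) :
    vietoris (fun A : Set (ℕ → ℝ) => A.Nonempty ∧ IsCompact A ∧ MaxPlusConvex A ∧ A ⊆ X) =
      TopologicalSpace.induced (MPCCIn.equivInside X) inferInstance := by
  have h : TopologicalSpace.induced (MPCCIn.equivInside X) inferInstance =
      TopologicalSpace.induced Subtype.val (TopologicalSpace.vietoris (ℕ → ℝ)) := by
    have h1 : IsInducing fun A : MaxPlusCompacts.Inside X => A.1.1 :=
      IsInducing.subtypeVal.comp IsInducing.subtypeVal
    have h2 : (inferInstance : TopologicalSpace (TopologicalSpace.NonemptyCompacts (ℕ → ℝ))) =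
      TopologicalSpace.induced SetLike.coe (TopologicalSpace.vietoris (ℕ → ℝ)) := rfl
    rw [h1.eq_induced]
    exact (congrArg _ (congrArg _ h2)).trans (by rw [induced_compose, induced_compose]; rfl)
  rw [h, vietoris, TopologicalSpace.vietoris, induced_generateFrom_eq, image_union, image_image,
    image_image]
  congr 1
  ext S
  constructor
  · rintro ⟨U, hU, rfl | rfl⟩
    exacts [Or.inl ⟨U, hU, rfl⟩, Or.inr ⟨U, hU, rfl⟩]
  · rintro (⟨U, hU, rfl⟩ | ⟨U, hU, rfl⟩)
    exacts [⟨U, hU, Or.inl rfl⟩, ⟨U, hU, Or.inr rfl⟩]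

/-- For an open subset `X` of `ℕ → ℝ`, the hyperspace of nonempty compact max-plus
convex subsets contained in `X` is homeomorphic to `X`. -/
theorem mpccIn_homeomorph (X : Set (ℕ → ℝ)) (hX : IsOpen X) :
    letI : TopologicalSpace (MPCCIn X) := vietoris _
    Nonempty (MPCCIn X ≃ₜ ↥X) := by
  let : TopologicalSpace (MPCCIn X) := vietoris _
  have := MaxPlusCompacts.metrizableSpace
  obtain ⟨L, hLc, hLX, hLanti, hLstrict⟩ := exists_level hX
  have : TopologicalSpace.MetrizableSpace (MaxPlusCompacts.Padded L) :=
    IsEmbedding.subtypeVal.metrizableSpace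
  obtain ⟨a⟩ := MaxPlusCompacts.nonempty_homeomorph_inside_prod hX
  obtain ⟨b⟩ := MaxPlusCompacts.nonempty_homeomorph_inside_padded hLX hLc
  obtain ⟨c⟩ := MaxPlusCompacts.nonempty_homeomorph_padded hLX hLc hLanti hLstrict
  obtain ⟨d⟩ := hX.nonempty_homeomorph_prod
  have hind : IsInducing (MPCCIn.equivInside X) := ⟨vietoris_eq_induced X⟩
  exact ⟨((((((MPCCIn.equivInside X).toHomeomorphOfIsInducing hind).trans a.symm).trans b).trans
    c).trans (d.prodCongr (Homeomorph.refl _))).trans d⟩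
end

section
/- Let X be an open subset of ℕ → ℝ and mpcc(X) the hyperspace of nonempty compact max-plus convex subsets of ℕ → ℝ contained in X, with the Hausdorff metric topology. Define H : mpcc(X) × [0,1] → mpcc(X) by H(A, 0) = A and, for t > 0, H(A, t) = { fun n => max (a n) (Real.log t + sup_{b ∈ A} b n) | a ∈ A }. Then H is well defined (each H(A, t) is a nonempty compact max-plus convex subset contained in X) and continuous, H(A, 1) is the singleton of the pointwise supremum of A, and H({x}, t) = {x} for every x ∈ X and t ∈ [0,1]. Consequently, the subspace of singletons { A ∈ mpcc(X) | ∃ x, A = {x} } is a strong deformation retract of mpcc(X), and mpcc(X) is homotopy equivalent to X. -/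
/-- The pointwise supremum of a set of functions `ℕ → ℝ`. -/
noncomputable def mSup (A : Set (ℕ → ℝ)) : ℕ → ℝ :=
  fun n => sSup ((fun a => a n) '' A)

lemma singleton_mem {X : Set (ℕ → ℝ)} {x : ℕ → ℝ} (hx : x ∈ X) :
    ({x} : Set (ℕ → ℝ)).Nonempty ∧ IsCompact ({x} : Set (ℕ → ℝ)) ∧
      MaxPlusConvex ({x} : Set (ℕ → ℝ)) ∧ ({x} : Set (ℕ → ℝ)) ⊆ X := by
  refine ⟨Set.singleton_nonempty x, isCompact_singleton, ?_,
    Set.singleton_subset_iff.mpr hx⟩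
  intro a ha b hb t ht
  rw [Set.mem_singleton_iff] at ha hb ⊢
  subst ha; subst hb
  funext i
  exact max_eq_left (by linarith)

section Vietoris

attribute [local instance] vietoris

variable {Y Z P : Type*} [TopologicalSpace Y] [TopologicalSpace Z] [TopologicalSpace P]
  {p : Set Y → Prop} {q : Set Z → Prop}

lemma isOpen_vietoris_subset {U : Set Y} (hU : IsOpen U) :
    IsOpen {K : {A : Set Y // p A} | (K : Set Y) ⊆ U} :=
  TopologicalSpace.isOpen_generateFrom_of_mem ⟨U, hU, Or.inl rfl⟩

lemma isOpen_vietoris_inter_nonempty {U : Set Y} (hU : IsOpen U) :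
    IsOpen {K : {A : Set Y // p A} | ((K : Set Y) ∩ U).Nonempty} :=
  TopologicalSpace.isOpen_generateFrom_of_mem ⟨U, hU, Or.inr rfl⟩

/-- A family of images of compact sets under a jointly continuous map is continuous for the
Vietoris topology, both in the set and in the parameter. -/
lemma continuous_vietoris_of_eq_image (hp : ∀ A, p A → IsCompact A) {φ : Y × P → Z}
    (hφ : Continuous φ) {T : Type*} [TopologicalSpace T] {K : T → {A : Set Y // p A}}
    (hK : Continuous K) {g : T → P} (hg : Continuous g) {F : T → {B : Set Z // q B}}
    (hF : ∀ x, (F x : Set Z) = (fun a => φ (a, g x)) '' (K x : Set Y)) :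
    Continuous F := by
  refine continuous_generateFrom_iff.2 ?_
  rintro S ⟨U, hU, rfl | rfl⟩
  · refine isOpen_iff_mem_nhds.2 ?_
    intro x hA
    simp only [Set.mem_preimage, Set.mem_ofPred_eq, hF, Set.image_subset_iff] at hA
    obtain ⟨V, W, hV, hW, hAV, huW, hVW⟩ :=
      generalized_tube_lemma (hp _ (K x).2) (isCompact_singleton (x := g x)) (hU.preimage hφ)
        (by rintro ⟨a, v⟩ ⟨ha, rfl⟩; exact hA ha)
    filter_upwards [((isOpen_vietoris_subset hV).preimage hK).mem_nhds hAV,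
      (hW.preimage hg).mem_nhds (huW rfl)]
      with y hB hv
    simp only [Set.mem_preimage, Set.mem_ofPred_eq, hF, Set.image_subset_iff]
    exact fun b hb => hVW ⟨hB hb, hv⟩
  · refine isOpen_iff_mem_nhds.2 ?_
    intro x hA
    simp only [Set.mem_preimage, Set.mem_ofPred_eq, hF] at hA
    obtain ⟨-, ⟨a, ha, rfl⟩, hz⟩ := hA
    obtain ⟨V, W, hV, hW, haV, huW, hVW⟩ := isOpen_prod_iff.1 (hU.preimage hφ) a (g x) hz
    filter_upwards [((isOpen_vietoris_inter_nonempty hV).preimage hK).mem_nhds ⟨a, ha, haV⟩,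
      (hW.preimage hg).mem_nhds huW]
      with y ⟨b, hb, hbV⟩ hv
    simp only [Set.mem_preimage, Set.mem_ofPred_eq, hF]
    exact ⟨φ (b, g y), ⟨b, hb, rfl⟩, hVW ⟨hbV, hv⟩⟩

lemma continuous_vietoris_of_eq_singleton {f : Y → Z} (hf : Continuous f)
    {F : Y → {B : Set Z // q B}} (hF : ∀ y, (F y : Set Z) = {f y}) : Continuous F := by
  refine continuous_generateFrom_iff.2 ?_
  rintro S ⟨U, hU, rfl | rfl⟩ <;>
  · convert hU.preimage hf using 1
    ext y
    simp [hF]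

end Vietoris

lemma bddAbove_eval_image {A : Set (ℕ → ℝ)} (hA : IsCompact A) (n : ℕ) :
    BddAbove ((fun a : ℕ → ℝ => a n) '' A) :=
  (hA.image (continuous_apply n)).bddAbove

lemma le_mSup {A : Set (ℕ → ℝ)} (hA : IsCompact A) {a : ℕ → ℝ} (ha : a ∈ A) (n : ℕ) :
    a n ≤ mSup A n :=
  le_csSup (bddAbove_eval_image hA n) ⟨a, ha, rfl⟩

lemma exists_mem_eq_mSup {A : Set (ℕ → ℝ)} (hne : A.Nonempty) (hA : IsCompact A) (n : ℕ) :
    ∃ a ∈ A, a n = mSup A n :=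
  (hA.image (continuous_apply n)).sSup_mem (hne.image _)

@[simp] lemma mSup_singleton (x : ℕ → ℝ) : mSup {x} = x := by
  ext n
  simp [mSup]

lemma MaxPlusConvex.sup_mem {ι : Type*} {A : Set (ι → ℝ)} (hA : MaxPlusConvex A)
    {a b : ι → ℝ} (ha : a ∈ A) (hb : b ∈ A) : a ⊔ b ∈ A := by
  simpa [Pi.sup_def] using hA a ha b hb 0 le_rfl

/-- A nonempty compact max-plus convex set contains its pointwise supremum. -/
lemma mSup_mem {A : Set (ℕ → ℝ)} (hne : A.Nonempty) (hA : IsCompact A)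
    (hconv : MaxPlusConvex A) : mSup A ∈ A := by
  choose a ha hmax using exists_mem_eq_mSup hne hA
  have hmem : ∀ n, partialSups a n ∈ A := by
    intro n
    induction n with
    | zero => simpa using ha 0
    | succ n ih =>
      rw [partialSups_add_one]
      exact hconv.sup_mem ih (ha _)
  refine hA.isClosed.mem_of_tendsto (f := fun n => partialSups a n) (b := Filter.atTop) ?_
    (Filter.Eventually.of_forall hmem)
  refine tendsto_pi_nhds.2 fun n => tendsto_const_nhds.congr' ?_
  filter_upwards [Filter.eventually_ge_atTop n] with m hm
  refine le_antisymm ?_ (le_mSup hA (hmem m) n)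
  rw [← hmax n]
  exact le_partialSups_of_le a hm n

/-- The max-plus combination `max a (log t + s)`, written so as to extend continuously to `t = 0`,
where its value is `a`. -/
noncomputable def maxPlusPath (a s : ℕ → ℝ) (t : ℝ) : ℕ → ℝ :=
  fun n => Real.log (max (Real.exp (a n)) (t * Real.exp (s n)))

lemma continuous_maxPlusPath :
    Continuous fun x : (ℕ → ℝ) × (ℕ → ℝ) × ℝ => maxPlusPath x.1 x.2.1 x.2.2 := by
  refine continuous_pi fun n => Continuous.log ?_ fun x =>
    (lt_max_of_lt_left (Real.exp_pos _)).ne'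
  fun_prop

@[simp] lemma maxPlusPath_zero (a s : ℕ → ℝ) : maxPlusPath a s 0 = a := by
  ext n
  simp [maxPlusPath, (Real.exp_pos (a n)).le]

lemma maxPlusPath_of_pos (a s : ℕ → ℝ) {t : ℝ} (ht : 0 < t) :
    maxPlusPath a s t = fun n => max (a n) (Real.log t + s n) := by
  ext n
  have h : t * Real.exp (s n) = Real.exp (Real.log t + s n) := by
    rw [Real.exp_add, Real.exp_log ht]
  rw [maxPlusPath, h, ← Real.exp_monotone.map_max, Real.log_exp]

lemma maxPlusPath_self (x : ℕ → ℝ) {t : ℝ} (ht0 : 0 ≤ t) (ht1 : t ≤ 1) :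
    maxPlusPath x x t = x := by
  rcases ht0.eq_or_lt with rfl | ht
  · simp
  · rw [maxPlusPath_of_pos _ _ ht]
    ext n
    simpa using Real.log_nonpos ht0 ht1

lemma MaxPlusConvex.maxPlusPath_mem {A : Set (ℕ → ℝ)} (hA : MaxPlusConvex A) {a s : ℕ → ℝ}
    (ha : a ∈ A) (hs : s ∈ A) {t : ℝ} (ht0 : 0 ≤ t) (ht1 : t ≤ 1) : maxPlusPath a s t ∈ A := by
  rcases ht0.eq_or_lt with rfl | ht
  · simpa using ha
  · rw [maxPlusPath_of_pos _ _ ht]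
    exact hA a ha s hs _ (Real.log_nonpos ht0 ht1)

lemma MaxPlusConvex.image_maxPlusPath {A : Set (ℕ → ℝ)} (hA : MaxPlusConvex A) (s : ℕ → ℝ)
    {t : ℝ} (ht0 : 0 ≤ t) : MaxPlusConvex ((fun a => maxPlusPath a s t) '' A) := by
  rcases ht0.eq_or_lt with rfl | ht
  · simpa using hA
  · rintro _ ⟨a, ha, rfl⟩ _ ⟨b, hb, rfl⟩ u hu
    refine ⟨_, hA a ha b hb u hu, ?_⟩
    simp only [maxPlusPath_of_pos _ _ ht]
    ext n
    grind

/-- The homotopy on `MPCCIn X` that moves each set to the singleton of its pointwise supremum. -/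
noncomputable def mpccHomotopy (X : Set (ℕ → ℝ)) (x : MPCCIn X × unitInterval) : MPCCIn X :=
  ⟨(fun a => maxPlusPath a (mSup x.1) x.2) '' x.1, by
    obtain ⟨⟨A, hne, hc, hconv, hAX⟩, t⟩ := x
    refine ⟨hne.image _, hc.image ?_, hconv.image_maxPlusPath _ t.2.1, ?_⟩
    · exact continuous_maxPlusPath.comp (by fun_prop : Continuous fun a => (a, mSup A, (t : ℝ)))
    · rintro _ ⟨a, ha, rfl⟩
      exact hAX (hconv.maxPlusPath_mem ha (mSup_mem hne hc hconv) t.2.1 t.2.2)⟩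

section Homotopy

attribute [local instance] vietoris

variable {X : Set (ℕ → ℝ)}

lemma continuous_mSup {p : Set (ℕ → ℝ) → Prop} (hp : ∀ A, p A → A.Nonempty ∧ IsCompact A) :
    Continuous fun A : {A : Set (ℕ → ℝ) // p A} => mSup A := by
  refine continuous_pi fun n => OrderTopology.continuous_iff.2 fun r => ⟨?_, ?_⟩
  · convert isOpen_vietoris_inter_nonempty (p := p)
      ((isOpen_Ioi (a := r)).preimage (continuous_apply (A := fun _ : ℕ => ℝ) n)) using 1
    ext A
    obtain ⟨hne, hc⟩ := hp A A.2
    obtain ⟨a, ha, hmax⟩ := exists_mem_eq_mSup hne hc n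
    constructor
    · intro h
      exact ⟨a, ha, lt_of_lt_of_eq h hmax.symm⟩
    · rintro ⟨b, hb, hr⟩
      exact lt_of_lt_of_le hr (le_mSup hc hb n)
  · convert isOpen_vietoris_subset (p := p)
      ((isOpen_Iio (a := r)).preimage (continuous_apply (A := fun _ : ℕ => ℝ) n)) using 1
    ext A
    obtain ⟨hne, hc⟩ := hp A A.2
    obtain ⟨a, ha, hmax⟩ := exists_mem_eq_mSup hne hc n
    constructor
    · intro h b hb
      exact lt_of_le_of_lt (le_mSup hc hb n) h
    · intro h
      exact lt_of_eq_of_lt hmax.symm (h ha)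

lemma continuous_mSup_mpccIn : Continuous fun A : MPCCIn X => mSup A :=
  continuous_mSup fun _ h => ⟨h.1, h.2.1⟩

lemma continuous_mpccHomotopy : Continuous (mpccHomotopy X) := by
  refine continuous_vietoris_of_eq_image (fun _ h => h.2.1) continuous_maxPlusPath
    continuous_fst (g := fun x : MPCCIn X × unitInterval => (mSup x.1, (x.2 : ℝ))) ?_
    fun _ => rfl
  exact (continuous_mSup_mpccIn.comp continuous_fst).prodMk
    (continuous_subtype_val.comp continuous_snd)

lemma mpccHomotopy_zero (A : MPCCIn X) : mpccHomotopy X (A, 0) = A :=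
  Subtype.ext (by simp [mpccHomotopy])

lemma mpccHomotopy_one (A : MPCCIn X) :
    (mpccHomotopy X (A, 1) : Set (ℕ → ℝ)) = {mSup (A : Set (ℕ → ℝ))} := by
  have h : ∀ a ∈ (A : Set (ℕ → ℝ)), maxPlusPath a (mSup A) 1 = mSup A := by
    intro a ha
    rw [maxPlusPath_of_pos _ _ one_pos]
    ext n
    simpa using le_mSup A.2.2.1 ha n
  simpa [mpccHomotopy, Set.image_congr h] using A.2.1.image_const (mSup (A : Set (ℕ → ℝ)))

lemma mpccHomotopy_of_eq_singleton (A : MPCCIn X) (t : unitInterval) {x : ℕ → ℝ}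
    (hA : (A : Set (ℕ → ℝ)) = {x}) : mpccHomotopy X (A, t) = A :=
  Subtype.ext (by simp [mpccHomotopy, hA, maxPlusPath_self x t.2.1 t.2.2])

/-- `MPCCIn X` is homotopy equivalent to `X`, through the pointwise supremum and the embedding of
points as singletons. -/
noncomputable def mpccInHomotopyEquiv (X : Set (ℕ → ℝ)) :
    ContinuousMap.HomotopyEquiv (MPCCIn X) X where
  toFun := ⟨fun A => ⟨mSup A, A.2.2.2.2 (mSup_mem A.2.1 A.2.2.1 A.2.2.2.1)⟩,
    continuous_mSup_mpccIn.subtype_mk _⟩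
  invFun := ⟨fun x => ⟨{(x : ℕ → ℝ)}, singleton_mem x.2⟩,
    continuous_vietoris_of_eq_singleton continuous_subtype_val fun _ => rfl⟩
  left_inv := ContinuousMap.Homotopic.symm
    ⟨{  toFun := fun x => mpccHomotopy X (x.2, x.1)
        continuous_toFun := continuous_mpccHomotopy.comp continuous_swap
        map_zero_left := mpccHomotopy_zero
        map_one_left := fun A => Subtype.ext (mpccHomotopy_one A) }⟩
  right_inv := by
    convert ContinuousMap.Homotopic.refl (ContinuousMap.id X) using 1
    ext x : 2
    exact mSup_singleton _

end Homotopy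

/-- For an open `X ⊆ ℕ → ℝ` there is a homotopy `H` on `mpcc(X)` with `H(A,0) = A`,
`H(A,t) = { a ⊕ (log t) ⊙ max A | a ∈ A }` for `t > 0` (so `H(A,1)` is the singleton of
the pointwise supremum of `A`), fixing all singletons; hence the subspace of singletons
is a strong deformation retract of `mpcc(X)` and `mpcc(X)` is homotopy equivalent to `X`. -/
theorem mpccIn_deformation_retract (X : Set (ℕ → ℝ)) (hX : IsOpen X) :
    letI : TopologicalSpace (MPCCIn X) := vietoris _
    ∃ H : MPCCIn X × unitInterval → MPCCIn X,
      Continuous H ∧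
      (∀ A : MPCCIn X, H (A, 0) = A) ∧
      (∀ (A : MPCCIn X) (t : unitInterval), 0 < (t : ℝ) →
        (H (A, t) : Set (ℕ → ℝ)) =
          {x | ∃ a ∈ (A : Set (ℕ → ℝ)),
            x = fun n => max (a n) (Real.log t + mSup (A : Set (ℕ → ℝ)) n)}) ∧
      (∀ A : MPCCIn X,
        (H (A, 1) : Set (ℕ → ℝ)) = {mSup (A : Set (ℕ → ℝ))}) ∧
      (∀ (x : ℕ → ℝ) (hx : x ∈ X) (t : unitInterval),
        H (⟨{x}, singleton_mem hx⟩, t) = ⟨{x}, singleton_mem hx⟩) ∧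
      (∀ (A : MPCCIn X) (t : unitInterval),
        (∃ x : ℕ → ℝ, (A : Set (ℕ → ℝ)) = {x}) →
          H (A, t) = A) ∧
      Nonempty (ContinuousMap.HomotopyEquiv (MPCCIn X) ↥X) := by
  refine ⟨mpccHomotopy X, continuous_mpccHomotopy, mpccHomotopy_zero, ?_, mpccHomotopy_one,
    fun x hx t => mpccHomotopy_of_eq_singleton _ t rfl,
    fun A t ⟨x, hx⟩ => mpccHomotopy_of_eq_singleton A t hx, ⟨mpccInHomotopyEquiv X⟩⟩
  intro A t ht
  ext x
  simp [mpccHomotopy, maxPlusPath_of_pos _ _ ht, eq_comm]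
end
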